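/- Let H_n denote the height (length of the longest path from the root to a leaf) of the left tree of a uniformly random tanglegram of size n. Then the expected value of H_n is asymptotically equal to 2√(πn) as n → ∞. -/

import Mathlib

open scoped Classical

inductive PTree : Type
  | leaf : PTree
  | node : PTree → PTree → PTree
deriving DecidableEq

namespace PTree

def size : PTree → ℕ
  | leaf => 1
  | node l r => size l + size r

def cherries : PTree → ℕ
  | leaf => 0
  | node leaf leaf => 1
  | node l r => cherries l + cherries r

def height : PTree → ℕ
  | leaf => 0
  | node l r => max (height l) (height r) + 1

def encode : PTree → ℕ
  | leaf => 0
  | node l r => Nat.pair (encode l) (encode r) + 1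

def normalize : PTree → PTree
  | leaf => leaf
  | node l r =>
      let l' := normalize l
      let r' := normalize r
      if encode l' ≤ encode r' then node l' r' else node r' l'

def isoFuns : PTree → PTree → List (ℕ → ℕ)
  | leaf, leaf => [fun i => i]
  | node l r, node l' r' =>
      ((isoFuns l l').flatMap fun g => (isoFuns r r').map fun h =>
        fun i => if i < l.size then g i else h (i - l.size) + l'.size)
      ++
      ((isoFuns l r').flatMap fun g => (isoFuns r l').map fun h =>
        fun i => if i < l.size then g i + l'.size else h (i - l.size))
  | _, _ => []

def planeTrees : ℕ → Finset PTree
  | 0 => ∅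
  | 1 => {leaf}
  | n + 2 =>
      (Finset.range (n + 1)).attach.biUnion fun k =>
        ((planeTrees (k.1 + 1)) ×ˢ (planeTrees (n + 1 - k.1))).image
          fun p => node p.1 p.2
  termination_by n => n
  decreasing_by
  · have := Finset.mem_range.mp k.2; omega
  · omega

def binTrees (n : ℕ) : Finset PTree := (planeTrees n).image normalize

/-- Triples (T, v, S): left plane tree, right plane tree, and a matching `v`
(a permutation of `0, …, n-1`, encoded as the list of its values) matching
leaf `i` of `T` with leaf `v i` of `S`. -/
def Triples (n : ℕ) : Finset (PTree × PTree × List ℕ) :=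
  (planeTrees n) ×ˢ ((planeTrees n) ×ˢ (List.range n).permutations.toFinset)

/-- Two triples represent the same tanglegram iff there are isomorphisms of the left
trees and of the right trees compatible with the matchings. -/
def equivTriple (n : ℕ) (t t' : PTree × PTree × List ℕ) : Bool :=
  (isoFuns t.1 t'.1).any fun φ => (isoFuns t.2.1 t'.2.1).any fun ψ =>
    (List.range n).all fun i => t'.2.2.getD (φ i) 0 == ψ (t.2.2.getD i 0)

/-- The tanglegrams of size `n`: equivalence classes of triples. -/
def tangleClasses (n : ℕ) : Finset (Finset (PTree × PTree × List ℕ)) :=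
  (Triples n).image fun t => (Triples n).filter (fun t' => equivTriple n t t' = true)

/-- The number of tanglegrams of size `n`. -/
def numTanglegrams (n : ℕ) : ℕ := (tangleClasses n).card

/-- The probability that a uniformly random tanglegram of size `n` satisfies the
(isomorphism-invariant) property `P` of triples. -/
noncomputable def tangleProb (n : ℕ) (P : PTree × PTree × List ℕ → Prop) : ℝ :=
  ((tangleClasses n).filter fun c => ∃ t ∈ c, P t).card / numTanglegrams n

/-- The expectation of the statistic `f` of a uniformly random tanglegram of size `n`. -/
noncomputable def tangleExp (n : ℕ) (f : PTree × PTree × List ℕ → ℕ) : ℝ :=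
  ∑' k : ℕ, (k : ℝ) * tangleProb n (fun t => f t = k)

end PTree

namespace PTree

/-- The distribution on pairs of binary trees (canonical representatives) induced by
the two halves of a uniformly random tanglegram of size `n`:
probability that the pair of isomorphism classes of the two trees lies in `S`. -/
noncomputable def nuT (n : ℕ) (S : Finset (PTree × PTree)) : ℝ :=
  tangleProb n fun t => (normalize t.1, normalize t.2.1) ∈ S

/-- The distribution on pairs of binary trees induced by two independent uniformly
random plane binary trees with `n` leaves. -/
noncomputable def nuP (n : ℕ) (S : Finset (PTree × PTree)) : ℝ :=
  (((planeTrees n) ×ˢ (planeTrees n)).filter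
      fun p => (normalize p.1, normalize p.2) ∈ S).card / ((planeTrees n).card ^ 2 : ℝ)

/-- The total variation distance between `nuT` and `nuP`. -/
noncomputable def tvDist (n : ℕ) : ℝ :=
  ((binTrees n ×ˢ binTrees n).powerset).sup' (Finset.powerset_nonempty _)
    fun S => |nuT n S - nuP n S|

/-- The number of occurrences of (trees isomorphic to) `B` as a fringe subtree of `T`. -/
def occ (B : PTree) : PTree → ℕ
  | leaf => if normalize leaf = normalize B then 1 else 0
  | node l r => (if normalize (node l r) = normalize B then 1 else 0) + occ B l + occ B r

/-- The number of generators of the automorphism group of `T`: the number of internal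
vertices whose two branches are isomorphic. -/
def gens : PTree → ℕ
  | leaf => 0
  | node l r => (if normalize l = normalize r then 1 else 0) + gens l + gens r

/-- `T` has a root branch isomorphic to `B`. -/
def hasBranch (B : PTree) : PTree → Prop
  | leaf => False
  | node l r => normalize l = normalize B ∨ normalize r = normalize B

/-- The cherries of a plane binary tree whose leaves are numbered from `k` on
(left to right), as pairs of leaf positions. -/
def cherryList : PTree → ℕ → List (ℕ × ℕ)
  | leaf, _ => []
  | node leaf leaf, k => [(k, k + 1)]
  | node l r, k => cherryList l k ++ cherryList r (k + l.size)

/-- The number of matched cherries: cherries of `T` whose two leaves are matched by `L`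
to the two leaves of a cherry of `S`. -/
def matchedCherries (T S : PTree) (L : List ℕ) : ℕ :=
  (cherryList T 0).countP fun p =>
    (cherryList S 0).any fun q =>
      (L.getD p.1 0 == q.1 && L.getD p.2 0 == q.2) ||
      (L.getD p.1 0 == q.2 && L.getD p.2 0 == q.1)

/-- The number of automorphisms of the tanglegram represented by the triple `(T, L, S)`:
pairs of automorphisms of the two trees compatible with the matching `L`. -/
def tangleAutCount (T S : PTree) (L : List ℕ) : ℕ :=
  ((isoFuns T T).map fun a =>
    (isoFuns S S).countP fun b =>
      (List.range T.size).all fun i => L.getD (a i) 0 == b (L.getD i 0)).sum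

/-- The number of automorphisms of `T` whose cycle type is `μ(s) = 2^s 1^(n-2s)`,
i.e. involutions of the leaves moving exactly `2 s` leaves. -/
def autMuCount (T : PTree) (s : ℕ) : ℕ :=
  (isoFuns T T).countP fun f =>
    ((List.range T.size).all fun i => f (f i) == i) &&
    ((List.range T.size).countP fun i => !(f i == i)) == 2 * s

end PTree


namespace PTree

theorem size_pos (T : PTree) : 0 < T.size := by
  induction T with
  | leaf => simp [size]
  | node l r hl hr => simp only [size]; omega

theorem mem_planeTrees {n : ℕ} {T : PTree} : T ∈ planeTrees n ↔ T.size = n := by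
  induction n using planeTrees.induct generalizing T with
  | case1 => simpa [planeTrees] using (size_pos T).ne'
  | case2 =>
    cases T with
    | leaf => simp [planeTrees, size]
    | node l r =>
      have := size_pos l
      have := size_pos r
      simp only [planeTrees, Finset.mem_singleton, reduceCtorEq, size, false_iff]
      omega
  | case3 n ih1 ih2 =>
    rw [planeTrees]
    simp only [Finset.mem_biUnion, Finset.mem_attach, true_and, Finset.mem_image,
      Finset.mem_product, Prod.exists]
    constructor
    · rintro ⟨k, l, r, ⟨hl, hr⟩, rfl⟩
      rw [ih1] at hl
      rw [ih2] at hr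
      have := Finset.mem_range.mp k.2
      simp only [size]
      omega
    · intro h
      cases T with
      | leaf => simp [size] at h
      | node l r =>
        have h1 := size_pos l
        have h2 := size_pos r
        simp only [size] at h
        refine ⟨⟨l.size - 1, Finset.mem_range.mpr (by omega)⟩, l, r, ⟨?_, ?_⟩, rfl⟩
        · rw [ih1]; simp; omega
        · rw [ih2]; simp; omega

theorem planeTrees_zero : planeTrees 0 = ∅ := by simp [planeTrees]

theorem planeTrees_one : planeTrees 1 = {leaf} := by simp [planeTrees]

theorem sum_planeTrees {M : Type*} [AddCommMonoid M] {n : ℕ} (hn : 2 ≤ n) (F : PTree → M) :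
    ∑ T ∈ planeTrees n, F T = ∑ p ∈ Finset.HasAntidiagonal.antidiagonal n,
      ∑ l ∈ planeTrees p.1, ∑ r ∈ planeTrees p.2, F (node l r) := by
  have h1 : ∀ p : ℕ × ℕ, ∑ l ∈ planeTrees p.1, ∑ r ∈ planeTrees p.2, F (node l r)
      = ∑ q ∈ planeTrees p.1 ×ˢ planeTrees p.2, F (node q.1 q.2) := fun p => by
    rw [Finset.sum_product]
  simp only [h1]
  rw [Finset.sum_sigma' (Finset.HasAntidiagonal.antidiagonal n)
    (fun p => planeTrees p.1 ×ˢ planeTrees p.2) (fun _ q => F (node q.1 q.2))]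
  symm
  refine Finset.sum_bij (fun x _ => node x.2.1 x.2.2) ?_ ?_ ?_ ?_
  · rintro ⟨p, l, r⟩ h
    simp only [Finset.mem_sigma, Finset.HasAntidiagonal.mem_antidiagonal, Finset.mem_product,
      mem_planeTrees] at h
    simp only [mem_planeTrees, size]
    omega
  · rintro ⟨⟨p1, p2⟩, l, r⟩ h ⟨⟨p1', p2'⟩, l', r'⟩ h' heq
    simp only [Finset.mem_sigma, Finset.HasAntidiagonal.mem_antidiagonal, Finset.mem_product,
      mem_planeTrees] at h h'
    simp only [node.injEq] at heq
    obtain ⟨rfl, rfl⟩ := heq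
    obtain ⟨-, rfl, rfl⟩ := h
    obtain ⟨-, rfl, rfl⟩ := h'
    rfl
  · intro T hT
    rw [mem_planeTrees] at hT
    cases T with
    | leaf => simp [size] at hT; omega
    | node l r =>
      refine ⟨⟨(l.size, r.size), l, r⟩, ?_, rfl⟩
      simpa [mem_planeTrees, size] using hT
  · intros; rfl

theorem sum_antidiagonal_mul_comm {R : Type*} [CommSemiring R] (n : ℕ) (a b : ℕ → R) :
    ∑ p ∈ Finset.HasAntidiagonal.antidiagonal n, a p.1 * b p.2 = ∑ p ∈ Finset.HasAntidiagonal.antidiagonal n, b p.1 * a p.2 := by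
  rw [← Finset.Nat.sum_antidiagonal_swap]
  exact Finset.sum_congr rfl fun p _ => mul_comm _ _

/-- The number of plane binary trees with `n` leaves. -/
noncomputable def numTrees (n : ℕ) : ℕ := (planeTrees n).card

theorem numTrees_zero : numTrees 0 = 0 := by simp [numTrees, planeTrees_zero]

theorem numTrees_one : numTrees 1 = 1 := by simp [numTrees, planeTrees_one]

theorem numTrees_eq_sum {n : ℕ} (hn : 2 ≤ n) :
    numTrees n = ∑ p ∈ Finset.HasAntidiagonal.antidiagonal n, numTrees p.1 * numTrees p.2 := by
  have := sum_planeTrees hn (fun _ => (1 : ℕ))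
  simpa [numTrees] using this

theorem numTrees_succ (n : ℕ) : numTrees (n + 1) = catalan n := by
  induction n using Nat.strong_induction_on with
  | _ n ih =>
    cases n with
    | zero => simp [numTrees_one]
    | succ n =>
      rw [numTrees_eq_sum (by omega), Finset.Nat.antidiagonal_succ, Finset.sum_cons,
        Finset.sum_map, numTrees_zero, zero_mul, zero_add, Finset.Nat.antidiagonal_succ',
        Finset.sum_cons, Finset.sum_map]
      simp only [Function.Embedding.prodMap, Function.Embedding.coeFn_mk, Prod.map,
        Function.Embedding.refl_apply, numTrees_zero, mul_zero, zero_add]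
      rw [catalan_succ']
      refine Finset.sum_congr rfl fun p hp => ?_
      have := Finset.HasAntidiagonal.mem_antidiagonal.mp hp
      simp only [Nat.succ_eq_add_one]
      rw [ih p.1 (by omega), ih p.2 (by omega)]

theorem numTrees_pos {n : ℕ} (hn : 1 ≤ n) : 0 < numTrees n := by
  obtain ⟨m, rfl⟩ := Nat.exists_eq_add_of_le' hn
  have h := succ_mul_catalan_eq_centralBinom m
  have := Nat.centralBinom_pos m
  rw [numTrees_succ]
  by_contra hc
  simp only [not_lt, nonpos_iff_eq_zero] at hc
  rw [hc] at h
  omega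

end PTree

namespace PTree

/-- The largest number of left steps on a path from the root to a leaf. -/
def leftHeight : PTree → ℕ
  | leaf => 0
  | node l r => max (leftHeight l + 1) (leftHeight r)

/-- The sum over the leaves of `s ^ (left steps) * t ^ (right steps)`. -/
noncomputable def leafWeight (s t : ℝ) : PTree → ℝ
  | leaf => 1
  | node l r => s * leafWeight s t l + t * leafWeight s t r

theorem leafWeight_nonneg {s t : ℝ} (hs : 0 ≤ s) (ht : 0 ≤ t) (T : PTree) :
    0 ≤ leafWeight s t T := by
  induction T with
  | leaf => simp [leafWeight]
  | node l r hl hr => simp only [leafWeight]; positivity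

theorem leafWeight_pos {s t : ℝ} (hs : 0 < s) (ht : 0 < t) (T : PTree) :
    0 < leafWeight s t T := by
  induction T with
  | leaf => simp [leafWeight]
  | node l r hl hr => simp only [leafWeight]; positivity

/-- The total number of leaves satisfies the convolution recursion. -/
theorem mul_numTrees_eq_sum {n : ℕ} (hn : 2 ≤ n) :
    ((n : ℝ) * numTrees n) = 2 * ∑ p ∈ Finset.HasAntidiagonal.antidiagonal n,
      ((p.1 : ℝ) * numTrees p.1) * numTrees p.2 := by
  have h := numTrees_eq_sum hn
  have h2 := sum_antidiagonal_mul_comm n (fun k => (k : ℝ) * numTrees k)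
    (fun k => (numTrees k : ℝ))
  rw [two_mul]
  nth_rewrite 2 [h2]
  rw [← Finset.sum_add_distrib, h, Nat.cast_sum, Finset.mul_sum]
  refine Finset.sum_congr rfl fun p hp => ?_
  rw [← Finset.HasAntidiagonal.mem_antidiagonal.mp hp]
  push_cast
  ring

theorem sum_leafWeight_le {s t : ℝ} (hs : 0 ≤ s) (ht : 0 ≤ t) (hst : s + t ≤ 2) (n : ℕ) :
    ∑ T ∈ planeTrees n, leafWeight s t T ≤ n * numTrees n := by
  induction n using Nat.strong_induction_on with
  | _ n ih =>
    obtain rfl | rfl | hn : n = 0 ∨ n = 1 ∨ 2 ≤ n := by omega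
    · simp [planeTrees_zero]
    · simp [planeTrees_one, leafWeight, numTrees_one]
    · have key : ∑ T ∈ planeTrees n, leafWeight s t T = (s + t) *
          ∑ p ∈ Finset.HasAntidiagonal.antidiagonal n,
            (∑ T ∈ planeTrees p.1, leafWeight s t T) * numTrees p.2 := by
        have h2 := sum_antidiagonal_mul_comm n (fun k => ∑ T ∈ planeTrees k, leafWeight s t T)
          (fun k => (numTrees k : ℝ))
        rw [add_mul]
        nth_rewrite 2 [h2]
        rw [sum_planeTrees hn, Finset.mul_sum, Finset.mul_sum, ← Finset.sum_add_distrib]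
        refine Finset.sum_congr rfl fun p _ => ?_
        simp only [leafWeight, Finset.sum_add_distrib, Finset.sum_const, ← Finset.mul_sum,
          nsmul_eq_mul, numTrees]
        ring
      rw [key, mul_numTrees_eq_sum hn]
      refine mul_le_mul hst (Finset.sum_le_sum fun p hp => ?_) ?_ (by norm_num)
      · by_cases h1 : p.2 = 0
        · simp [h1, numTrees_zero]
        · have := Finset.HasAntidiagonal.mem_antidiagonal.mp hp
          exact mul_le_mul_of_nonneg_right (ih p.1 (by omega)) (by positivity)
      · exact Finset.sum_nonneg fun p _ => mul_nonneg
          (Finset.sum_nonneg fun T _ => leafWeight_nonneg hs ht T) (by positivity)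

theorem exists_leaf_height {s t : ℝ} (hs : 0 ≤ s) (ht : 0 ≤ t) (T : PTree) :
    ∃ L R : ℕ, L + R = T.height ∧ L ≤ T.leftHeight ∧ s ^ L * t ^ R ≤ leafWeight s t T := by
  induction T with
  | leaf => exact ⟨0, 0, by simp [height, leftHeight, leafWeight]⟩
  | node l r hl hr =>
    have wl := leafWeight_nonneg hs ht l
    have wr := leafWeight_nonneg hs ht r
    rcases le_total (height r) (height l) with h | h
    · obtain ⟨L, R, h1, h2, h3⟩ := hl
      refine ⟨L + 1, R, by simp only [height]; omega, by simp only [leftHeight]; omega, ?_⟩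
      have := mul_le_mul_of_nonneg_left h3 hs
      have := mul_nonneg ht wr
      simp only [leafWeight]
      rw [pow_succ]; linarith
    · obtain ⟨L, R, h1, h2, h3⟩ := hr
      refine ⟨L, R + 1, by simp only [height]; omega, by simp only [leftHeight]; omega, ?_⟩
      have := mul_le_mul_of_nonneg_left h3 ht
      have := mul_nonneg hs wl
      simp only [leafWeight]
      rw [pow_succ]; linarith

theorem exists_leaf_leftHeight {s t : ℝ} (hs : 0 ≤ s) (ht : 0 ≤ t) (T : PTree) :
    ∃ L R : ℕ, L = T.leftHeight ∧ L + R ≤ T.height ∧ s ^ L * t ^ R ≤ leafWeight s t T := by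
  induction T with
  | leaf => exact ⟨0, 0, by simp [height, leftHeight, leafWeight]⟩
  | node l r hl hr =>
    have wl := leafWeight_nonneg hs ht l
    have wr := leafWeight_nonneg hs ht r
    rcases le_total (leftHeight r) (leftHeight l + 1) with h | h
    · obtain ⟨L, R, h1, h2, h3⟩ := hl
      refine ⟨L + 1, R, by simp only [leftHeight]; omega, by simp only [height]; omega, ?_⟩
      have := mul_le_mul_of_nonneg_left h3 hs
      have := mul_nonneg ht wr
      simp only [leafWeight]
      rw [pow_succ]; linarith
    · obtain ⟨L, R, h1, h2, h3⟩ := hr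
      refine ⟨L, R + 1, by simp only [leftHeight]; omega, by simp only [height]; omega, ?_⟩
      have := mul_le_mul_of_nonneg_left h3 ht
      have := mul_nonneg hs wl
      simp only [leafWeight]
      rw [pow_succ]; linarith

theorem sum_log_leafWeight_le {s t : ℝ} (hs : 0 < s) (ht : 0 < t) (hst : s + t ≤ 2) {n : ℕ}
    (hn : 1 ≤ n) :
    ∑ T ∈ planeTrees n, Real.log (leafWeight s t T) ≤ numTrees n * Real.log n := by
  have hn' : (0 : ℝ) < n := by exact_mod_cast hn
  have h1 : ∀ T ∈ planeTrees n, Real.log (leafWeight s t T)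
      ≤ Real.log n + (leafWeight s t T / n - 1) := fun T _ => by
    have hW := leafWeight_pos hs ht T
    have := Real.log_le_sub_one_of_pos (div_pos hW hn')
    rw [Real.log_div hW.ne' hn'.ne'] at this
    linarith
  refine (Finset.sum_le_sum h1).trans ?_
  have h2 := sum_leafWeight_le hs.le ht.le hst n
  simp only [Finset.sum_add_distrib, Finset.sum_sub_distrib, ← Finset.sum_div, Finset.sum_const,
    nsmul_eq_mul, mul_one]
  have h3 : (∑ T ∈ planeTrees n, leafWeight s t T) / n ≤ numTrees n := by
    rw [div_le_iff₀ hn']; linarith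
  simp only [numTrees] at *
  linarith

theorem exp_add_exp_le_two (e : ℝ) :
    Real.exp (e * (1 - e)) + Real.exp (-(e * (1 + e))) ≤ 2 := by
  have h := Real.cosh_le_exp_half_sq e
  rw [Real.cosh_eq] at h
  have h1 : Real.exp (e * (1 - e)) + Real.exp (-(e * (1 + e)))
      = Real.exp (-e ^ 2) * (Real.exp e + Real.exp (-e)) := by
    rw [mul_add (Real.exp (-e ^ 2)), ← Real.exp_add, ← Real.exp_add]
    congr 2 <;> ring
  have h2 : Real.exp (-e ^ 2) * Real.exp (e ^ 2 / 2) ≤ 1 := by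
    rw [← Real.exp_add]
    exact Real.exp_le_one_iff.mpr (by nlinarith [sq_nonneg e])
  rw [h1]
  nlinarith [Real.exp_pos (-e ^ 2)]

theorem height_le_leftHeight_add_log (e : ℝ) (he : 0 < e) (T : PTree) :
    (1 - e) * T.height ≤ 2 * T.leftHeight +
      Real.log (leafWeight (Real.exp (-(e * (1 + e)))) (Real.exp (e * (1 - e))) T) / e := by
  obtain ⟨L, R, h1, h2, h3⟩ := exists_leaf_height (Real.exp_pos (-(e * (1 + e)))).le
    (Real.exp_pos (e * (1 - e))).le T
  rw [← Real.exp_nat_mul, ← Real.exp_nat_mul, ← Real.exp_add,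
    ← Real.le_log_iff_exp_le (leafWeight_pos (Real.exp_pos _) (Real.exp_pos _) T)] at h3
  have h4 : (L : ℝ) ≤ T.leftHeight := by exact_mod_cast h2
  rw [← h1, ← sub_le_iff_le_add', le_div_iff₀ he]
  push_cast
  nlinarith

theorem leftHeight_le_height_add_log (e : ℝ) (he : 0 < e) (T : PTree) :
    2 * (T.leftHeight : ℝ) ≤ (1 + e) * T.height +
      Real.log (leafWeight (Real.exp (e * (1 - e))) (Real.exp (-(e * (1 + e)))) T) / e := by
  obtain ⟨L, R, h1, h2, h3⟩ := exists_leaf_leftHeight (Real.exp_pos (e * (1 - e))).le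
    (Real.exp_pos (-(e * (1 + e)))).le T
  rw [← Real.exp_nat_mul, ← Real.exp_nat_mul, ← Real.exp_add,
    ← Real.le_log_iff_exp_le (leafWeight_pos (Real.exp_pos _) (Real.exp_pos _) T)] at h3
  have h4 : (L : ℝ) + R ≤ T.height := by exact_mod_cast h2
  rw [← h1, ← sub_le_iff_le_add', le_div_iff₀ he]
  have h5 : 0 ≤ e * (1 + e) := by positivity
  nlinarith [mul_le_mul_of_nonneg_left h4 h5]

theorem sum_height_le (e : ℝ) (he : 0 < e) {n : ℕ} (hn : 1 ≤ n) :
    (1 - e) * ∑ T ∈ planeTrees n, (T.height : ℝ) ≤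
      2 * ∑ T ∈ planeTrees n, (T.leftHeight : ℝ) + numTrees n * Real.log n / e := by
  have h := Finset.sum_le_sum fun T (_ : T ∈ planeTrees n) => height_le_leftHeight_add_log e he T
  rw [Finset.sum_add_distrib, ← Finset.mul_sum, ← Finset.mul_sum, ← Finset.sum_div] at h
  refine h.trans (add_le_add le_rfl (div_le_div_of_nonneg_right ?_ he.le))
  exact sum_log_leafWeight_le (Real.exp_pos _) (Real.exp_pos _)
    (by rw [add_comm]; exact exp_add_exp_le_two e) hn

theorem sum_leftHeight_le (e : ℝ) (he : 0 < e) {n : ℕ} (hn : 1 ≤ n) :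
    2 * ∑ T ∈ planeTrees n, (T.leftHeight : ℝ) ≤
      (1 + e) * ∑ T ∈ planeTrees n, (T.height : ℝ) + numTrees n * Real.log n / e := by
  have h := Finset.sum_le_sum fun T (_ : T ∈ planeTrees n) => leftHeight_le_height_add_log e he T
  rw [Finset.sum_add_distrib, ← Finset.mul_sum, ← Finset.mul_sum, ← Finset.sum_div] at h
  refine h.trans (add_le_add le_rfl (div_le_div_of_nonneg_right ?_ he.le))
  exact sum_log_leafWeight_le (Real.exp_pos _) (Real.exp_pos _) (exp_add_exp_le_two e) hn

theorem sum_height_sq_le (n : ℕ) :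
    ∑ T ∈ planeTrees n, (T.height : ℝ) ^ 2 ≤
      32 * ∑ T ∈ planeTrees n, (T.leftHeight : ℝ) ^ 2 + 128 * (n * numTrees n) := by
  set s := Real.exp (-((1 / 2 : ℝ) * (1 + 1 / 2))) with hs
  set t := Real.exp ((1 / 2 : ℝ) * (1 - 1 / 2)) with ht
  have hst : s + t ≤ 2 := by rw [add_comm]; exact exp_add_exp_le_two (1 / 2)
  have h1 : ∀ T ∈ planeTrees n, (T.height : ℝ) ^ 2 ≤
      32 * (T.leftHeight : ℝ) ^ 2 + 128 * leafWeight s t T := fun T _ => by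
    have h := height_le_leftHeight_add_log (1 / 2) (by norm_num) T
    rw [← hs, ← ht] at h
    have hW : 0 < leafWeight s t T := leafWeight_pos (Real.exp_pos _) (Real.exp_pos _) T
    have hlog := Real.log_le_sub_one_of_pos (Real.sqrt_pos.mpr hW)
    rw [Real.log_sqrt hW.le] at hlog
    have hsq := Real.sq_sqrt hW.le
    have h0 : (0 : ℝ) ≤ T.height := by positivity
    have h2 : (T.height : ℝ) ≤ 4 * T.leftHeight + 8 * √(leafWeight s t T) := by linarith
    have h3 := pow_le_pow_left₀ h0 h2 2
    nlinarith [sq_nonneg (4 * (T.leftHeight : ℝ) - 8 * √(leafWeight s t T))]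
  refine (Finset.sum_le_sum h1).trans ?_
  rw [Finset.sum_add_distrib, ← Finset.mul_sum, ← Finset.mul_sum]
  have := sum_leafWeight_le (Real.exp_pos _).le (Real.exp_pos _).le hst n
  rw [← hs, ← ht] at this
  linarith

end PTree

namespace PTree

/-- The step of a lattice path encoded by a Boolean. -/
def step (b : Bool) : ℤ := if b then 1 else -1

/-- The final position of a lattice path. -/
def tot : List Bool → ℤ
  | [] => 0
  | b :: w => step b + tot w

/-- The maximal position of a lattice path. -/
def maxPos : List Bool → ℤ
  | [] => 0
  | b :: w => max 0 (step b + maxPos w)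

/-- The minimal position of a lattice path. -/
def minPos : List Bool → ℤ
  | [] => 0
  | b :: w => min 0 (step b + minPos w)

theorem tot_append (u v : List Bool) : tot (u ++ v) = tot u + tot v := by
  induction u with
  | nil => simp [tot]
  | cons b u ih => simp only [List.cons_append, tot, ih]; ring

theorem maxPos_nonneg (u : List Bool) : 0 ≤ maxPos u := by
  cases u <;> simp [maxPos]

theorem minPos_nonpos (u : List Bool) : minPos u ≤ 0 := by
  cases u <;> simp [minPos]

theorem maxPos_append (u v : List Bool) :
    maxPos (u ++ v) = max (maxPos u) (tot u + maxPos v) := by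
  induction u with
  | nil => simp [tot, maxPos, maxPos_nonneg]
  | cons b u ih => simp only [List.cons_append, tot, maxPos, ih]; omega

theorem minPos_append (u v : List Bool) :
    minPos (u ++ v) = min (minPos u) (tot u + minPos v) := by
  induction u with
  | nil => simp [tot, minPos, minPos_nonpos]
  | cons b u ih => simp only [List.cons_append, tot, minPos, ih]; omega

theorem maxPos_le_length (u : List Bool) : maxPos u ≤ u.length := by
  induction u with
  | nil => simp [maxPos]
  | cons b u ih =>
    have : step b ≤ 1 := by cases b <;> simp [step]
    simp only [maxPos, List.length_cons]; push_cast; omega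

theorem tot_map_not (u : List Bool) : tot (u.map not) = -tot u := by
  induction u with
  | nil => simp [tot]
  | cons b u ih => cases b <;> simp only [List.map_cons, tot, ih, step] <;> simp <;> ring

theorem maxPos_map_not (u : List Bool) : maxPos (u.map not) = -minPos u := by
  induction u with
  | nil => simp [maxPos, minPos]
  | cons b u ih =>
    have : step (not b) = -step b := by cases b <;> simp [step]
    simp only [List.map_cons, maxPos, minPos, ih, this]; omega

/-- The lattice path encoding a plane binary tree in preorder. -/
def code : PTree → List Bool
  | leaf => [false]
  | node l r => true :: (code l ++ code r)

theorem tot_code (T : PTree) : tot (code T) = -1 := by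
  induction T with
  | leaf => simp [code, tot, step]
  | node l r hl hr => simp [code, tot, tot_append, hl, hr, step]

theorem maxPos_code (T : PTree) : maxPos (code T) = leftHeight T := by
  induction T with
  | leaf => simp [code, maxPos, step, leftHeight]
  | node l r hl hr =>
    simp only [code, maxPos, maxPos_append, tot_code, hl, hr, step, leftHeight, if_true]
    push_cast; omega

theorem minPos_code (T : PTree) : minPos (code T) = -1 := by
  induction T with
  | leaf => simp [code, minPos, step]
  | node l r hl hr => simp [code, minPos, minPos_append, tot_code, hl, hr, step]

theorem length_code (T : PTree) : (code T).length + 1 = 2 * T.size := by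
  induction T with
  | leaf => simp [code, size]
  | node l r hl hr => simp only [code, size, List.length_cons, List.length_append]; omega

theorem code_append_inj {T T' : PTree} {a b : List Bool} (h : code T ++ a = code T' ++ b) :
    T = T' ∧ a = b := by
  induction T generalizing T' a b with
  | leaf =>
    cases T' with
    | leaf => simpa [code] using h
    | node l' r' => simp [code] at h
  | node l r hl hr =>
    cases T' with
    | leaf => simp [code] at h
    | node l' r' =>
      simp only [code, List.cons_append, List.append_assoc, List.cons.injEq, true_and] at h
      obtain ⟨h1, h2⟩ := hl h
      obtain ⟨h3, h4⟩ := hr h2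
      exact ⟨by rw [h1, h3], h4⟩

theorem tot_take_code_nonneg {T : PTree} {u v : List Bool} (h : u ++ v = code T) (hv : v ≠ []) :
    0 ≤ tot u := by
  induction T generalizing u v with
  | leaf =>
    cases u with
    | nil => simp [tot]
    | cons b u => simp [code, hv] at h
  | node l r hl hr =>
    cases u with
    | nil => simp [tot]
    | cons b u =>
      simp only [code, List.cons_append, List.cons.injEq] at h
      obtain ⟨rfl, h⟩ := h
      rcases List.append_eq_append_iff.mp h with ⟨c, h1, h2⟩ | ⟨c, h1, h2⟩
      · by_cases hc : c = []
        · subst hc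
          simp only [List.append_nil] at h1
          rw [tot, ← h1, tot_code]; simp [step]
        · have := hl h1.symm hc
          simp only [tot, step, if_true]; omega
      · have := hr h2.symm hv
        rw [h1, tot, tot_append, tot_code]; simp only [step, if_true]; omega

theorem rotate_code_range {T : PTree} {u v : List Bool} (h : u ++ v = code T) :
    (leftHeight T : ℤ) ≤ maxPos (v ++ u) - minPos (v ++ u) ∧
      maxPos (v ++ u) - minPos (v ++ u) ≤ leftHeight T + 2 := by
  have h1 := tot_code T
  have h2 := maxPos_code T
  have h3 := minPos_code T
  rw [← h, tot_append] at h1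
  rw [← h, maxPos_append] at h2
  rw [← h, minPos_append] at h3
  rw [maxPos_append, minPos_append]
  omega

theorem tot_rotate_code {T : PTree} {u v : List Bool} (h : u ++ v = code T) :
    tot (v ++ u) = -1 := by
  rw [tot_append, add_comm, ← tot_append, h, tot_code]

theorem rotate_code_inj_aux {T T' : PTree} {u v u' v' : List Bool} (h : u ++ v = code T)
    (h' : u' ++ v' = code T') (hv' : v' ≠ []) (he : v ++ u = v' ++ u')
    (hlen : u.length ≤ u'.length) : T = T' ∧ u.length = u'.length := by
  rcases List.append_eq_append_iff.mp he with ⟨x, h1, h2⟩ | ⟨x, h1, h2⟩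
  · have : x = [] := by
      have := congrArg List.length h2
      simp only [List.length_append] at this
      exact List.eq_nil_of_length_eq_zero (by omega)
    subst this
    simp only [List.nil_append, List.append_nil] at h1 h2
    subst h1 h2
    rw [h] at h'
    exact ⟨(code_append_inj (a := []) (b := []) (by simpa using h')).1, rfl⟩
  · by_cases hx : x = []
    · subst hx
      simp only [List.nil_append, List.append_nil] at h1 h2
      subst h1 h2
      rw [h] at h'
      exact ⟨(code_append_inj (a := []) (b := []) (by simpa using h')).1, rfl⟩
    · exfalso
      subst h1 h2
      rw [← List.append_assoc] at h
      rw [List.append_assoc] at h'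
      have h3 := tot_take_code_nonneg h hx
      have h4 := tot_take_code_nonneg h' (by simp [hv'])
      have h5 := tot_code T
      rw [← h, tot_append] at h5
      omega

/-- The lattice paths of length `n`. -/
def words : ℕ → Finset (List Bool)
  | 0 => {[]}
  | n + 1 => (words n).image (List.cons true) ∪ (words n).image (List.cons false)

theorem mem_words {n : ℕ} {w : List Bool} : w ∈ words n ↔ w.length = n := by
  induction n generalizing w with
  | zero => simp [words]
  | succ n ih =>
    simp only [words, Finset.mem_union, Finset.mem_image, ih]
    constructor
    · rintro (⟨v, hv, rfl⟩ | ⟨v, hv, rfl⟩) <;> simp [hv]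
    · intro h
      cases w with
      | nil => simp at h
      | cons b v => cases b <;> simp_all

theorem sum_words_succ {M : Type*} [AddCommMonoid M] (n : ℕ) (F : List Bool → M) :
    ∑ w ∈ words (n + 1), F w = ∑ w ∈ words n, F (true :: w) + ∑ w ∈ words n, F (false :: w) := by
  rw [words, Finset.sum_union, Finset.sum_image (by simp), Finset.sum_image (by simp)]
  rw [Finset.disjoint_left]
  simp only [Finset.mem_image]
  rintro _ ⟨v, _, rfl⟩ ⟨v', _, h⟩
  simp at h

/-- The number of lattice paths of length `n` ending at `s`. -/
def numPaths : ℕ → ℤ → ℕ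
  | 0, s => if s = 0 then 1 else 0
  | n + 1, s => numPaths n (s - 1) + numPaths n (s + 1)

theorem numPaths_neg (n : ℕ) (s : ℤ) : numPaths n (-s) = numPaths n s := by
  induction n generalizing s with
  | zero => simp [numPaths]
  | succ n ih =>
    rw [numPaths, numPaths, add_comm, ← ih (s - 1), ← ih (s + 1)]
    congr 2 <;> ring

theorem numPaths_eq_zero {n : ℕ} {s : ℤ} (h : (n : ℤ) < s) : numPaths n s = 0 := by
  induction n generalizing s with
  | zero => simp only [numPaths]; rw [if_neg]; push_cast at h; omega
  | succ n ih => push_cast at h; rw [numPaths, ih (by omega), ih (by omega)]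

theorem numPaths_choose (n k : ℕ) : numPaths n (2 * k - n) = n.choose k := by
  induction n generalizing k with
  | zero => cases k <;> simp [numPaths]; omega
  | succ n ih =>
    cases k with
    | zero =>
      have h := ih 0
      rw [numPaths, show (2 * ((0 : ℕ) : ℤ) - ((n + 1 : ℕ) : ℤ) - 1) = -((n : ℤ) + 2) by
        push_cast; ring, numPaths_neg, numPaths_eq_zero (by omega), zero_add]
      rw [show (2 * ((0 : ℕ) : ℤ) - ((n + 1 : ℕ) : ℤ) + 1) = 2 * ((0 : ℕ) : ℤ) - n by
        push_cast; ring, h]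
      simp
    | succ k =>
      rw [numPaths, Nat.choose_succ_succ, ← ih, ← ih]
      congr 2 <;> push_cast <;> ring

theorem mul_numPaths_succ (n : ℕ) (s : ℤ) :
    s * numPaths (n + 1) s = (n + 1) * ((numPaths n (s - 1) : ℤ) - numPaths n (s + 1)) := by
  induction n generalizing s with
  | zero =>
    simp only [numPaths]
    by_cases h1 : s = 1
    · subst h1; norm_num
    · by_cases h2 : s = -1
      · subst h2; norm_num
      · rw [if_neg (by omega), if_neg (by omega)]; simp
  | succ n ih =>
    have h1 := ih (s - 1)
    have h2 := ih (s + 1)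
    rw [numPaths]
    simp only [numPaths] at h1 h2 ⊢
    simp only [sub_add_cancel, add_sub_cancel_right] at h1 h2 ⊢
    push_cast at *
    linarith

theorem card_words_tot (n : ℕ) (s : ℤ) :
    ∑ w ∈ words n, (if tot w = s then 1 else 0) = numPaths n s := by
  induction n generalizing s with
  | zero =>
    simp only [words, Finset.sum_singleton, tot, numPaths]
    simp only [eq_comm]
  | succ n ih =>
    rw [sum_words_succ, numPaths, ← ih, ← ih]
    congr 1 <;> refine Finset.sum_congr rfl fun w _ => ?_ <;> simp only [tot, step] <;>
      congr 1 <;> simp <;> omega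

/-- The reflection principle. -/
theorem card_words_tot_maxPos (n : ℕ) (s m : ℤ) (hm : 0 ≤ m) (hs : s ≤ m) :
    ∑ w ∈ words n, (if tot w = s ∧ m ≤ maxPos w then 1 else 0) = numPaths n (2 * m - s) := by
  induction n generalizing s m with
  | zero =>
    simp only [words, Finset.sum_singleton, tot, maxPos, numPaths]
    congr 1; simp; omega
  | succ n ih =>
    rcases hm.eq_or_lt with rfl | hm
    · simp only [maxPos_nonneg, and_true, card_words_tot]
      rw [← numPaths_neg]; congr 1; ring
    · rw [sum_words_succ, numPaths, show 2 * m - s - 1 = 2 * (m - 1) - (s - 1) by ring,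
        show 2 * m - s + 1 = 2 * (m + 1) - (s + 1) by ring,
        ← ih _ _ (by omega) (by omega), ← ih _ _ (by omega) (by omega)]
      congr 1 <;> refine Finset.sum_congr rfl fun w _ => ?_ <;>
        simp only [tot, maxPos, step] <;> congr 1 <;> simp <;> omega

end PTree

namespace PTree

theorem numPaths_one (N : ℕ) : numPaths (2 * N + 1) 1 = (2 * N + 1) * catalan N := by
  have h := numPaths_choose (2 * N + 1) (N + 1)
  rw [show (2 * ((N + 1 : ℕ) : ℤ) - ((2 * N + 1 : ℕ) : ℤ)) = 1 by push_cast; ring] at h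
  have h1 := succ_mul_catalan_eq_centralBinom N
  have h2 := Nat.add_one_mul_choose_eq (2 * N) N
  rw [← Nat.centralBinom_eq_two_mul_choose, ← h1] at h2
  rw [h]
  have : (N + 1) * ((2 * N + 1).choose (N + 1)) = (N + 1) * ((2 * N + 1) * catalan N) := by
    rw [mul_comm, ← h2]; ring
  exact Nat.eq_of_mul_eq_mul_left (by omega) this

/-- The cycle lemma: every path of length `2 N + 1` ending at `-1` is a unique rotation of the
code of a plane tree. -/
theorem sum_rotate (N : ℕ) (F : List Bool → ℝ) :
    ∑ w ∈ (words (2 * N + 1)).filter (fun w => tot w = -1), F w =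
      ∑ T ∈ planeTrees (N + 1), ∑ i ∈ Finset.range (2 * N + 1),
        F ((code T).drop i ++ (code T).take i) := by
  have hlen : ∀ T ∈ planeTrees (N + 1), (code T).length = 2 * N + 1 := by
    intro T hT
    have := length_code T
    rw [mem_planeTrees.mp hT] at this
    omega
  have key : Set.InjOn (fun p : PTree × ℕ => (code p.1).drop p.2 ++ (code p.1).take p.2)
      ((planeTrees (N + 1) ×ˢ Finset.range (2 * N + 1) : Finset (PTree × ℕ)) : Set (PTree × ℕ)) := by
    rintro ⟨T, i⟩ h ⟨T', j⟩ h' he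
    simp only [Finset.coe_product, Set.mem_prod, Finset.mem_coe, Finset.mem_range] at h h'
    have e1 := hlen T h.1
    have e2 := hlen T' h'.1
    have l1 : ((code T).take i).length = i := by rw [List.length_take]; omega
    have l2 : ((code T').take j).length = j := by rw [List.length_take]; omega
    have n1 : (code T).drop i ≠ [] := by
      intro h0; have := congrArg List.length h0; simp at this; omega
    have n2 : (code T').drop j ≠ [] := by
      intro h0; have := congrArg List.length h0; simp at this; omega
    rcases le_total i j with hij | hij
    · obtain ⟨a, b⟩ := rotate_code_inj_aux (List.take_append_drop i (code T))
        (List.take_append_drop j (code T')) n2 he (by omega)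
      rw [l1, l2] at b
      rw [a, b]
    · obtain ⟨a, b⟩ := rotate_code_inj_aux (List.take_append_drop j (code T'))
        (List.take_append_drop i (code T)) n1 he.symm (by omega)
      rw [l1, l2] at b
      rw [a, b]
  have him : (planeTrees (N + 1) ×ˢ Finset.range (2 * N + 1)).image
      (fun p : PTree × ℕ => (code p.1).drop p.2 ++ (code p.1).take p.2) =
      (words (2 * N + 1)).filter (fun w => tot w = -1) := by
    apply Finset.eq_of_subset_of_card_le
    · intro w hw
      simp only [Finset.mem_image, Finset.mem_product, Prod.exists] at hw
      obtain ⟨T, i, ⟨hT, hi⟩, rfl⟩ := hw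
      rw [Finset.mem_filter, mem_words]
      refine ⟨?_, tot_rotate_code (List.take_append_drop i (code T))⟩
      have := hlen T hT
      rw [List.length_append, List.length_take, List.length_drop]
      have := Finset.mem_range.mp hi
      omega
    · rw [Finset.card_image_of_injOn key, Finset.card_product, Finset.card_range,
        Finset.card_filter, card_words_tot, numPaths_neg, numPaths_one, mul_comm]
      exact Nat.mul_le_mul_right _ (numTrees_succ N).ge
  rw [← him, Finset.sum_image key, Finset.sum_product]

theorem tot_map_not_filter (n : ℕ) (s : ℤ) (F : List Bool → ℝ) :
    ∑ w ∈ (words n).filter (fun w => tot w = -s), F w =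
      ∑ w ∈ (words n).filter (fun w => tot w = s), F (w.map not) := by
  symm
  refine Finset.sum_nbij' (fun w => w.map not) (fun w => w.map not) ?_ ?_ ?_ ?_ ?_
  · intro w hw
    simp only [Finset.mem_filter, mem_words, List.length_map] at hw ⊢
    rw [tot_map_not]; exact ⟨hw.1, by rw [hw.2]⟩
  · intro w hw
    simp only [Finset.mem_filter, mem_words, List.length_map] at hw ⊢
    rw [tot_map_not]; exact ⟨hw.1, by rw [hw.2]; ring⟩
  · intro w _; simp [Function.comp_def]
  · intro w _; simp [Function.comp_def]
  · intro w _; rfl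

theorem sum_weight_maxPos (n : ℕ) (s : ℤ) (hs : s ≤ 1) (g : ℕ → ℝ) :
    ∑ w ∈ (words n).filter (fun w => tot w = s), ∑ m ∈ Finset.range (maxPos w).toNat, g m =
      ∑ m ∈ Finset.range n, g m * numPaths n (2 * (m + 1) - s) := by
  have h : ∀ w ∈ (words n).filter (fun w => tot w = s),
      ∑ m ∈ Finset.range (maxPos w).toNat, g m =
        ∑ m ∈ Finset.range n, if ((m : ℤ) + 1 ≤ maxPos w) then g m else 0 := by
    intro w hw
    rw [← Finset.sum_filter]
    refine Finset.sum_congr ?_ fun _ _ => rfl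
    ext m
    have h1 := maxPos_le_length w
    have h2 := maxPos_nonneg w
    rw [Finset.mem_filter, mem_words] at hw
    simp only [Finset.mem_range, Finset.mem_filter]
    omega
  rw [Finset.sum_congr rfl h, Finset.sum_comm]
  refine Finset.sum_congr rfl fun m _ => ?_
  rw [← card_words_tot_maxPos n s (m + 1) (by omega) (by omega), Finset.sum_filter]
  push_cast
  rw [Finset.mul_sum]
  refine Finset.sum_congr rfl fun w _ => ?_
  by_cases h1 : tot w = s <;> by_cases h2 : (m : ℤ) + 1 ≤ maxPos w <;> simp [h1, h2]

end PTree

namespace PTree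

theorem sum_numPaths_odd (N : ℕ) :
    ∑ m ∈ Finset.range (2 * N + 1), numPaths (2 * N + 1) (2 * m + 1) = 4 ^ N := by
  rw [← Nat.sum_range_choose_halfway N,
    ← Finset.sum_range_reflect (fun m => (2 * N + 1).choose m),
    ← Finset.sum_subset (Finset.range_subset_range.mpr (show N + 1 ≤ 2 * N + 1 by omega))]
  · refine Finset.sum_congr rfl fun m hm => ?_
    have := Finset.mem_range.mp hm
    rw [← numPaths_choose, ← numPaths_neg]
    congr 1
    omega
  · intro m _ hm
    apply numPaths_eq_zero
    simp only [Finset.mem_range] at hm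
    push_cast; omega

theorem sum_numPaths_odd_shift (N : ℕ) :
    ∑ m ∈ Finset.range (2 * N + 1), numPaths (2 * N + 1) (2 * (m + 1) + 1)
      + numPaths (2 * N + 1) 1 = 4 ^ N := by
  have h := Finset.sum_range_succ' (fun m : ℕ => numPaths (2 * N + 1) (2 * m + 1)) (2 * N + 1)
  rw [Finset.sum_range_succ, sum_numPaths_odd, numPaths_eq_zero (by push_cast; omega)] at h
  simpa using h.symm

theorem cast_toNat_maxPos (w : List Bool) : (((maxPos w).toNat : ℕ) : ℝ) = maxPos w := by
  have : (((maxPos w).toNat : ℤ)) = maxPos w := Int.toNat_of_nonneg (maxPos_nonneg w)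
  exact_mod_cast this

theorem sum_maxPos_weight (N : ℕ) (g : ℕ → ℝ) :
    ∑ w ∈ (words (2 * N + 1)).filter (fun w => tot w = -1),
        ∑ m ∈ Finset.range (maxPos w).toNat, g m =
      ∑ m ∈ Finset.range (2 * N + 1), g m * numPaths (2 * N + 1) (2 * (m + 1) + 1) := by
  rw [sum_weight_maxPos _ _ (by norm_num)]
  simp

theorem sum_minPos_weight (N : ℕ) (g : ℕ → ℝ) :
    ∑ w ∈ (words (2 * N + 1)).filter (fun w => tot w = -1),
        ∑ m ∈ Finset.range (maxPos (w.map not)).toNat, g m =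
      ∑ m ∈ Finset.range (2 * N + 1), g m * numPaths (2 * N + 1) (2 * m + 1) := by
  rw [tot_map_not_filter]
  have : ∀ w : List Bool, (w.map not).map not = w := fun w => by simp [Function.comp_def]
  simp only [this]
  rw [sum_weight_maxPos _ _ le_rfl]
  refine Finset.sum_congr rfl fun m _ => ?_
  rw [show (2 * ((m : ℤ) + 1) - 1) = 2 * m + 1 by ring]

theorem sum_range_words (N : ℕ) :
    ∑ w ∈ (words (2 * N + 1)).filter (fun w => tot w = -1), ((maxPos w : ℝ) - minPos w) =
      2 * 4 ^ N - (2 * N + 1) * numTrees (N + 1) := by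
  have h1 := sum_maxPos_weight N (fun _ => 1)
  have h2 := sum_minPos_weight N (fun _ => 1)
  simp only [Finset.sum_const, Finset.card_range, nsmul_eq_mul, mul_one, one_mul,
    cast_toNat_maxPos] at h1 h2
  simp only [maxPos_map_not] at h2
  have h3 : (_ : ℝ) = _ := congrArg Nat.cast (sum_numPaths_odd N)
  have h4 : (_ : ℝ) = _ := congrArg Nat.cast (sum_numPaths_odd_shift N)
  rw [numPaths_one, ← numTrees_succ] at h4
  push_cast at h1 h2 h3 h4
  simp only [sub_eq_add_neg, Finset.sum_add_distrib]
  rw [h1, h2]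
  linarith

theorem sum_odd_eq_sq (k : ℕ) : ∑ m ∈ Finset.range k, (2 * (m : ℝ) + 1) = k ^ 2 := by
  induction k with
  | zero => simp
  | succ k ih => rw [Finset.sum_range_succ, ih]; push_cast; ring

theorem sum_mul_numPaths_odd (N M : ℕ) (j : ℤ) :
    ∑ m ∈ Finset.range M, (2 * (m : ℝ) + 2 * j + 1) * numPaths (2 * N + 1) (2 * m + 2 * j + 1) =
      (2 * N + 1) * ((numPaths (2 * N) (2 * j) : ℝ) - numPaths (2 * N) (2 * M + 2 * j)) := by
  induction M with
  | zero => simp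
  | succ M ih =>
    rw [Finset.sum_range_succ, ih]
    have h := mul_numPaths_succ (2 * N) (2 * M + 2 * j + 1)
    rw [show (2 * M + 2 * j + 1 - 1 : ℤ) = 2 * M + 2 * j by ring,
      show (2 * M + 2 * j + 1 + 1 : ℤ) = 2 * (M + 1 : ℕ) + 2 * j by push_cast; ring] at h
    have h' : (_ : ℝ) = _ := congrArg Int.cast h
    push_cast at h' ⊢
    linarith

theorem sum_range_sq_words_le (N : ℕ) :
    ∑ w ∈ (words (2 * N + 1)).filter (fun w => tot w = -1), ((maxPos w : ℝ) - minPos w) ^ 2 ≤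
      2 * ((2 * N + 1) ^ 2 * numTrees (N + 1)) := by
  have h1 := sum_maxPos_weight N (fun m => 2 * m + 1)
  have h2 := sum_minPos_weight N (fun m => 2 * m + 1)
  simp only [sum_odd_eq_sq, cast_toNat_maxPos] at h1 h2
  simp only [maxPos_map_not] at h2
  have h3 := sum_mul_numPaths_odd N (2 * N + 1) 0
  have h4 := sum_mul_numPaths_odd N (2 * N + 1) 1
  have h5 : numPaths (2 * N + 1) 1 = numPaths (2 * N) 0 + numPaths (2 * N) 2 := by
    rw [numPaths]; norm_num
  have h5' : (_ : ℝ) = _ := congrArg Nat.cast h5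
  rw [numPaths_one, ← numTrees_succ] at h5'
  have h6 : ∑ m ∈ Finset.range (2 * N + 1),
      (2 * (m : ℝ) + 1) * numPaths (2 * N + 1) (2 * (m + 1) + 1) ≤
      (2 * N + 1) * numPaths (2 * N) 2 := by
    calc _ ≤ ∑ m ∈ Finset.range (2 * N + 1),
        (2 * (m : ℝ) + 2 * (1 : ℤ) + 1) * numPaths (2 * N + 1) (2 * m + 2 * 1 + 1) := by
          refine Finset.sum_le_sum fun m _ => ?_
          rw [show (2 * ((m : ℤ) + 1) + 1) = 2 * m + 2 * 1 + 1 by ring]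
          gcongr; push_cast; linarith
      _ ≤ _ := by
          rw [h4, mul_one]
          gcongr
          have : (0 : ℝ) ≤ numPaths (2 * N) (2 * (2 * N + 1 : ℕ) + 2) := by positivity
          linarith
  have h7 : ∑ m ∈ Finset.range (2 * N + 1),
      (2 * (m : ℝ) + 1) * numPaths (2 * N + 1) (2 * m + 1) ≤
      (2 * N + 1) * numPaths (2 * N) 0 := by
    simp only [mul_zero, add_zero, Int.cast_zero] at h3
    rw [h3]
    gcongr
    have : (0 : ℝ) ≤ numPaths (2 * N) (2 * (2 * N + 1 : ℕ)) := by positivity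
    linarith
  push_cast at h1 h2 h5'
  have h8 : (2 * (N : ℝ) + 1) * ((2 * N + 1) * numTrees (N + 1)) =
    (2 * N + 1) * (numPaths (2 * N) 0 + numPaths (2 * N) 2) := by rw [h5']
  calc _ ≤ ∑ w ∈ (words (2 * N + 1)).filter (fun w => tot w = -1),
        (2 * (maxPos w : ℝ) ^ 2 + 2 * (- minPos w : ℝ) ^ 2) := by
          refine Finset.sum_le_sum fun w _ => ?_
          nlinarith [sq_nonneg ((maxPos w : ℝ) + minPos w)]
    _ ≤ _ := by
      rw [Finset.sum_add_distrib, ← Finset.mul_sum, ← Finset.mul_sum, h1, h2]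
      nlinarith

theorem leftHeight_range {T : PTree} (i : ℕ) :
    (leftHeight T : ℝ) ≤ maxPos ((code T).drop i ++ (code T).take i) -
        minPos ((code T).drop i ++ (code T).take i) ∧
      maxPos ((code T).drop i ++ (code T).take i) -
        minPos ((code T).drop i ++ (code T).take i) ≤ (leftHeight T : ℝ) + 2 := by
  obtain ⟨h1, h2⟩ := rotate_code_range (List.take_append_drop i (code T))
  constructor <;> exact_mod_cast by assumption

theorem sum_leftHeight_bounds (N : ℕ) :
    (2 * N + 1) * ∑ T ∈ planeTrees (N + 1), (leftHeight T : ℝ) ≤ 2 * 4 ^ N ∧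
    2 * 4 ^ N - 3 * ((2 * N + 1) * numTrees (N + 1)) ≤
      (2 * N + 1) * ∑ T ∈ planeTrees (N + 1), (leftHeight T : ℝ) := by
  have h := sum_rotate N (fun w => (maxPos w : ℝ) - minPos w)
  rw [sum_range_words] at h
  have h1 : ∑ T ∈ planeTrees (N + 1), ∑ i ∈ Finset.range (2 * N + 1), (leftHeight T : ℝ) =
      (2 * N + 1) * ∑ T ∈ planeTrees (N + 1), (leftHeight T : ℝ) := by
    simp [Finset.mul_sum]
  have h2 : ∑ T ∈ planeTrees (N + 1), ∑ i ∈ Finset.range (2 * N + 1), ((leftHeight T : ℝ) + 2) =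
      (2 * N + 1) * ∑ T ∈ planeTrees (N + 1), (leftHeight T : ℝ) +
        2 * ((2 * N + 1) * numTrees (N + 1)) := by
    simp [Finset.mul_sum, Finset.sum_add_distrib, numTrees]; ring
  have h3 := Finset.sum_le_sum fun T (_ : T ∈ planeTrees (N + 1)) =>
    Finset.sum_le_sum fun i (_ : i ∈ Finset.range (2 * N + 1)) => (leftHeight_range (T := T) i).1
  have h4 := Finset.sum_le_sum fun T (_ : T ∈ planeTrees (N + 1)) =>
    Finset.sum_le_sum fun i (_ : i ∈ Finset.range (2 * N + 1)) => (leftHeight_range (T := T) i).2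
  rw [← h, h1] at h3
  rw [← h, h2] at h4
  have : (0 : ℝ) ≤ (2 * N + 1) * numTrees (N + 1) := by positivity
  constructor <;> linarith

theorem sum_leftHeight_sq_le (n : ℕ) :
    ∑ T ∈ planeTrees n, (leftHeight T : ℝ) ^ 2 ≤ 4 * (n * numTrees n) := by
  cases n with
  | zero => simp [planeTrees_zero]
  | succ N =>
    have h := sum_rotate N (fun w => ((maxPos w : ℝ) - minPos w) ^ 2)
    have h0 := sum_range_sq_words_le N
    rw [h] at h0
    have h1 : ∑ T ∈ planeTrees (N + 1), ∑ i ∈ Finset.range (2 * N + 1), (leftHeight T : ℝ) ^ 2 =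
        (2 * N + 1) * ∑ T ∈ planeTrees (N + 1), (leftHeight T : ℝ) ^ 2 := by
      simp [Finset.mul_sum]
    have h3 := Finset.sum_le_sum fun T (_ : T ∈ planeTrees (N + 1)) =>
      Finset.sum_le_sum fun i (_ : i ∈ Finset.range (2 * N + 1)) =>
        pow_le_pow_left₀ (Nat.cast_nonneg _) (leftHeight_range (T := T) i).1 2
    rw [h1] at h3
    have h5 : (2 * (N : ℝ) + 1) * ∑ T ∈ planeTrees (N + 1), (leftHeight T : ℝ) ^ 2 ≤
        (2 * N + 1) * (2 * ((2 * N + 1) * numTrees (N + 1))) := by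
      refine h3.trans (h0.trans (le_of_eq ?_)); ring
    have h6 := le_of_mul_le_mul_left h5 (by positivity)
    refine h6.trans ?_
    push_cast
    have : (0 : ℝ) ≤ numTrees (N + 1) := by positivity
    nlinarith

end PTree

namespace PTree

/-- The mean of a statistic of a uniformly random plane binary tree with `n` leaves. -/
noncomputable def mean (n : ℕ) (F : PTree → ℝ) : ℝ := (∑ T ∈ planeTrees n, F T) / numTrees n

theorem four_pow_div_centralBinom_sq (N : ℕ) :
    ((4 : ℝ) ^ N / N.centralBinom) ^ 2 = Real.Wallis.W N * (2 * N + 1) := by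
  rw [Real.Wallis.W_eq_factorial_ratio, Nat.centralBinom_eq_two_mul_choose,
    Nat.cast_choose ℝ (by omega), show 2 * N - N = N by omega,
    show (2 : ℝ) ^ (4 * N) = (4 ^ N) ^ 2 by
      rw [← pow_mul, show (4 : ℝ) = 2 ^ 2 by norm_num, ← pow_mul]; congr 1; ring]
  have h1 : ((2 * N).factorial : ℝ) ≠ 0 := by positivity
  have h2 : (N.factorial : ℝ) ≠ 0 := by positivity
  have h3 : (2 * (N : ℝ) + 1) ≠ 0 := by positivity
  field_simp

theorem numTrees_succ_mul (N : ℕ) :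
    ((N : ℝ) + 1) * numTrees (N + 1) = N.centralBinom := by
  rw [numTrees_succ]
  exact_mod_cast succ_mul_catalan_eq_centralBinom N

theorem four_pow_div_sqrt (N : ℕ) :
    2 * 4 ^ N / ((2 * N + 1) * numTrees (N + 1)) / Real.sqrt (N + 1) =
      Real.sqrt (4 * Real.Wallis.W N * ((N + 1) / (2 * N + 1))) := by
  have h3 : (0 : ℝ) < numTrees (N + 1) := by exact_mod_cast numTrees_pos (by omega)
  have hN : (0 : ℝ) < N + 1 := by positivity
  symm
  rw [Real.sqrt_eq_iff_mul_self_eq_of_pos (by positivity)]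
  have h := four_pow_div_centralBinom_sq N
  rw [← numTrees_succ_mul] at h
  have hW : Real.Wallis.W N = (4 ^ N / (((N : ℝ) + 1) * numTrees (N + 1))) ^ 2 / (2 * N + 1) := by
    rw [h]; field_simp
  rw [hW, div_mul_div_comm, Real.mul_self_sqrt hN.le]
  field_simp
  ring

theorem tendsto_four_pow_div_sqrt :
    Filter.Tendsto (fun N : ℕ =>
      2 * 4 ^ N / (((2 * N + 1) : ℝ) * numTrees (N + 1)) / Real.sqrt (N + 1))
      Filter.atTop (nhds (Real.sqrt Real.pi)) := by
  simp only [four_pow_div_sqrt]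
  refine (Real.continuous_sqrt.tendsto _).comp ?_
  have h1 : Filter.Tendsto (fun N : ℕ => (((N : ℝ) + 1) / (2 * N + 1))) Filter.atTop
      (nhds (1 / 2)) := by
    have h := (tendsto_one_div_add_atTop_nhds_zero_nat (𝕜 := ℝ)).const_sub 2
    have h2 := h.inv₀ (by norm_num)
    rw [sub_zero, ← one_div] at h2
    refine h2.congr fun N => ?_
    have : (N : ℝ) + 1 ≠ 0 := by positivity
    have : 2 * (N : ℝ) + 1 ≠ 0 := by positivity
    field_simp
    ring_nf
    field_simp
    ring
  have h := (Real.Wallis.tendsto_W_nhds_pi_div_two.const_mul 4).mul h1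
  rwa [show 4 * (Real.pi / 2) * (1 / 2) = Real.pi by ring] at h

theorem tendsto_inv_sqrt : Filter.Tendsto (fun n : ℕ => 1 / Real.sqrt n) Filter.atTop (nhds 0) := by
  simp only [one_div]
  exact (Real.tendsto_sqrt_atTop.comp tendsto_natCast_atTop_atTop).inv_tendsto_atTop

theorem tendsto_mean_leftHeight :
    Filter.Tendsto (fun n : ℕ => mean n (fun T => leftHeight T) / Real.sqrt n)
      Filter.atTop (nhds (Real.sqrt Real.pi)) := by
  rw [← Filter.tendsto_add_atTop_iff_nat 1]
  have h0 := (Filter.tendsto_add_atTop_iff_nat 1).mpr tendsto_inv_sqrt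
  have hlow := tendsto_four_pow_div_sqrt.sub (h0.const_mul 3)
  rw [mul_zero, sub_zero] at hlow
  refine tendsto_of_tendsto_of_tendsto_of_le_of_le hlow tendsto_four_pow_div_sqrt ?_ ?_
  all_goals
    intro N
    have h3 : (0 : ℝ) < numTrees (N + 1) := by exact_mod_cast numTrees_pos (by omega)
    obtain ⟨h1, h2⟩ := sum_leftHeight_bounds N
    have h4 : (0 : ℝ) < 2 * N + 1 := by positivity
    have h5 : 0 < Real.sqrt ((N : ℝ) + 1) := by positivity
    simp only [mean, Nat.cast_add, Nat.cast_one]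
  · rw [mul_one_div, ← sub_div]
    gcongr
    rw [le_div_iff₀ h3, sub_mul, div_mul_eq_mul_div, sub_le_iff_le_add,
      div_le_iff₀ (by positivity)]
    nlinarith
  · refine div_le_div_of_nonneg_right ?_ h5.le
    rw [div_le_div_iff₀ h3 (by positivity)]
    nlinarith

theorem tendsto_mean_height :
    Filter.Tendsto (fun n : ℕ => mean n (fun T => height T) / Real.sqrt n)
      Filter.atTop (nhds (2 * Real.sqrt Real.pi)) := by
  have hb := tendsto_mean_leftHeight.const_mul 2
  set e : ℕ → ℝ := fun n => (n : ℝ) ^ (-(1 / 4) : ℝ) with he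
  have hnat := tendsto_natCast_atTop_atTop (R := ℝ)
  have he0 : Filter.Tendsto e Filter.atTop (nhds 0) :=
    (tendsto_rpow_neg_atTop (by norm_num)).comp hnat
  have hd : Filter.Tendsto (fun n : ℕ => Real.log n / e n / Real.sqrt n) Filter.atTop (nhds 0) := by
    have h := ((isLittleO_log_rpow_atTop (r := 1 / 4) (by norm_num)).tendsto_div_nhds_zero).comp hnat
    refine h.congr' ?_
    filter_upwards [Filter.eventually_gt_atTop 0] with n hn
    have hn' : (0 : ℝ) < n := by exact_mod_cast hn
    simp only [Function.comp, he]
    rw [div_div, Real.sqrt_eq_rpow, ← Real.rpow_add hn']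
    norm_num
  have hlow := (hb.sub hd).div (he0.const_add 1) (by norm_num)
  have hup := (hb.add hd).div (he0.const_sub 1) (by norm_num)
  rw [sub_zero, add_zero, div_one] at hlow
  rw [add_zero, sub_zero, div_one] at hup
  refine tendsto_of_tendsto_of_tendsto_of_le_of_le' hlow hup ?_ ?_
  · filter_upwards [Filter.eventually_gt_atTop 0] with n hn
    have hn' : (0 : ℝ) < n := by exact_mod_cast hn
    have hc : (0 : ℝ) < numTrees n := by exact_mod_cast numTrees_pos hn
    have hs := Real.sqrt_pos.mpr hn'
    have hp : 0 < e n := Real.rpow_pos_of_pos hn' _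
    have h := sum_leftHeight_le (e n) hp hn
    rw [Pi.div_apply, div_le_iff₀ (by positivity)]
    simp only [mean]
    rw [sub_le_iff_le_add]
    calc _ = (2 * ∑ T ∈ planeTrees n, (leftHeight T : ℝ)) / numTrees n / Real.sqrt n := by ring
      _ ≤ ((1 + e n) * ∑ T ∈ planeTrees n, (T.height : ℝ) + numTrees n * Real.log n / e n) /
          numTrees n / Real.sqrt n := by gcongr
      _ = _ := by field_simp
  · filter_upwards [Filter.eventually_gt_atTop 0, he0.eventually (gt_mem_nhds one_pos)] with n hn he1
    have hn' : (0 : ℝ) < n := by exact_mod_cast hn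
    have hc : (0 : ℝ) < numTrees n := by exact_mod_cast numTrees_pos hn
    have hs := Real.sqrt_pos.mpr hn'
    have hp : 0 < e n := Real.rpow_pos_of_pos hn' _
    have h := sum_height_le (e n) hp hn
    rw [Pi.div_apply, le_div_iff₀ (by linarith)]
    simp only [mean]
    calc _ = ((1 - e n) * ∑ T ∈ planeTrees n, (T.height : ℝ)) / numTrees n / Real.sqrt n := by ring
      _ ≤ (2 * ∑ T ∈ planeTrees n, (leftHeight T : ℝ) + numTrees n * Real.log n / e n) /
          numTrees n / Real.sqrt n := by gcongr
      _ = _ := by field_simp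

theorem mean_height_sq_le (n : ℕ) : mean n (fun T => (height T : ℝ) ^ 2) ≤ 256 * n := by
  rcases Nat.eq_zero_or_pos n with rfl | hn
  · simp [mean, planeTrees_zero]
  have hc : (0 : ℝ) < numTrees n := by exact_mod_cast numTrees_pos hn
  rw [mean, div_le_iff₀ hc]
  have h1 := sum_height_sq_le n
  have h2 := sum_leftHeight_sq_le n
  linarith

end PTree

namespace PTree

theorem cherries_node {l r : PTree} (h : 3 ≤ l.size + r.size) :
    cherries (node l r) = cherries l + cherries r := by
  cases l <;> cases r <;> first | rfl | (simp [size] at h)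

/-- The total number of cherries. -/
noncomputable def sumCherries (n : ℕ) : ℝ := ∑ T ∈ planeTrees n, (cherries T : ℝ)

/-- The second factorial moment sum of the number of cherries. -/
noncomputable def sumCherriesSq (n : ℕ) : ℝ :=
  ∑ T ∈ planeTrees n, (cherries T : ℝ) * ((cherries T : ℝ) - 1)

theorem planeTrees_two : planeTrees 2 = {node leaf leaf} := by
  ext T
  rw [mem_planeTrees, Finset.mem_singleton]
  constructor
  · intro h
    cases T with
    | leaf => simp [size] at h
    | node l r =>
      simp only [size] at h
      have h1 := size_pos l
      have h2 := size_pos r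
      have e1 : l ∈ planeTrees 1 := mem_planeTrees.mpr (by omega)
      have e2 : r ∈ planeTrees 1 := mem_planeTrees.mpr (by omega)
      rw [planeTrees_one, Finset.mem_singleton] at e1 e2
      rw [e1, e2]
  · rintro rfl; rfl

theorem sumCherries_zero : sumCherries 0 = 0 := by simp [sumCherries, planeTrees_zero]
theorem sumCherries_one : sumCherries 1 = 0 := by simp [sumCherries, planeTrees_one, cherries]
theorem sumCherries_two : sumCherries 2 = 1 := by simp [sumCherries, planeTrees_two, cherries]
theorem sumCherriesSq_zero : sumCherriesSq 0 = 0 := by simp [sumCherriesSq, planeTrees_zero]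
theorem sumCherriesSq_one : sumCherriesSq 1 = 0 := by simp [sumCherriesSq, planeTrees_one, cherries]
theorem sumCherriesSq_two : sumCherriesSq 2 = 0 := by simp [sumCherriesSq, planeTrees_two, cherries]

theorem sumCherries_eq {n : ℕ} (hn : 3 ≤ n) :
    sumCherries n = 2 * ∑ p ∈ Finset.HasAntidiagonal.antidiagonal n,
      sumCherries p.1 * numTrees p.2 := by
  rw [two_mul]
  nth_rewrite 2 [sum_antidiagonal_mul_comm n sumCherries (fun k => (numTrees k : ℝ))]
  rw [sumCherries, sum_planeTrees (by omega), ← Finset.sum_add_distrib]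
  refine Finset.sum_congr rfl fun p hp => ?_
  have hp' := Finset.HasAntidiagonal.mem_antidiagonal.mp hp
  have : ∀ l ∈ planeTrees p.1, ∑ r ∈ planeTrees p.2, (cherries (node l r) : ℝ) =
      ∑ r ∈ planeTrees p.2, ((cherries l : ℝ) + cherries r) := by
    intro l hl
    refine Finset.sum_congr rfl fun r hr => ?_
    rw [cherries_node (by rw [mem_planeTrees.mp hl, mem_planeTrees.mp hr]; omega)]
    push_cast; rfl
  rw [Finset.sum_congr rfl this]
  simp only [Finset.sum_add_distrib, Finset.sum_const, nsmul_eq_mul, sumCherries, numTrees,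
    ← Finset.mul_sum]
  ring

theorem sumCherriesSq_eq {n : ℕ} (hn : 3 ≤ n) :
    sumCherriesSq n = 2 * ∑ p ∈ Finset.HasAntidiagonal.antidiagonal n,
        sumCherriesSq p.1 * numTrees p.2 +
      2 * ∑ p ∈ Finset.HasAntidiagonal.antidiagonal n, sumCherries p.1 * sumCherries p.2 := by
  rw [two_mul]
  nth_rewrite 2 [sum_antidiagonal_mul_comm n sumCherriesSq (fun k => (numTrees k : ℝ))]
  rw [sumCherriesSq, sum_planeTrees (by omega), Finset.mul_sum, ← Finset.sum_add_distrib,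
    ← Finset.sum_add_distrib]
  refine Finset.sum_congr rfl fun p hp => ?_
  have hp' := Finset.HasAntidiagonal.mem_antidiagonal.mp hp
  have : ∀ l ∈ planeTrees p.1, ∑ r ∈ planeTrees p.2,
      ((cherries (node l r) : ℝ) * ((cherries (node l r) : ℝ) - 1)) =
      ∑ r ∈ planeTrees p.2, ((cherries l : ℝ) * ((cherries l : ℝ) - 1) +
        (cherries r : ℝ) * ((cherries r : ℝ) - 1) + (2 * (cherries l : ℝ)) * cherries r) := by
    intro l hl
    refine Finset.sum_congr rfl fun r hr => ?_
    rw [cherries_node (by rw [mem_planeTrees.mp hl, mem_planeTrees.mp hr]; omega)]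
    push_cast; ring
  rw [Finset.sum_congr rfl this]
  simp only [Finset.sum_add_distrib, Finset.sum_const, nsmul_eq_mul, sumCherries, numTrees,
    sumCherriesSq, ← Finset.mul_sum, ← Finset.sum_mul]
  ring

theorem sumCherries_succ (n : ℕ) : sumCherries (n + 1) = n * numTrees n := by
  induction n using Nat.strong_induction_on with
  | _ n ih =>
    obtain rfl | rfl | hn : n = 0 ∨ n = 1 ∨ 2 ≤ n := by omega
    · simp [sumCherries_one]
    · simp [sumCherries_two, numTrees_one]
    · rw [sumCherries_eq (by omega), mul_numTrees_eq_sum hn, Finset.Nat.sum_antidiagonal_succ,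
        sumCherries_zero, zero_mul, zero_add]
      congr 1
      refine Finset.sum_congr rfl fun p hp => ?_
      have hp' := Finset.HasAntidiagonal.mem_antidiagonal.mp hp
      rcases Nat.eq_zero_or_pos p.2 with h | h
      · simp [h, numTrees_zero]
      · rw [ih p.1 (by omega)]

theorem mul_sub_one_numTrees_eq_sum {n : ℕ} (hn : 2 ≤ n) :
    ((n : ℝ) * (n - 1) * numTrees n) = 2 * ∑ p ∈ Finset.HasAntidiagonal.antidiagonal n,
      ((p.1 : ℝ) * (p.1 - 1) * numTrees p.1) * numTrees p.2 +
      2 * ∑ p ∈ Finset.HasAntidiagonal.antidiagonal n,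
      ((p.1 : ℝ) * numTrees p.1) * (p.2 * numTrees p.2) := by
  have h := numTrees_eq_sum hn
  have h2 := sum_antidiagonal_mul_comm n (fun k => (k : ℝ) * (k - 1) * numTrees k)
    (fun k => (numTrees k : ℝ))
  rw [two_mul]
  nth_rewrite 2 [h2]
  rw [Finset.mul_sum, ← Finset.sum_add_distrib, ← Finset.sum_add_distrib, h, Nat.cast_sum,
    Finset.mul_sum]
  refine Finset.sum_congr rfl fun p hp => ?_
  rw [← Finset.HasAntidiagonal.mem_antidiagonal.mp hp]
  push_cast
  ring

theorem sumCherriesSq_succ (n : ℕ) : sumCherriesSq (n + 2) = n * (n - 1) * numTrees n := by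
  induction n using Nat.strong_induction_on with
  | _ n ih =>
    rcases Nat.eq_zero_or_pos n with rfl | hn
    · simp [sumCherriesSq_two]
    · rw [sumCherriesSq_eq (by omega), Finset.Nat.sum_antidiagonal_succ, sumCherriesSq_zero,
        zero_mul, zero_add, Finset.Nat.sum_antidiagonal_succ, zero_add, sumCherriesSq_one,
        zero_mul, zero_add, Finset.Nat.sum_antidiagonal_succ, sumCherries_zero, zero_mul, zero_add,
        Finset.Nat.sum_antidiagonal_succ', sumCherries_zero, mul_zero, zero_add]
      have e1 : ∑ p ∈ Finset.HasAntidiagonal.antidiagonal n,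
          sumCherriesSq (p.1 + 1 + 1) * numTrees p.2 =
          ∑ p ∈ Finset.HasAntidiagonal.antidiagonal n,
          ((p.1 : ℝ) * (p.1 - 1) * numTrees p.1) * numTrees p.2 := by
        refine Finset.sum_congr rfl fun p hp => ?_
        have hp' := Finset.HasAntidiagonal.mem_antidiagonal.mp hp
        rcases Nat.eq_zero_or_pos p.2 with h | h
        · simp [h, numTrees_zero]
        · rw [ih p.1 (by omega)]
      simp only [sumCherries_succ]
      rw [e1]
      obtain rfl | hn : n = 1 ∨ 2 ≤ n := by omega
      · simp [Finset.Nat.antidiagonal_succ]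
      · rw [mul_sub_one_numTrees_eq_sum hn]

theorem numTrees_ratio (N : ℕ) :
    ((N : ℝ) + 2) * numTrees (N + 2) = 2 * (2 * N + 1) * numTrees (N + 1) := by
  have h0 := numTrees_succ_mul N
  have h1 := numTrees_succ_mul (N + 1)
  have h2 : (_ : ℝ) = _ := congrArg Nat.cast (Nat.succ_mul_centralBinom_succ N)
  push_cast at h1 h2
  rw [← h0, ← h1] at h2
  have h3 : ((N : ℝ) + 1) ≠ 0 := by positivity
  apply mul_left_cancel₀ h3
  linear_combination h2

theorem sum_cherries_sub_sq_le (n : ℕ) :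
    ∑ T ∈ planeTrees n, ((cherries T : ℝ) - n / 4) ^ 2 ≤ (n * numTrees n : ℝ) := by
  obtain rfl | rfl | rfl | ⟨m, rfl⟩ : n = 0 ∨ n = 1 ∨ n = 2 ∨ ∃ m, n = m + 3 := by
    rcases n with _ | _ | _ | m
    · simp
    · simp
    · simp
    · exact Or.inr (Or.inr (Or.inr ⟨m, rfl⟩))
  · simp [planeTrees_zero]
  · simp [planeTrees_one, cherries, numTrees_one]; norm_num1
  · simp [planeTrees_two, cherries, numTrees]; norm_num1
  have h1 := sumCherries_succ (m + 2)
  have h2 := sumCherriesSq_succ (m + 1)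
  have h3 := numTrees_ratio (m + 1)
  have h4 := numTrees_ratio m
  have ha : (0 : ℝ) ≤ numTrees (m + 1) := by positivity
  have e : ∑ T ∈ planeTrees (m + 3), ((cherries T : ℝ) - (m + 3 : ℕ) / 4) ^ 2 =
      sumCherriesSq (m + 3) + (1 - (m + 3) / 2) * sumCherries (m + 3) +
        (m + 3) ^ 2 / 16 * numTrees (m + 3) := by
    rw [sumCherriesSq, sumCherries, numTrees, Finset.mul_sum, Finset.cast_card, Finset.mul_sum,
      ← Finset.sum_add_distrib, ← Finset.sum_add_distrib]
    refine Finset.sum_congr rfl fun T _ => ?_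
    push_cast; ring
  rw [e]
  push_cast at h1 h2 h3 h4 ⊢
  norm_num [add_assoc] at h1 h2 h3 h4 ⊢
  rw [h1, h2]
  generalize (numTrees (m + 1) : ℝ) = a at *
  generalize (numTrees (m + 2) : ℝ) = b at *
  generalize (numTrees (m + 3) : ℝ) = c at *
  have hm : (0 : ℝ) ≤ m := by positivity
  generalize (m : ℝ) = x at *
  rw [← sub_nonneg]
  have hx : 0 < x + 2 := by linarith
  have : (x + 2) * ((x + 3) * c - ((x + 1) * x * a + ((1 - (x + 3) / 2) * ((x + 2) * b) +
      (x + 3) ^ 2 / 16 * c))) = a * (15 * x ^ 2 + (5 + 101 / 4) * x + (2 + 39 / 4)) := by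
    linear_combination (x + 2) * (1 - (x + 3) / 16) * h3 +
      ((1 - (x + 3) / 16) * (4 * x + 6) - (x + 2) * (1 - (x + 3) / 2)) * h4
  refine nonneg_of_mul_nonneg_left (b := x + 2) ?_ hx
  rw [mul_comm, this]
  positivity

end PTree

namespace PTree

/-- The branch-preserving combination of two leaf maps. -/
def joinMap (a a' : ℕ) (g h : ℕ → ℕ) : ℕ → ℕ := fun i => if i < a then g i else h (i - a) + a'

/-- The branch-swapping combination of two leaf maps. -/
def swapMap (a a' : ℕ) (g h : ℕ → ℕ) : ℕ → ℕ := fun i => if i < a then g i + a' else h (i - a)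

theorem joinMap_lt {a a' i : ℕ} (g h : ℕ → ℕ) (hi : i < a) : joinMap a a' g h i = g i := if_pos hi
theorem joinMap_ge {a a' i : ℕ} (g h : ℕ → ℕ) (hi : ¬ i < a) :
    joinMap a a' g h i = h (i - a) + a' := if_neg hi
theorem swapMap_lt {a a' i : ℕ} (g h : ℕ → ℕ) (hi : i < a) :
    swapMap a a' g h i = g i + a' := if_pos hi
theorem swapMap_ge {a a' i : ℕ} (g h : ℕ → ℕ) (hi : ¬ i < a) :
    swapMap a a' g h i = h (i - a) := if_neg hi

theorem isoFuns_node (l r l' r' : PTree) : isoFuns (node l r) (node l' r') =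
    ((isoFuns l l').flatMap fun g => (isoFuns r r').map fun h => joinMap l.size l'.size g h) ++
    ((isoFuns l r').flatMap fun g => (isoFuns r l').map fun h => swapMap l.size l'.size g h) := by
  rw [isoFuns]; rfl

theorem isoFuns_leaf_leaf : isoFuns leaf leaf = [fun i => i] := by rw [isoFuns]
theorem isoFuns_leaf_node (l r : PTree) : isoFuns leaf (node l r) = [] := by rw [isoFuns] <;> simp
theorem isoFuns_node_leaf (l r : PTree) : isoFuns (node l r) leaf = [] := by rw [isoFuns] <;> simp

theorem mem_isoFuns_node {l r l' r' : PTree} {f : ℕ → ℕ} :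
    f ∈ isoFuns (node l r) (node l' r') ↔
      (∃ g ∈ isoFuns l l', ∃ h ∈ isoFuns r r', f = joinMap l.size l'.size g h) ∨
      (∃ g ∈ isoFuns l r', ∃ h ∈ isoFuns r l', f = swapMap l.size l'.size g h) := by
  rw [isoFuns_node]
  simp only [List.mem_append, List.mem_flatMap, List.mem_map, eq_comm]

/-- Induction over the elements of `isoFuns`. -/
theorem isoFuns_induction {P : PTree → PTree → (ℕ → ℕ) → Prop}
    (leaf : P leaf leaf fun i => i)
    (join : ∀ l r l' r' g h, g ∈ isoFuns l l' → h ∈ isoFuns r r' → P l l' g → P r r' h →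
      P (node l r) (node l' r') (joinMap l.size l'.size g h))
    (swap : ∀ l r l' r' g h, g ∈ isoFuns l r' → h ∈ isoFuns r l' → P l r' g → P r l' h →
      P (node l r) (node l' r') (swapMap l.size l'.size g h))
    {T T' : PTree} {f : ℕ → ℕ} (hf : f ∈ isoFuns T T') : P T T' f := by
  induction T generalizing T' f with
  | leaf =>
    cases T' with
    | leaf => rw [isoFuns_leaf_leaf, List.mem_singleton] at hf; rw [hf]; exact leaf
    | node l' r' => simp [isoFuns_leaf_node] at hf
  | node l r hl hr =>
    cases T' with
    | leaf => simp [isoFuns_node_leaf] at hf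
    | node l' r' =>
      rcases mem_isoFuns_node.mp hf with ⟨g, hg, h, hh, rfl⟩ | ⟨g, hg, h, hh, rfl⟩
      · exact join _ _ _ _ _ _ hg hh (hl hg) (hr hh)
      · exact swap _ _ _ _ _ _ hg hh (hl hg) (hr hh)

theorem size_eq_of_mem_isoFuns {T T' : PTree} {f : ℕ → ℕ} (hf : f ∈ isoFuns T T') :
    T.size = T'.size := by
  refine isoFuns_induction (P := fun T T' _ => T.size = T'.size) rfl ?_ ?_ hf
  · intro l r l' r' g h _ _ h1 h2; simp only [size]; omega
  · intro l r l' r' g h _ _ h1 h2; simp only [size]; omega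

theorem height_eq_of_mem_isoFuns {T T' : PTree} {f : ℕ → ℕ} (hf : f ∈ isoFuns T T') :
    T.height = T'.height := by
  refine isoFuns_induction (P := fun T T' _ => T.height = T'.height) rfl ?_ ?_ hf
  · intro l r l' r' g h _ _ h1 h2; simp only [height, h1, h2]
  · intro l r l' r' g h _ _ h1 h2; simp only [height, h1, h2, max_comm]

theorem lt_of_mem_isoFuns {T T' : PTree} {f : ℕ → ℕ} (hf : f ∈ isoFuns T T') :
    ∀ i < T.size, f i < T.size := by
  refine isoFuns_induction (P := fun T _ f => ∀ i < T.size, f i < T.size) ?_ ?_ ?_ hf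
  · simp
  · intro l r l' r' g h hg hh h1 h2 i hi
    have := size_eq_of_mem_isoFuns hg
    have := size_eq_of_mem_isoFuns hh
    simp only [size, joinMap] at *
    split_ifs with hc
    · have := h1 i hc; omega
    · have := h2 (i - l.size) (by omega); omega
  · intro l r l' r' g h hg hh h1 h2 i hi
    have := size_eq_of_mem_isoFuns hg
    have := size_eq_of_mem_isoFuns hh
    simp only [size, swapMap] at *
    split_ifs with hc
    · have := h1 i hc; omega
    · have := h2 (i - l.size) (by omega); omega

theorem exists_id_isoFuns (T : PTree) : ∃ f ∈ isoFuns T T, ∀ i < T.size, f i = i := by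
  induction T with
  | leaf => exact ⟨fun i => i, by simp [isoFuns_leaf_leaf], fun _ _ => rfl⟩
  | node l r hl hr =>
    obtain ⟨g, hg, hg'⟩ := hl
    obtain ⟨h, hh, hh'⟩ := hr
    refine ⟨_, mem_isoFuns_node.mpr (Or.inl ⟨g, hg, h, hh, rfl⟩), fun i hi => ?_⟩
    simp only [joinMap, size] at *
    split_ifs with hc
    · exact hg' i hc
    · rw [hh' _ (by omega)]; omega

theorem exists_inv_isoFuns {T T' : PTree} {f : ℕ → ℕ} (hf : f ∈ isoFuns T T') :
    ∃ k ∈ isoFuns T' T, ∀ i < T.size, k (f i) = i := by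
  refine isoFuns_induction (P := fun T T' f => ∃ k ∈ isoFuns T' T, ∀ i < T.size, k (f i) = i)
    ⟨fun i => i, by simp [isoFuns_leaf_leaf], fun _ _ => rfl⟩ ?_ ?_ hf
  · rintro l r l' r' g h hg hh ⟨g', hg', e1⟩ ⟨h', hh', e2⟩
    refine ⟨_, mem_isoFuns_node.mpr (Or.inl ⟨g', hg', h', hh', rfl⟩), fun i hi => ?_⟩
    have s1 := size_eq_of_mem_isoFuns hg
    have m1 := lt_of_mem_isoFuns hg
    simp only [size] at *
    by_cases hc : i < l.size
    · have := m1 i hc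
      rw [joinMap_lt _ _ hc, joinMap_lt _ _ (by omega), e1 i hc]
    · rw [joinMap_ge _ _ hc, joinMap_ge _ _ (by omega), Nat.add_sub_cancel, e2 _ (by omega)]; omega
  · rintro l r l' r' g h hg hh ⟨g', hg', e1⟩ ⟨h', hh', e2⟩
    refine ⟨_, mem_isoFuns_node.mpr (Or.inr ⟨h', hh', g', hg', rfl⟩), fun i hi => ?_⟩
    have s1 := size_eq_of_mem_isoFuns hh
    have m1 := lt_of_mem_isoFuns hh
    simp only [size] at *
    by_cases hc : i < l.size
    · rw [swapMap_lt _ _ hc, swapMap_ge _ _ (by omega), Nat.add_sub_cancel, e1 i hc]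
    · have := m1 (i - l.size) (by omega)
      rw [swapMap_ge _ _ hc, swapMap_lt _ _ (by omega), e2 _ (by omega)]; omega

theorem exists_comp_isoFuns {T T' T'' : PTree} {f f' : ℕ → ℕ} (hf : f ∈ isoFuns T T')
    (hf' : f' ∈ isoFuns T' T'') : ∃ k ∈ isoFuns T T'', ∀ i < T.size, k i = f' (f i) := by
  induction T generalizing T' T'' f f' with
  | leaf =>
    cases T' with
    | node l' r' => simp [isoFuns_leaf_node] at hf
    | leaf =>
      rw [isoFuns_leaf_leaf, List.mem_singleton] at hf
      exact ⟨f', hf', fun i _ => by rw [hf]⟩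
  | node l r hl hr =>
    cases T' with
    | leaf => simp [isoFuns_node_leaf] at hf
    | node l' r' =>
      cases T'' with
      | leaf => simp [isoFuns_node_leaf] at hf'
      | node l'' r'' =>
        rcases mem_isoFuns_node.mp hf with ⟨g, hg, h, hh, rfl⟩ | ⟨g, hg, h, hh, rfl⟩ <;>
        rcases mem_isoFuns_node.mp hf' with ⟨g', hg', h', hh', rfl⟩ | ⟨g', hg', h', hh', rfl⟩
        · obtain ⟨x, hx, ex⟩ := hl hg hg'
          obtain ⟨y, hy, ey⟩ := hr hh hh'
          refine ⟨_, mem_isoFuns_node.mpr (Or.inl ⟨x, hx, y, hy, rfl⟩), fun i hi => ?_⟩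
          have s1 := size_eq_of_mem_isoFuns hg
          have m1 := lt_of_mem_isoFuns hg
          simp only [size] at *
          by_cases hc : i < l.size
          · have := m1 i hc
            rw [joinMap_lt _ _ hc, joinMap_lt _ _ hc, joinMap_lt _ _ (by omega), ex i hc]
          · rw [joinMap_ge _ _ hc, joinMap_ge _ _ hc, joinMap_ge _ _ (by omega), ey _ (by omega), Nat.add_sub_cancel]
        · obtain ⟨x, hx, ex⟩ := hl hg hg'
          obtain ⟨y, hy, ey⟩ := hr hh hh'
          refine ⟨_, mem_isoFuns_node.mpr (Or.inr ⟨x, hx, y, hy, rfl⟩), fun i hi => ?_⟩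
          have s1 := size_eq_of_mem_isoFuns hg
          have m1 := lt_of_mem_isoFuns hg
          simp only [size] at *
          by_cases hc : i < l.size
          · have := m1 i hc
            rw [swapMap_lt _ _ hc, joinMap_lt _ _ hc, swapMap_lt _ _ (by omega), ex i hc]
          · rw [swapMap_ge _ _ hc, joinMap_ge _ _ hc, swapMap_ge _ _ (by omega), ey _ (by omega), Nat.add_sub_cancel]
        · obtain ⟨x, hx, ex⟩ := hl hg hh'
          obtain ⟨y, hy, ey⟩ := hr hh hg'
          refine ⟨_, mem_isoFuns_node.mpr (Or.inr ⟨x, hx, y, hy, rfl⟩), fun i hi => ?_⟩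
          have s1 := size_eq_of_mem_isoFuns hh
          have m1 := lt_of_mem_isoFuns hh
          simp only [size] at *
          by_cases hc : i < l.size
          · rw [swapMap_lt _ _ hc, swapMap_lt _ _ hc, joinMap_ge _ _ (by omega), ex i hc, Nat.add_sub_cancel]
          · have := m1 (i - l.size) (by omega)
            rw [swapMap_ge _ _ hc, swapMap_ge _ _ hc, joinMap_lt _ _ (by omega), ey _ (by omega)]
        · obtain ⟨x, hx, ex⟩ := hl hg hh'
          obtain ⟨y, hy, ey⟩ := hr hh hg'
          refine ⟨_, mem_isoFuns_node.mpr (Or.inl ⟨x, hx, y, hy, rfl⟩), fun i hi => ?_⟩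
          have s1 := size_eq_of_mem_isoFuns hh
          have m1 := lt_of_mem_isoFuns hh
          simp only [size] at *
          by_cases hc : i < l.size
          · rw [joinMap_lt _ _ hc, swapMap_lt _ _ hc, swapMap_ge _ _ (by omega), ex i hc, Nat.add_sub_cancel]
          · have := m1 (i - l.size) (by omega)
            rw [joinMap_ge _ _ hc, swapMap_ge _ _ hc, swapMap_lt _ _ (by omega), ey _ (by omega)]

theorem pairwise_isoFuns (T T' : PTree) :
    (isoFuns T T').Pairwise fun f g => ∃ i < T.size, f i ≠ g i := by
  induction T generalizing T' with
  | leaf => cases T' <;> simp [isoFuns_leaf_leaf, isoFuns_leaf_node]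
  | node l r hl hr =>
    cases T' with
    | leaf => simp [isoFuns_node_leaf]
    | node l' r' =>
      rw [isoFuns_node, List.pairwise_append, List.pairwise_flatMap, List.pairwise_flatMap]
      simp only [List.pairwise_map, List.mem_flatMap, List.mem_map]
      refine ⟨⟨?_, ?_⟩, ⟨?_, ?_⟩, ?_⟩
      · intro g _
        refine (hr r').imp ?_
        rintro h h' ⟨i, hi, hne⟩
        refine ⟨i + l.size, by simp only [size]; omega, ?_⟩
        simpa [joinMap] using hne
      · refine (hl l').imp ?_
        rintro g g' ⟨i, hi, hne⟩ _ ⟨h, _, rfl⟩ _ ⟨h', _, rfl⟩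
        refine ⟨i, by simp only [size]; omega, ?_⟩
        simpa [joinMap, hi] using hne
      · intro g _
        refine (hr l').imp ?_
        rintro h h' ⟨i, hi, hne⟩
        refine ⟨i + l.size, by simp only [size]; omega, ?_⟩
        simpa [swapMap] using hne
      · refine (hl r').imp ?_
        rintro g g' ⟨i, hi, hne⟩ _ ⟨h, _, rfl⟩ _ ⟨h', _, rfl⟩
        refine ⟨i, by simp only [size]; omega, ?_⟩
        simpa [swapMap, hi] using hne
      · rintro _ ⟨g, hg, h, hh, rfl⟩ _ ⟨g', hg', h', hh', rfl⟩
        have := size_pos l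
        refine ⟨0, by simp only [size]; omega, ?_⟩
        have s1 := size_eq_of_mem_isoFuns hg
        have m1 := lt_of_mem_isoFuns hg 0 this
        simp only [joinMap, swapMap, if_pos this]
        omega

theorem length_isoFuns_node (l r l' r' : PTree) : (isoFuns (node l r) (node l' r')).length =
    (isoFuns l l').length * (isoFuns r r').length +
      (isoFuns l r').length * (isoFuns r l').length := by
  rw [isoFuns_node, List.length_append]
  simp [List.length_flatMap]

theorem sum_length_isoFuns (T : PTree) (n : ℕ) :
    ∑ T' ∈ planeTrees n, (isoFuns T T').length = if n = T.size then 2 ^ (n - 1) else 0 := by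
  induction T generalizing n with
  | leaf =>
    obtain rfl | rfl | hn : n = 0 ∨ n = 1 ∨ 2 ≤ n := by omega
    · simp [planeTrees_zero, size]
    · simp [planeTrees_one, isoFuns_leaf_leaf, size]
    · rw [sum_planeTrees hn, if_neg (by simp only [size]; omega)]
      simp [isoFuns_leaf_node]
  | node l r hl hr =>
    have p1 := size_pos l
    have p2 := size_pos r
    obtain rfl | rfl | hn : n = 0 ∨ n = 1 ∨ 2 ≤ n := by omega
    · simp [planeTrees_zero, size]; omega
    · rw [if_neg (by simp only [size]; omega)]
      simp [planeTrees_one, isoFuns_node_leaf]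
    · rw [sum_planeTrees hn]
      simp only [length_isoFuns_node, Finset.sum_add_distrib]
      have e1 : ∀ p : ℕ × ℕ, ∑ x ∈ planeTrees p.1, ∑ y ∈ planeTrees p.2,
          (isoFuns l x).length * (isoFuns r y).length =
          (if p.1 = l.size then 2 ^ (p.1 - 1) else 0) *
          (if p.2 = r.size then 2 ^ (p.2 - 1) else 0) := by
        intro p; rw [← Finset.sum_mul_sum, hl, hr]
      have e2 : ∀ p : ℕ × ℕ, ∑ x ∈ planeTrees p.1, ∑ y ∈ planeTrees p.2,
          (isoFuns l y).length * (isoFuns r x).length =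
          (if p.2 = l.size then 2 ^ (p.2 - 1) else 0) *
          (if p.1 = r.size then 2 ^ (p.1 - 1) else 0) := by
        intro p; rw [Finset.sum_comm, ← Finset.sum_mul_sum, hl, hr]
      simp only [e1, e2]
      by_cases h : n = (node l r).size
      · have hp : 2 ^ (l.size - 1) * 2 ^ (r.size - 1) + 2 ^ (l.size - 1) * 2 ^ (r.size - 1) =
            2 ^ (n - 1) := by
          rw [← two_mul, ← pow_add, ← pow_succ']
          congr 1; simp only [size] at h; omega
        simp only [size] at h
        rw [if_pos (by simpa [size] using h), Finset.sum_eq_single (l.size, r.size),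
          Finset.sum_eq_single (r.size, l.size)]
        · simpa using hp
        · rintro ⟨a, b⟩ hab hne
          have := Finset.HasAntidiagonal.mem_antidiagonal.mp hab
          by_cases hb : b = l.size
          · have ha : a = r.size := by simp only at this; omega
            exact absurd (by rw [ha, hb]) hne
          · simp [hb]
        · intro hc; exact absurd (Finset.HasAntidiagonal.mem_antidiagonal.mpr (by omega)) hc
        · rintro ⟨a, b⟩ hab hne
          have := Finset.HasAntidiagonal.mem_antidiagonal.mp hab
          by_cases hb : b = r.size
          · have ha : a = l.size := by simp only at this; omega
            exact absurd (by rw [ha, hb]) hne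
          · simp [hb]
        · intro hc; exact absurd (Finset.HasAntidiagonal.mem_antidiagonal.mpr (by omega)) hc
      · rw [if_neg h, Finset.sum_eq_zero, Finset.sum_eq_zero, zero_add]
        · rintro ⟨a, b⟩ hab
          have := Finset.HasAntidiagonal.mem_antidiagonal.mp hab
          simp only [size] at h this ⊢
          split_ifs <;> omega
        · rintro ⟨a, b⟩ hab
          have := Finset.HasAntidiagonal.mem_antidiagonal.mp hab
          simp only [size] at h this ⊢
          split_ifs <;> omega

end PTree

namespace PTree
open Equiv (Perm)

/-- The permutation of `Fin n` which agrees with `f`, if there is one. -/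
noncomputable def toPerm (n : ℕ) (f : ℕ → ℕ) : Perm (Fin n) :=
  if h : ∃ σ : Perm (Fin n), ∀ i, (σ i : ℕ) = f i then h.choose else 1

theorem toPerm_apply {n : ℕ} {T T' : PTree} (hT : T.size = n) {f : ℕ → ℕ} (hf : f ∈ isoFuns T T')
    (i : Fin n) : (toPerm n f i : ℕ) = f i := by
  have h : ∃ σ : Perm (Fin n), ∀ i, (σ i : ℕ) = f i := by
    subst hT
    obtain ⟨k, _, hk⟩ := exists_inv_isoFuns hf
    have hinj : Function.Injective
        (fun i : Fin T.size => (⟨f i, lt_of_mem_isoFuns hf i i.2⟩ : Fin T.size)) := by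
      intro i j hij
      have := congrArg (fun x : Fin T.size => k x) hij
      simp only [hk _ i.2, hk _ j.2] at this
      exact Fin.ext this
    exact ⟨Equiv.ofBijective _ (Finite.injective_iff_bijective.mp hinj), fun i => rfl⟩
  rw [toPerm, dif_pos h]
  exact h.choose_spec i

/-- The leaf permutations induced by the isomorphisms from `T` to `T'`. -/
noncomputable def isoPerms (n : ℕ) (T T' : PTree) : Finset (Perm (Fin n)) :=
  ((isoFuns T T').map (toPerm n)).toFinset

theorem mem_isoPerms {n : ℕ} {T T' : PTree} (hT : T.size = n) {φ : Perm (Fin n)} :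
    φ ∈ isoPerms n T T' ↔ ∃ f ∈ isoFuns T T', ∀ i, (φ i : ℕ) = f i := by
  rw [isoPerms, List.mem_toFinset, List.mem_map]
  constructor
  · rintro ⟨f, hf, rfl⟩; exact ⟨f, hf, toPerm_apply hT hf⟩
  · rintro ⟨f, hf, h⟩
    exact ⟨f, hf, Equiv.ext fun i => Fin.ext (by rw [toPerm_apply hT hf, h])⟩

theorem sum_isoPerms {n : ℕ} {T T' : PTree} (hT : T.size = n) {M : Type*} [AddCommMonoid M]
    (F : Perm (Fin n) → M) :
    ∑ φ ∈ isoPerms n T T', F φ = ((isoFuns T T').map fun f => F (toPerm n f)).sum := by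
  rw [isoPerms, List.sum_toFinset, List.map_map]
  · rfl
  · rw [List.Nodup, List.pairwise_map]
    refine (pairwise_isoFuns T T').imp_of_mem ?_
    rintro f g hf hg ⟨i, hi, hne⟩ he
    rw [hT] at hi
    apply hne
    rw [← toPerm_apply hT hf ⟨i, hi⟩, ← toPerm_apply hT hg ⟨i, hi⟩, he]

theorem card_isoPerms {n : ℕ} {T T' : PTree} (hT : T.size = n) :
    (isoPerms n T T').card = (isoFuns T T').length := by
  have := sum_isoPerms (T' := T') hT (fun _ => (1 : ℕ))
  simpa using this

theorem one_mem_isoPerms {n : ℕ} {T : PTree} (hT : T.size = n) : 1 ∈ isoPerms n T T := by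
  obtain ⟨f, hf, h⟩ := exists_id_isoFuns T
  exact (mem_isoPerms hT).mpr ⟨f, hf, fun i => by simp [h i (by rw [hT]; exact i.2)]⟩

theorem inv_mem_isoPerms {n : ℕ} {T T' : PTree} (hT : T.size = n) {φ : Perm (Fin n)}
    (hφ : φ ∈ isoPerms n T T') : φ⁻¹ ∈ isoPerms n T' T := by
  obtain ⟨f, hf, h⟩ := (mem_isoPerms hT).mp hφ
  obtain ⟨k, hk, hk'⟩ := exists_inv_isoFuns hf
  have hT' := (size_eq_of_mem_isoFuns hf).symm.trans hT
  refine (mem_isoPerms hT').mpr ⟨k, hk, fun i => ?_⟩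
  have h1 := h (φ⁻¹ i)
  rw [show φ (φ⁻¹ i) = i from φ.apply_symm_apply i] at h1
  rw [h1, hk' _ (by rw [hT]; exact (φ⁻¹ i).2)]

theorem mul_mem_isoPerms {n : ℕ} {T T' T'' : PTree} (hT : T.size = n) {φ ψ : Perm (Fin n)}
    (hφ : φ ∈ isoPerms n T T') (hψ : ψ ∈ isoPerms n T' T'') : ψ * φ ∈ isoPerms n T T'' := by
  obtain ⟨f, hf, h⟩ := (mem_isoPerms hT).mp hφ
  have hT' := (size_eq_of_mem_isoFuns hf).symm.trans hT
  obtain ⟨g, hg, h'⟩ := (mem_isoPerms hT').mp hψ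
  obtain ⟨k, hk, hk'⟩ := exists_comp_isoFuns hf hg
  refine (mem_isoPerms hT).mpr ⟨k, hk, fun i => ?_⟩
  rw [hk' _ (by rw [hT]; exact i.2), ← h, ← h', Perm.mul_apply]

theorem sum_card_isoPerms {n : ℕ} {T : PTree} (hT : T.size = n) :
    ∑ T' ∈ planeTrees n, (isoPerms n T T').card = 2 ^ (n - 1) := by
  have h := sum_length_isoFuns T n
  rw [if_pos hT.symm] at h
  rw [← h]
  exact Finset.sum_congr rfl fun T' _ => card_isoPerms hT

/-- Counting classes of a finite groupoid. -/
theorem card_classes_mul {X : Type*} (s : Finset X) (R : X → X → Prop) (a : X → X → ℕ) (K : ℕ)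
    (hR : ∀ x ∈ s, ∀ y ∈ s, (R x y ↔ 0 < a x y)) (hrefl : ∀ x ∈ s, R x x)
    (hsymm : ∀ x ∈ s, ∀ y ∈ s, R x y → R y x)
    (htrans : ∀ x ∈ s, ∀ y ∈ s, ∀ z ∈ s, R x y → R y z → R x z)
    (ha : ∀ x ∈ s, ∀ y ∈ s, R x y → a x y = a x x) (hK : ∀ x ∈ s, ∑ y ∈ s, a x y = K)
    (P : X → Prop) (hP : ∀ x ∈ s, ∀ y ∈ s, R x y → P x → P y) :
    (((s.image fun x => s.filter (R x)).filter fun c => ∃ x ∈ c, P x).card) * K =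
      ∑ x ∈ s.filter P, a x x := by
  set C := fun x => s.filter (R x) with hC
  have hmem : ∀ x ∈ s, ∀ y ∈ s, (C x = C y ↔ R x y) := by
    intro x hx y hy
    constructor
    · intro h
      have : y ∈ C y := Finset.mem_filter.mpr ⟨hy, hrefl y hy⟩
      rw [← h] at this
      exact (Finset.mem_filter.mp this).2
    · intro h
      ext z
      simp only [hC, Finset.mem_filter]
      exact ⟨fun hz => ⟨hz.1, htrans y hy x hx z hz.1 (hsymm x hx y hy h) hz.2⟩,
        fun hz => ⟨hz.1, htrans x hx y hy z hz.1 h hz.2⟩⟩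
  have hKx : ∀ x ∈ s, (C x).card * a x x = K := by
    intro x hx
    rw [← hK x hx, ← Finset.sum_filter_add_sum_filter_not s (R x)]
    rw [Finset.sum_eq_zero (s := s.filter fun y => ¬ R x y), add_zero, Finset.card_eq_sum_ones,
      Finset.sum_mul]
    · refine Finset.sum_congr rfl fun y hy => ?_
      have := Finset.mem_filter.mp hy
      rw [one_mul, ha x hx y this.1 this.2]
    · intro y hy
      have := Finset.mem_filter.mp hy
      have h := (hR x hx y this.1).not.mp this.2
      omega
  have hmaps : ∀ x ∈ s.filter P, C x ∈ (s.image C).filter fun c => ∃ x ∈ c, P x := by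
    intro x hx
    have := Finset.mem_filter.mp hx
    exact Finset.mem_filter.mpr ⟨Finset.mem_image_of_mem _ this.1, x,
      Finset.mem_filter.mpr ⟨this.1, hrefl x this.1⟩, this.2⟩
  rw [← Finset.sum_fiberwise_of_maps_to hmaps, ← smul_eq_mul, ← Finset.sum_const]
  refine Finset.sum_congr rfl fun c hc => ?_
  obtain ⟨hc1, x, hxc, hPx⟩ := Finset.mem_filter.mp hc
  obtain ⟨y, hy, rfl⟩ := Finset.mem_image.mp hc1
  have hx := Finset.mem_filter.mp hxc
  have e : (s.filter P).filter (fun z => C z = C y) = C y := by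
    ext z
    simp only [Finset.mem_filter]
    constructor
    · rintro ⟨⟨hz, _⟩, h⟩
      exact Finset.mem_filter.mpr ⟨hz, hsymm z hz y hy ((hmem z hz y hy).mp h)⟩
    · intro hz
      have hz := Finset.mem_filter.mp hz
      have hyz := (hmem y hy z hz.1).mpr hz.2
      have hyx := (hmem y hy x hx.1).mpr hx.2
      exact ⟨⟨hz.1, hP x hx.1 z hz.1 ((hmem x hx.1 z hz.1).mp (hyx.symm.trans hyz)) hPx⟩, hyz.symm⟩
  have e' : ∑ z ∈ (s.filter P).filter (fun z => C z = C y), a z z = ∑ z ∈ C y, a z z := by rw [e]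
  refine Eq.trans ?_ e'.symm
  rw [← hKx y hy, Finset.card_eq_sum_ones, Finset.sum_mul]
  refine Finset.sum_congr rfl fun z hz => ?_
  have hz := Finset.mem_filter.mp hz
  have h1 := hKx y hy
  have h2 := hKx z hz.1
  rw [← (hmem y hy z hz.1).mpr hz.2, ← h1] at h2
  have hpos : 0 < (C y).card := Finset.card_pos.mpr ⟨z, Finset.mem_filter.mpr hz⟩
  rw [one_mul]
  exact (Nat.eq_of_mul_eq_mul_left hpos h2).symm

end PTree

namespace PTree
open Equiv (Perm)

/-- The list of values of a permutation. -/
def permList {n : ℕ} (v : Perm (Fin n)) : List ℕ := List.ofFn fun i => (v i : ℕ)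

theorem permList_getD {n : ℕ} (v : Perm (Fin n)) (i : Fin n) : (permList v).getD i 0 = v i := by
  simp [permList]

theorem permList_injective (n : ℕ) : Function.Injective (permList (n := n)) := by
  intro v w h
  refine Equiv.ext fun i => Fin.ext ?_
  rw [← permList_getD, h, permList_getD]

theorem mem_permutations_range {n : ℕ} {L : List ℕ} :
    L ∈ (List.range n).permutations.toFinset ↔ ∃ v : Perm (Fin n), permList v = L := by
  rw [List.mem_toFinset, List.mem_permutations]
  constructor
  · intro h
    have hlen : L.length = n := by simpa using h.length_eq
    have hlt : ∀ i : Fin n, L[(i : ℕ)]'(by rw [hlen]; exact i.2) < n := fun i =>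
      List.mem_range.mp (h.subset (List.getElem_mem _))
    have hnd : L.Nodup := h.nodup_iff.mpr List.nodup_range
    have hinj : Function.Injective (fun i : Fin n => (⟨_, hlt i⟩ : Fin n)) := by
      intro i j hij
      have := congrArg Fin.val hij
      exact Fin.ext ((List.Nodup.getElem_inj_iff hnd).mp this)
    refine ⟨Equiv.ofBijective _ (Finite.injective_iff_bijective.mp hinj), ?_⟩
    refine List.ext_getElem (by simp [permList, hlen]) fun i h1 h2 => ?_
    simp [permList]
  · rintro ⟨v, rfl⟩
    refine List.perm_of_nodup_nodup_toFinset_eq ?_ List.nodup_range ?_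
    · exact List.nodup_ofFn.mpr fun i j h => v.injective (Fin.ext h)
    · ext k
      simp only [permList, List.mem_toFinset, List.mem_ofFn, List.mem_range]
      constructor
      · rintro ⟨i, rfl⟩; exact (v i).2
      · intro hk; exact ⟨v.symm ⟨k, hk⟩, by simp⟩

/-- The permutation with a given list of values. -/
noncomputable def listPerm (n : ℕ) (L : List ℕ) : Perm (Fin n) :=
  Function.invFun (permList (n := n)) L

theorem listPerm_permList {n : ℕ} (v : Perm (Fin n)) : listPerm n (permList v) = v :=
  Function.leftInverse_invFun (permList_injective n) v

theorem mem_Triples {n : ℕ} {t : PTree × PTree × List ℕ} :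
    t ∈ Triples n ↔ t.1.size = n ∧ t.2.1.size = n ∧ permList (listPerm n t.2.2) = t.2.2 := by
  simp only [Triples, Finset.mem_product, mem_planeTrees, mem_permutations_range]
  refine and_congr_right fun _ => and_congr_right fun _ => ⟨?_, fun h => ⟨_, h⟩⟩
  rintro ⟨v, hv⟩
  rw [← hv, listPerm_permList]

theorem sum_Triples {n : ℕ} (F : PTree × PTree × List ℕ → ℕ) :
    ∑ t ∈ Triples n, F t =
      ∑ T ∈ planeTrees n, ∑ S ∈ planeTrees n, ∑ v : Perm (Fin n), F (T, S, permList v) := by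
  have e : (List.range n).permutations.toFinset =
      Finset.univ.image (permList (n := n)) := by
    ext L; rw [mem_permutations_range]; simp
  rw [Triples, Finset.sum_product]
  refine Finset.sum_congr rfl fun T _ => ?_
  rw [Finset.sum_product]
  refine Finset.sum_congr rfl fun S _ => ?_
  rw [e, Finset.sum_image fun v _ w _ h => permList_injective n h]

/-- The isomorphisms from one triple to another. -/
noncomputable def tripleIsos (n : ℕ) (t t' : PTree × PTree × List ℕ) :
    Finset (Perm (Fin n) × Perm (Fin n)) :=
  (isoPerms n t.1 t'.1 ×ˢ isoPerms n t.2.1 t'.2.1).filter fun p =>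
    listPerm n t'.2.2 * p.1 = p.2 * listPerm n t.2.2

theorem equivTriple_iff {n : ℕ} {t t' : PTree × PTree × List ℕ} (ht : t ∈ Triples n)
    (ht' : t' ∈ Triples n) : equivTriple n t t' = true ↔ ∃ p, p ∈ tripleIsos n t t' := by
  obtain ⟨T, S, L⟩ := t
  obtain ⟨T', S', L'⟩ := t'
  obtain ⟨h1, h2, h3⟩ := mem_Triples.mp ht
  obtain ⟨h1', h2', h3'⟩ := mem_Triples.mp ht'
  simp only at h1 h2 h3 h1' h2' h3'
  set v := listPerm n L with hv
  set v' := listPerm n L' with hv'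
  simp only [equivTriple, List.any_eq_true, List.all_eq_true, List.mem_range, beq_iff_eq,
    tripleIsos, Finset.mem_filter, Finset.mem_product, Prod.exists, ← h3, ← h3', listPerm_permList]
  constructor
  · rintro ⟨f, hf, g, hg, h⟩
    refine ⟨toPerm n f, toPerm n g, ⟨(mem_isoPerms h1).mpr ⟨f, hf, toPerm_apply h1 hf⟩,
      (mem_isoPerms h2).mpr ⟨g, hg, toPerm_apply h2 hg⟩⟩, Equiv.ext fun i => Fin.ext ?_⟩
    have := h i i.2
    rw [permList_getD, ← toPerm_apply h1 hf, permList_getD, ← toPerm_apply h2 hg] at this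
    exact this
  · rintro ⟨φ, ψ, ⟨hφ, hψ⟩, h⟩
    obtain ⟨f, hf, hf'⟩ := (mem_isoPerms h1).mp hφ
    obtain ⟨g, hg, hg'⟩ := (mem_isoPerms h2).mp hψ
    refine ⟨f, hf, g, hg, fun i hi => ?_⟩
    have e := permList_getD v ⟨i, hi⟩
    simp only at e
    rw [e, ← hg', ← Perm.mul_apply, ← h, Perm.mul_apply, ← permList_getD, hf']

theorem mul_mem_tripleIsos {n : ℕ} {t t' t'' : PTree × PTree × List ℕ} (ht : t ∈ Triples n)
    {p q : Perm (Fin n) × Perm (Fin n)} (hp : p ∈ tripleIsos n t t')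
    (hq : q ∈ tripleIsos n t' t'') : q * p ∈ tripleIsos n t t'' := by
  simp only [tripleIsos, Finset.mem_filter, Finset.mem_product, Prod.fst_mul, Prod.snd_mul]
    at hp hq ⊢
  obtain ⟨h1, h2, -⟩ := mem_Triples.mp ht
  refine ⟨⟨mul_mem_isoPerms h1 hp.1.1 hq.1.1, mul_mem_isoPerms h2 hp.1.2 hq.1.2⟩, ?_⟩
  rw [← mul_assoc, hq.2, mul_assoc, hp.2, mul_assoc]

theorem inv_mem_tripleIsos {n : ℕ} {t t' : PTree × PTree × List ℕ} (ht : t ∈ Triples n)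
    {p : Perm (Fin n) × Perm (Fin n)} (hp : p ∈ tripleIsos n t t') :
    p⁻¹ ∈ tripleIsos n t' t := by
  simp only [tripleIsos, Finset.mem_filter, Finset.mem_product, Prod.fst_inv, Prod.snd_inv]
    at hp ⊢
  obtain ⟨h1, h2, -⟩ := mem_Triples.mp ht
  refine ⟨⟨inv_mem_isoPerms h1 hp.1.1, inv_mem_isoPerms h2 hp.1.2⟩, ?_⟩
  rw [mul_inv_eq_iff_eq_mul, mul_assoc, hp.2, inv_mul_cancel_left]

theorem one_mem_tripleIsos {n : ℕ} {t : PTree × PTree × List ℕ} (ht : t ∈ Triples n) :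
    1 ∈ tripleIsos n t t := by
  obtain ⟨h1, h2, -⟩ := mem_Triples.mp ht
  simp [tripleIsos, one_mem_isoPerms h1, one_mem_isoPerms h2]

theorem card_tripleIsos_eq {n : ℕ} {t t' : PTree × PTree × List ℕ} (ht : t ∈ Triples n)
    {p : Perm (Fin n) × Perm (Fin n)} (hp : p ∈ tripleIsos n t t') :
    (tripleIsos n t t').card = (tripleIsos n t t).card := by
  refine Finset.card_nbij' (fun q => p⁻¹ * q) (fun q => p * q) ?_ ?_ ?_ ?_
  · intro q hq
    exact mul_mem_tripleIsos ht hq (inv_mem_tripleIsos ht hp)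
  · intro q hq
    exact mul_mem_tripleIsos ht hq hp
  · intro q _; simp
  · intro q _; simp

/-- The number of triples `(v, u, w)` with `v` a matching and `(u, w)` an automorphism of
`(T, v, S)`. -/
noncomputable def autWeight (n : ℕ) (T S : PTree) : ℕ :=
  ∑ u ∈ isoPerms n T T, ∑ w ∈ isoPerms n S S,
    (Finset.univ.filter fun v : Perm (Fin n) => v * u = w * v).card

theorem card_tripleIsos (n : ℕ) (T S T' S' : PTree) (v v' : Perm (Fin n)) :
    (tripleIsos n (T, S, permList v) (T', S', permList v')).card =
      ∑ u ∈ isoPerms n T T', ∑ w ∈ isoPerms n S S', if v' * u = w * v then 1 else 0 := by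
  rw [tripleIsos, Finset.card_filter, Finset.sum_product]
  simp only [listPerm_permList]

theorem sum_card_tripleIsos {n : ℕ} {t : PTree × PTree × List ℕ} (ht : t ∈ Triples n) :
    ∑ t' ∈ Triples n, (tripleIsos n t t').card = 2 ^ (n - 1) * 2 ^ (n - 1) := by
  obtain ⟨T, S, L⟩ := t
  obtain ⟨h1, h2, h3⟩ := mem_Triples.mp ht
  simp only at h1 h2 h3
  rw [sum_Triples, ← h3]
  nth_rewrite 1 [← sum_card_isoPerms h1]
  rw [← sum_card_isoPerms h2, Finset.sum_mul_sum]
  refine Finset.sum_congr rfl fun T' _ => Finset.sum_congr rfl fun S' _ => ?_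
  simp only [card_tripleIsos]
  rw [Finset.sum_comm, Finset.card_eq_sum_ones, Finset.card_eq_sum_ones, Finset.sum_mul_sum]
  refine Finset.sum_congr rfl fun u _ => ?_
  rw [Finset.sum_comm]
  refine Finset.sum_congr rfl fun w _ => ?_
  rw [Finset.sum_eq_single (w * listPerm n L * u⁻¹)]
  · simp
  · intro v _ hv
    rw [if_neg]
    exact fun h => hv (by rw [← h]; simp)
  · simp

theorem sum_filter_card_tripleIsos (n : ℕ) (P : PTree → Prop) [DecidablePred P] :
    ∑ t ∈ (Triples n).filter (fun t => P t.1), (tripleIsos n t t).card =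
      ∑ T ∈ (planeTrees n).filter P, ∑ S ∈ planeTrees n, autWeight n T S := by
  rw [Finset.sum_filter, sum_Triples, Finset.sum_filter]
  refine Finset.sum_congr rfl fun T _ => ?_
  split_ifs with h
  · refine Finset.sum_congr rfl fun S _ => ?_
    simp only [card_tripleIsos, autWeight]
    rw [Finset.sum_comm]
    refine Finset.sum_congr rfl fun u _ => ?_
    rw [Finset.sum_comm]
    refine Finset.sum_congr rfl fun w _ => ?_
    rw [Finset.card_filter]
  · simp

theorem card_tangleClasses_filter (n : ℕ) (P : PTree → Prop) [DecidablePred P]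
    [DecidablePred fun c : Finset (PTree × PTree × List ℕ) => ∃ t ∈ c, P t.1]
    (hP : ∀ T T' f, f ∈ isoFuns T T' → P T → P T') :
    ((tangleClasses n).filter fun c => ∃ t ∈ c, P t.1).card * (2 ^ (n - 1) * 2 ^ (n - 1)) =
      ∑ T ∈ (planeTrees n).filter P, ∑ S ∈ planeTrees n, autWeight n T S := by
  rw [← sum_filter_card_tripleIsos]
  have h := card_classes_mul (Triples n) (fun t t' => equivTriple n t t' = true)
    (fun t t' => (tripleIsos n t t').card) (2 ^ (n - 1) * 2 ^ (n - 1))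
    (fun t ht t' ht' => by
      rw [equivTriple_iff ht ht', Finset.card_pos]; rfl)
    (fun t ht => (equivTriple_iff ht ht).mpr ⟨_, one_mem_tripleIsos ht⟩)
    (fun t ht t' ht' h => by
      obtain ⟨p, hp⟩ := (equivTriple_iff ht ht').mp h
      exact (equivTriple_iff ht' ht).mpr ⟨_, inv_mem_tripleIsos ht hp⟩)
    (fun t ht t' ht' t'' ht'' h h' => by
      obtain ⟨p, hp⟩ := (equivTriple_iff ht ht').mp h
      obtain ⟨q, hq⟩ := (equivTriple_iff ht' ht'').mp h'
      exact (equivTriple_iff ht ht'').mpr ⟨_, mul_mem_tripleIsos ht hp hq⟩)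
    (fun t ht t' ht' h => by
      obtain ⟨p, hp⟩ := (equivTriple_iff ht ht').mp h
      exact card_tripleIsos_eq ht hp)
    (fun t ht => sum_card_tripleIsos ht) (fun t => P t.1)
    (fun t ht t' ht' h hPt => by
      obtain ⟨p, hp⟩ := (equivTriple_iff ht ht').mp h
      simp only [tripleIsos, Finset.mem_filter, Finset.mem_product] at hp
      obtain ⟨f, hf, -⟩ := (mem_isoPerms (mem_Triples.mp ht).1).mp hp.1.1
      exact hP _ _ f hf hPt)
  rw [show (∑ t ∈ (Triples n).filter (fun t => P t.1), (tripleIsos n t t).card) = _ by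
    convert h.symm]
  congr 2
  ext c
  simp only [Finset.mem_filter, tangleClasses, Finset.mem_image]
  exact iff_of_eq (by congr!)

theorem tangleExp_eq (n : ℕ) :
    tangleExp n (fun t => height t.1) =
      (∑ T ∈ planeTrees n, (height T : ℝ) * ∑ S ∈ planeTrees n, (autWeight n T S : ℝ)) /
        ∑ T ∈ planeTrees n, ∑ S ∈ planeTrees n, (autWeight n T S : ℝ) := by
  have hD := card_tangleClasses_filter n (fun _ => True) (fun _ _ _ _ _ => trivial)
  have hD' : (numTanglegrams n : ℝ) * (2 ^ (n - 1) * 2 ^ (n - 1)) =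
      ∑ T ∈ planeTrees n, ∑ S ∈ planeTrees n, (autWeight n T S : ℝ) := by
    rw [Finset.filter_true] at hD
    have e : ((tangleClasses n).filter fun c => ∃ t ∈ c, True) = tangleClasses n := by
      refine Finset.filter_true_of_mem fun c hc => ?_
      obtain ⟨t, ht, rfl⟩ := Finset.mem_image.mp hc
      exact ⟨t, Finset.mem_filter.mpr
        ⟨ht, (equivTriple_iff ht ht).mpr ⟨_, one_mem_tripleIsos ht⟩⟩, trivial⟩
    rw [e] at hD
    rw [numTanglegrams]
    exact_mod_cast hD
  have hp : ∀ k, tangleProb n (fun t => height t.1 = k) =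
      (∑ T ∈ (planeTrees n).filter (fun T => height T = k),
        ∑ S ∈ planeTrees n, (autWeight n T S : ℝ)) /
        ∑ T ∈ planeTrees n, ∑ S ∈ planeTrees n, (autWeight n T S : ℝ) := by
    intro k
    have h := card_tangleClasses_filter n (fun T => height T = k)
      (fun T T' f hf h => (height_eq_of_mem_isoFuns hf).symm.trans h)
    have h' : (((tangleClasses n).filter fun c => ∃ t ∈ c, height t.1 = k).card : ℝ) *
        (2 ^ (n - 1) * 2 ^ (n - 1)) = ∑ T ∈ (planeTrees n).filter (fun T => height T = k),
        ∑ S ∈ planeTrees n, (autWeight n T S : ℝ) := by exact_mod_cast h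
    rw [← hD', ← h', tangleProb, mul_div_mul_right _ _ (by positivity)]
    congr!
  rw [tangleExp, tsum_eq_sum (s := (planeTrees n).image height)]
  · rw [← Finset.sum_fiberwise_of_maps_to (t := (planeTrees n).image height) (g := height)
      (fun T hT => Finset.mem_image_of_mem _ hT), Finset.sum_div]
    refine Finset.sum_congr rfl fun k _ => ?_
    rw [hp, mul_div_assoc', Finset.mul_sum]
    congr 1
    refine Finset.sum_congr rfl fun T hT => ?_
    rw [(Finset.mem_filter.mp hT).2]
  · intro k hk
    rw [hp, Finset.filter_eq_empty_iff.mpr, Finset.sum_empty, zero_div, mul_zero]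
    intro T hT h
    exact hk (Finset.mem_image.mpr ⟨T, hT, h⟩)

end PTree

namespace PTree
open Equiv (Perm)
open scoped Nat

theorem multiset_prod_mul_prod_count_factorial_le (m : Multiset ℕ) (hm : ∀ i ∈ m, 2 ≤ i) :
    m.prod * ∏ i ∈ m.toFinset, (m.count i)! ≤ m.sum ^ (m.sum / 2) := by
  rw [Finset.prod_multiset_count, ← Finset.prod_mul_distrib]
  have h1 : ∀ i ∈ m.toFinset, i ^ m.count i * (m.count i)! ≤ m.sum ^ m.count i := by
    intro i hi
    calc i ^ m.count i * (m.count i)! ≤ i ^ m.count i * m.count i ^ m.count i := by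
          gcongr; exact Nat.factorial_le_pow _
      _ = (m.count i * i) ^ m.count i := by rw [mul_comm, mul_pow]
      _ ≤ m.sum ^ m.count i := by
          gcongr
          rw [Finset.sum_multiset_count m]
          exact Finset.single_le_sum (f := fun i => m.count i • i) (fun _ _ => Nat.zero_le _) hi
  refine (Finset.prod_le_prod' h1).trans ?_
  rw [Finset.prod_pow_eq_pow_sum, Multiset.toFinset_sum_count_eq]
  have h2 : m.card * 2 ≤ m.sum := by
    simpa using Multiset.card_nsmul_le_sum hm
  rcases Nat.eq_zero_or_pos m.sum with h | h
  · have : m.card = 0 := by omega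
    rw [h, this]
  · exact Nat.pow_le_pow_right h (by omega)

theorem card_intertwiners_le_centralizer {G : Type*} [Group G] [Fintype G] [DecidableEq G] (u w : G) :
    (Finset.univ.filter fun v : G => v * u = w * v).card ≤ Nat.card (Subgroup.centralizer {u}) := by
  rcases (Finset.univ.filter fun v : G => v * u = w * v).eq_empty_or_nonempty with h | ⟨v₀, h₀⟩
  · rw [h]; exact Nat.zero_le _
  · rw [Nat.card_eq_fintype_card, ← Fintype.card_coe]
    have h₀ := (Finset.mem_filter.mp h₀).2
    refine Fintype.card_le_of_injective
      (fun v => (⟨v₀⁻¹ * v, ?_⟩ : Subgroup.centralizer {u})) ?_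
    · have hv := (Finset.mem_filter.mp v.2).2
      have key : v₀⁻¹ * w = u * v₀⁻¹ := by
        rw [inv_mul_eq_iff_eq_mul, ← mul_assoc, h₀, mul_inv_cancel_right]
      rw [Subgroup.mem_centralizer_singleton_iff, mul_assoc, hv, ← mul_assoc, key, mul_assoc]
    · intro v v' h
      have := congrArg Subtype.val h
      exact Subtype.ext (mul_left_cancel this)

theorem card_intertwiners_eq_centralizer {G : Type*} [Group G] [Fintype G] [DecidableEq G] {u w : G}
    (h : IsConj u w) :
    (Finset.univ.filter fun v : G => v * u = w * v).card = Nat.card (Subgroup.centralizer {u}) := by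
  refine le_antisymm (card_intertwiners_le_centralizer u w) ?_
  obtain ⟨v₀, h₀⟩ := isConj_iff.mp h
  rw [Nat.card_eq_fintype_card, ← Fintype.card_coe]
  refine Fintype.card_le_of_injective (fun c => ⟨v₀ * c, ?_⟩) ?_
  · have hc := Subgroup.mem_centralizer_singleton_iff.mp c.2
    refine Finset.mem_filter.mpr ⟨Finset.mem_univ _, ?_⟩
    rw [← h₀, mul_assoc, hc]; group
  · intro v v' h
    have := congrArg Subtype.val h
    exact Subtype.ext (mul_left_cancel this)

theorem card_intertwiners_le {n : ℕ} (u w : Perm (Fin n)) :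
    (Finset.univ.filter fun v : Perm (Fin n) => v * u = w * v).card ≤
      (n - u.support.card)! * u.support.card ^ (u.support.card / 2) := by
  refine (card_intertwiners_le_centralizer u w).trans ?_
  rw [Equiv.Perm.nat_card_centralizer, mul_assoc, Fintype.card_fin, Equiv.Perm.sum_cycleType]
  gcongr
  have := multiset_prod_mul_prod_count_factorial_le u.cycleType
    (fun i hi => Equiv.Perm.two_le_of_mem_cycleType hi)
  rwa [Equiv.Perm.sum_cycleType] at this

theorem card_support_eq_of_intertwiner {n : ℕ} {u w v : Perm (Fin n)} (h : v * u = w * v) :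
    u.support.card = w.support.card := by
  have : w = v * u * v⁻¹ := by rw [h]; group
  rw [this, Equiv.Perm.card_support_conj]

theorem card_intertwiners_involution {n : ℕ} {u w : Perm (Fin n)} (hu : u ^ 2 = 1) (hw : w ^ 2 = 1)
    (h : u.support.card = w.support.card) :
    (Finset.univ.filter fun v : Perm (Fin n) => v * u = w * v).card =
      (n - u.support.card)! * (2 ^ (u.support.card / 2) * (u.support.card / 2)!) := by
  have hu' := Equiv.Perm.cycleType_of_pow_prime_eq_one (p := 2) hu
  have hw' := Equiv.Perm.cycleType_of_pow_prime_eq_one (p := 2) hw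
  have su := Equiv.Perm.sum_cycleType u
  have sw := Equiv.Perm.sum_cycleType w
  rw [hu', Multiset.sum_replicate, smul_eq_mul] at su
  rw [hw', Multiset.sum_replicate, smul_eq_mul] at sw
  have hc : Multiset.card u.cycleType = Multiset.card w.cycleType := by omega
  have hconj : IsConj u w := by
    rw [Equiv.Perm.isConj_iff_cycleType_eq, hu', hw', hc]
  have hk : u.support.card / 2 = Multiset.card u.cycleType := by omega
  rw [card_intertwiners_eq_centralizer hconj, Equiv.Perm.nat_card_centralizer, mul_assoc,
    Fintype.card_fin, Equiv.Perm.sum_cycleType, hk]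
  congr 1
  set m := Multiset.card u.cycleType
  rw [hu', Multiset.prod_replicate]
  congr 1
  rcases Nat.eq_zero_or_pos m with h0 | h0
  · simp [h0]
  · rw [Multiset.toFinset_replicate, if_neg (by omega), Finset.prod_singleton,
      Multiset.count_replicate_self]

end PTree

namespace PTree
open Polynomial

/-- The number of elements of `{0, …, n-1}` moved by `f`. -/
def moved (n : ℕ) (f : ℕ → ℕ) : ℕ := ∑ i ∈ Finset.range n, if f i = i then 0 else 1

/-- `f` is an involution on `{0, …, n-1}`. -/
def IsInvOn (n : ℕ) (f : ℕ → ℕ) : Prop := ∀ i < n, f (f i) = i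

/-- The generating polynomial of the automorphisms of `T` by number of moved leaves. -/
noncomputable def autPoly (T : PTree) : ℕ[X] :=
  ((isoFuns T T).map fun f => (X : ℕ[X]) ^ moved T.size f).sum

/-- The generating polynomial of the involutive automorphisms of `T` by number of moved leaves. -/
noncomputable def invPoly (T : PTree) : ℕ[X] :=
  ((isoFuns T T).map fun f => if IsInvOn T.size f then (X : ℕ[X]) ^ moved T.size f else 0).sum

theorem moved_joinMap (a b : ℕ) (g h : ℕ → ℕ) :
    moved (a + b) (joinMap a a g h) = moved a g + moved b h := by
  rw [moved, Finset.sum_range_add, moved, moved]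
  congr 1
  · refine Finset.sum_congr rfl fun i hi => ?_
    rw [joinMap_lt _ _ (Finset.mem_range.mp hi)]
  · refine Finset.sum_congr rfl fun i _ => ?_
    rw [joinMap_ge _ _ (by omega), Nat.add_sub_cancel_left]
    exact if_congr (by omega) rfl rfl

theorem moved_swapMap {a b : ℕ} {g h : ℕ → ℕ} (hh : ∀ i < b, h i < a) :
    moved (a + b) (swapMap a a g h) = a + b := by
  rw [moved, Finset.sum_congr rfl (g := fun _ => 1)]
  · simp
  · intro i hi
    have hi := Finset.mem_range.mp hi
    by_cases h1 : i < a
    · rw [swapMap_lt _ _ h1, if_neg (by omega)]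
    · have := hh (i - a) (by omega)
      rw [swapMap_ge _ _ h1, if_neg (by omega)]

theorem isInvOn_joinMap {a b : ℕ} {g h : ℕ → ℕ} (hg : ∀ i < a, g i < a) :
    IsInvOn (a + b) (joinMap a a g h) ↔ IsInvOn a g ∧ IsInvOn b h := by
  constructor
  · intro H
    refine ⟨fun i hi => ?_, fun i hi => ?_⟩
    · have := H i (by omega)
      rwa [joinMap_lt g h hi, joinMap_lt g h (hg i hi)] at this
    · have := H (i + a) (by omega)
      rw [joinMap_ge g h (by omega : ¬ i + a < a), Nat.add_sub_cancel,
        joinMap_ge g h (by omega), Nat.add_sub_cancel] at this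
      omega
  · rintro ⟨h1, h2⟩ i hi
    by_cases hia : i < a
    · rw [joinMap_lt g h hia, joinMap_lt g h (hg i hia), h1 i hia]
    · rw [joinMap_ge g h hia, joinMap_ge g h (by omega), Nat.add_sub_cancel, h2 _ (by omega)]
      omega

theorem sum_map_flatMap_map {α β γ M : Type*} [AddCommMonoid M] (L₁ : List α) (L₂ : List β)
    (J : α → β → γ) (F : γ → M) :
    ((L₁.flatMap fun g => L₂.map fun h => J g h).map F).sum =
      (L₁.map fun g => (L₂.map fun h => F (J g h)).sum).sum := by
  induction L₁ with
  | nil => simp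
  | cons a l ih =>
    rw [List.flatMap_cons, List.map_append, List.sum_append, ih, List.map_map]
    rfl

theorem sum_map_mul_sum_map {α β M : Type*} [Semiring M] (L₁ : List α) (L₂ : List β)
    (F : α → M) (G : β → M) :
    (L₁.map F).sum * (L₂.map G).sum = (L₁.map fun g => (L₂.map fun h => F g * G h).sum).sum := by
  rw [← List.sum_map_mul_right]
  congr 1
  refine List.map_congr_left fun g _ => ?_
  rw [List.sum_map_mul_left]

theorem sum_map_isoFuns_node {M : Type*} [AddCommMonoid M] (l r : PTree) (F : (ℕ → ℕ) → M) :
    ((isoFuns (node l r) (node l r)).map F).sum =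
      ((isoFuns l l).map fun g =>
        ((isoFuns r r).map fun h => F (joinMap l.size l.size g h)).sum).sum +
      ((isoFuns l r).map fun g =>
        ((isoFuns r l).map fun h => F (swapMap l.size l.size g h)).sum).sum := by
  rw [isoFuns_node, List.map_append, List.sum_append, sum_map_flatMap_map, sum_map_flatMap_map]

theorem autPoly_leaf : autPoly leaf = 1 := by
  simp [autPoly, isoFuns_leaf_leaf, moved]

theorem invPoly_leaf : invPoly leaf = 1 := by
  simp [invPoly, isoFuns_leaf_leaf, moved, IsInvOn]

theorem autPoly_node (l r : PTree) : autPoly (node l r) = autPoly l * autPoly r +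
    ((isoFuns l r).length * (isoFuns r l).length : ℕ) • (X : ℕ[X]) ^ (l.size + r.size) := by
  rw [autPoly, sum_map_isoFuns_node]
  congr 1
  · rw [autPoly, autPoly, sum_map_mul_sum_map]
    congr 1
    refine List.map_congr_left fun g _ => ?_
    congr 1
    refine List.map_congr_left fun h _ => ?_
    rw [size, moved_joinMap, pow_add]
  · rw [List.map_congr_left (g := fun _ => (isoFuns r l).length • (X : ℕ[X]) ^ (l.size + r.size)),
      List.map_const', List.sum_replicate, mul_smul]
    intro g hg
    rw [List.map_congr_left (g := fun _ => (X : ℕ[X]) ^ (l.size + r.size)),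
      List.map_const', List.sum_replicate]
    intro h hh
    have e := size_eq_of_mem_isoFuns hh
    rw [size, moved_swapMap]
    intro i hi
    rw [← e]
    exact lt_of_mem_isoFuns hh i hi

theorem invPoly_node (l r : PTree) : ∃ R : ℕ[X], invPoly (node l r) = invPoly l * invPoly r + R := by
  rw [invPoly, sum_map_isoFuns_node]
  refine ⟨_, congrArg (· + _) ?_⟩
  rw [invPoly, invPoly, sum_map_mul_sum_map]
  congr 1
  refine List.map_congr_left fun g hg => ?_
  congr 1
  refine List.map_congr_left fun h _ => ?_
  rw [size, moved_joinMap, if_congr (isInvOn_joinMap (lt_of_mem_isoFuns hg)) rfl rfl, pow_add]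
  by_cases h1 : IsInvOn l.size g <;> by_cases h2 : IsInvOn r.size h <;> simp [h1, h2]

theorem invPoly_cherry : invPoly (node leaf leaf) = 1 + X ^ 2 := by
  have h1 : IsInvOn 2 (joinMap 1 1 (fun i => i) fun i => i) := by
    intro i hi; interval_cases i <;> simp [joinMap]
  have h2 : IsInvOn 2 (swapMap 1 1 (fun i => i) fun i => i) := by
    intro i hi; interval_cases i <;> simp [swapMap]
  have h3 : moved 2 (joinMap 1 1 (fun i => i) fun i => i) = 0 := by
    simp [moved, joinMap, Finset.sum_range_succ]
  have h4 : moved 2 (swapMap 1 1 (fun i => i) fun i => i) = 2 := by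
    simp [moved, swapMap, Finset.sum_range_succ]
  rw [invPoly, sum_map_isoFuns_node]
  simp [isoFuns_leaf_leaf, size, h1, h2, h3, h4]

theorem exists_invPoly_eq (T : PTree) :
    ∃ R : ℕ[X], invPoly T = (1 + X ^ 2) ^ T.cherries + R := by
  induction T with
  | leaf => exact ⟨0, by simp [invPoly_leaf, cherries]⟩
  | node l r hl hr =>
    by_cases h : 3 ≤ l.size + r.size
    · obtain ⟨R₁, h₁⟩ := hl
      obtain ⟨R₂, h₂⟩ := hr
      obtain ⟨R, hR⟩ := invPoly_node l r
      refine ⟨(1 + X ^ 2) ^ l.cherries * R₂ + R₁ * (1 + X ^ 2) ^ r.cherries + R₁ * R₂ + R, ?_⟩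
      rw [hR, h₁, h₂, cherries_node h, pow_add]
      ring
    · have hl' := size_pos l
      have hr' := size_pos r
      cases l with
      | leaf =>
        cases r with
        | leaf => exact ⟨0, by simp [invPoly_cherry, cherries]⟩
        | node a b => have := size_pos a; have := size_pos b; simp only [size] at *; omega
      | node a b => have := size_pos a; have := size_pos b; simp only [size] at *; omega

theorem exists_autPoly_eq (T : PTree) : ∃ R : ℕ[X], autPoly T = invPoly T + R := by
  refine ⟨((isoFuns T T).map fun f =>
    if IsInvOn T.size f then 0 else (X : ℕ[X]) ^ moved T.size f).sum, ?_⟩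
  rw [invPoly, autPoly, ← List.sum_map_add]
  congr 1
  refine List.map_congr_left fun f _ => ?_
  split_ifs <;> simp

theorem length_isoFuns_le (T T' : PTree) : (isoFuns T T').length ≤ 2 ^ (T.size - 1) := by
  by_cases h : T'.size = T.size
  · have := sum_length_isoFuns T T.size
    rw [if_pos rfl] at this
    rw [← this]
    exact Finset.single_le_sum (f := fun T' => (isoFuns T T').length) (fun _ _ => Nat.zero_le _)
      (mem_planeTrees.mpr h)
  · rcases hL : isoFuns T T' with _ | ⟨f, L⟩
    · simp
    · exact absurd (size_eq_of_mem_isoFuns (T := T) (T' := T') (f := f) (by simp [hL])).symm h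

theorem two_mul_cherries_le (T : PTree) : 2 * T.cherries ≤ T.size := by
  induction T with
  | leaf => simp [cherries]
  | node l r hl hr =>
    by_cases h : 3 ≤ l.size + r.size
    · rw [cherries_node h, size]; omega
    · have hl' := size_pos l
      have hr' := size_pos r
      cases l with
      | leaf =>
        cases r with
        | leaf => simp [cherries, size]
        | node a b => have := size_pos a; have := size_pos b; simp only [size] at *; omega
      | node a b => have := size_pos a; have := size_pos b; simp only [size] at *; omega

/-- Evaluation of a polynomial with natural number coefficients at a real number. -/
noncomputable def evalR (y : ℝ) : ℕ[X] →+* ℝ := Polynomial.eval₂RingHom (Nat.castRingHom ℝ) y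

theorem evalR_X (y : ℝ) : evalR y X = y := by simp [evalR]

theorem evalR_nonneg {y : ℝ} (hy : 0 ≤ y) (p : ℕ[X]) : 0 ≤ evalR y p := by
  rw [evalR, coe_eval₂RingHom, eval₂_eq_sum, Polynomial.sum]
  exact Finset.sum_nonneg fun i _ => by simp; positivity

theorem coeff_mul_pow_le_evalR {y : ℝ} (hy : 0 ≤ y) (p : ℕ[X]) (k : ℕ) :
    (p.coeff k : ℝ) * y ^ k ≤ evalR y p := by
  rw [evalR, coe_eval₂RingHom, eval₂_eq_sum, Polynomial.sum]
  by_cases h : k ∈ p.support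
  · exact Finset.single_le_sum (f := fun i => (Nat.castRingHom ℝ) (p.coeff i) * y ^ i)
      (fun i _ => by simp; positivity) h
  · rw [Polynomial.notMem_support_iff.mp h]
    simp
    exact Finset.sum_nonneg fun i _ => by positivity

theorem one_le_evalR_autPoly {y : ℝ} (hy : 0 ≤ y) (T : PTree) : 1 ≤ evalR y (autPoly T) := by
  obtain ⟨R, hR⟩ := exists_autPoly_eq T
  obtain ⟨R', hR'⟩ := exists_invPoly_eq T
  rw [hR, hR', map_add, map_add, map_pow, map_add, map_pow, map_one, evalR_X]
  have h1 := evalR_nonneg hy R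
  have h2 := evalR_nonneg hy R'
  have h3 : (1:ℝ) ≤ (1 + y ^ 2) ^ T.cherries := one_le_pow₀ (by nlinarith [sq_nonneg y])
  linarith

theorem evalR_autPoly_le {y : ℝ} (hy : 0 ≤ y) (hy' : y ≤ 1 / 2) (T : PTree) :
    evalR y (autPoly T) ≤ (1 + y ^ 2) ^ T.cherries * Real.exp (4 * (T.size - 1) * y ^ 4) := by
  induction T with
  | leaf => simp [autPoly_leaf, cherries, size]
  | node l r hl hr =>
    have hl' := size_pos l
    have hr' := size_pos r
    rw [autPoly_node, map_add, map_mul, map_nsmul, map_pow, evalR_X]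
    by_cases h : 3 ≤ l.size + r.size
    · rw [cherries_node h, pow_add (1 + y ^ 2), size]
      have key : ((isoFuns l r).length * (isoFuns r l).length) • y ^ (l.size + r.size) ≤
          4 * y ^ 4 := by
        rcases hL : isoFuns l r with _ | ⟨f, L⟩
        · simp; positivity
        have e := size_eq_of_mem_isoFuns (T := l) (T' := r) (f := f) (by simp [hL])
        rw [← hL]
        have h1 := length_isoFuns_le l r
        have h2 := length_isoFuns_le r l
        rw [← e] at h2 ⊢
        obtain ⟨m, hm⟩ : ∃ m, l.size = m + 2 := ⟨l.size - 2, by omega⟩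
        rw [hm] at h1 h2 ⊢
        have h3 : (((isoFuns l r).length * (isoFuns r l).length : ℕ) : ℝ) ≤
            4 * 2 ^ (2 * m) := by
          have := Nat.mul_le_mul h1 h2
          have h4 : 2 ^ (m + 2 - 1) * 2 ^ (m + 2 - 1) = 4 * 2 ^ (2 * m) := by
            rw [show m + 2 - 1 = m + 1 by omega, ← pow_add,
              show m + 1 + (m + 1) = 2 * m + 2 by ring, pow_add]; ring
          rw [h4] at this
          exact_mod_cast this
        rw [nsmul_eq_mul]
        calc _ ≤ 4 * 2 ^ (2 * m) * y ^ (m + 2 + (m + 2)) := by gcongr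
          _ = 4 * (2 * y) ^ (2 * m) * y ^ 4 := by
            rw [show m + 2 + (m + 2) = 2 * m + 4 by ring, pow_add, mul_pow]; ring
          _ ≤ 4 * 1 * y ^ 4 := by
            gcongr
            exact pow_le_one₀ (by positivity) (by linarith)
          _ = _ := by ring
      have h5 := one_le_evalR_autPoly hy l
      have h6 := one_le_evalR_autPoly hy r
      have h7 : 1 ≤ evalR y (autPoly l) * evalR y (autPoly r) := one_le_mul_of_one_le_of_one_le h5 h6
      calc _ ≤ evalR y (autPoly l) * evalR y (autPoly r) + 4 * y ^ 4 := by gcongr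
        _ ≤ evalR y (autPoly l) * evalR y (autPoly r) * (4 * y ^ 4 + 1) := by
          nlinarith [show 0 ≤ 4 * y ^ 4 by positivity]
        _ ≤ ((1 + y ^ 2) ^ l.cherries * Real.exp (4 * (l.size - 1) * y ^ 4)) *
            ((1 + y ^ 2) ^ r.cherries * Real.exp (4 * (r.size - 1) * y ^ 4)) *
            Real.exp (4 * y ^ 4) := by
          gcongr
          exact Real.add_one_le_exp _
        _ = _ := by
          rw [show (4 * (((l.size + r.size : ℕ) : ℝ) - 1) * y ^ 4) = 4 * (l.size - 1) * y ^ 4 +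
            4 * (r.size - 1) * y ^ 4 + 4 * y ^ 4 by push_cast; ring, Real.exp_add, Real.exp_add]
          ring
    · cases l with
      | leaf =>
        cases r with
        | leaf =>
          simp only [autPoly_leaf, isoFuns_leaf_leaf, map_one, cherries, size]
          have : 1 ≤ Real.exp (4 * (((1 + 1 : ℕ) : ℝ) - 1) * y ^ 4) := by
            rw [Real.one_le_exp_iff]; push_cast; norm_num; positivity
          simp only [List.length_singleton, mul_one, one_smul, pow_one]
          refine le_trans (le_of_eq ?_) (le_mul_of_one_le_right (by positivity) this)
          simp
        | node a b => have := size_pos a; have := size_pos b; simp only [size] at *; omega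
      | node a b => have := size_pos a; have := size_pos b; simp only [size] at *; omega

end PTree

namespace PTree
open Polynomial
open Equiv (Perm)
open scoped Nat

/-- The automorphisms of `T` moving exactly `k` leaves. -/
noncomputable def autMoving (n k : ℕ) (T : PTree) : Finset (Perm (Fin n)) :=
  (isoPerms n T T).filter fun u => u.support.card = k

/-- The involutive automorphisms of `T` moving exactly `k` leaves. -/
noncomputable def invMoving (n k : ℕ) (T : PTree) : Finset (Perm (Fin n)) :=
  (autMoving n k T).filter fun u => u ^ 2 = 1

theorem card_support_toPerm {n : ℕ} {T : PTree} (hT : T.size = n) {f : ℕ → ℕ}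
    (hf : f ∈ isoFuns T T) : (toPerm n f).support.card = moved n f := by
  have e : (toPerm n f).support.card = ∑ i : Fin n, if f i = i then 0 else 1 := by
    rw [Equiv.Perm.support, Finset.card_filter]
    refine Finset.sum_congr rfl fun i _ => ?_
    rw [← toPerm_apply hT hf i]
    simp only [ne_eq, ite_not, Fin.ext_iff]
  rw [e, moved, Fin.sum_univ_eq_sum_range (fun i => if f i = i then 0 else 1)]

theorem toPerm_sq_eq_one_iff {n : ℕ} {T : PTree} (hT : T.size = n) {f : ℕ → ℕ}
    (hf : f ∈ isoFuns T T) : toPerm n f ^ 2 = 1 ↔ IsInvOn n f := by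
  rw [pow_two, Equiv.ext_iff]
  constructor
  · intro h i hi
    have := congrArg Fin.val (h ⟨i, hi⟩)
    rwa [Perm.mul_apply, toPerm_apply hT hf, toPerm_apply hT hf] at this
  · intro h i
    refine Fin.ext ?_
    rw [Perm.mul_apply, toPerm_apply hT hf, toPerm_apply hT hf]
    exact h i i.2

theorem card_autMoving {n : ℕ} (k : ℕ) {T : PTree} (hT : T.size = n) :
    (autMoving n k T).card = (autPoly T).coeff k := by
  rw [autMoving, Finset.card_filter, sum_isoPerms hT, autPoly, ← Polynomial.lcoeff_apply,
    map_list_sum, List.map_map]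
  congr 1
  refine List.map_congr_left fun f hf => ?_
  rw [Function.comp_apply, Polynomial.lcoeff_apply, Polynomial.coeff_X_pow,
    card_support_toPerm hT hf, hT]
  exact if_congr eq_comm rfl rfl

theorem card_invMoving {n : ℕ} (k : ℕ) {T : PTree} (hT : T.size = n) :
    (invMoving n k T).card = (invPoly T).coeff k := by
  rw [invMoving, autMoving, Finset.filter_filter, Finset.card_filter, sum_isoPerms hT, invPoly,
    ← Polynomial.lcoeff_apply, map_list_sum, List.map_map]
  congr 1
  refine List.map_congr_left fun f hf => ?_
  rw [Function.comp_apply, Polynomial.lcoeff_apply, card_support_toPerm hT hf, hT]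
  simp only [toPerm_sq_eq_one_iff hT hf]
  by_cases h : IsInvOn n f
  · simp [h, Polynomial.coeff_X_pow, eq_comm]
  · simp [h]

/-- The contribution to `autWeight` of the automorphisms moving exactly `k` leaves. -/
noncomputable def autWeightAt (n k : ℕ) (T S : PTree) : ℕ :=
  ∑ u ∈ autMoving n k T, ∑ w ∈ autMoving n k S,
    (Finset.univ.filter fun v : Perm (Fin n) => v * u = w * v).card

theorem autWeight_eq_sum (n : ℕ) (T S : PTree) :
    autWeight n T S = ∑ k ∈ Finset.range (n + 1), autWeightAt n k T S := by
  rw [autWeight, ← Finset.sum_fiberwise_of_maps_to (t := Finset.range (n + 1))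
    (g := fun u : Perm (Fin n) => u.support.card)]
  · refine Finset.sum_congr rfl fun k _ => ?_
    rw [autWeightAt, autMoving]
    refine Finset.sum_congr rfl fun u hu => ?_
    rw [autMoving, Finset.sum_filter]
    refine Finset.sum_congr rfl fun w _ => ?_
    split_ifs with h
    · rfl
    · rw [Finset.card_eq_zero, Finset.filter_eq_empty_iff]
      intro v _ hv
      exact h ((card_support_eq_of_intertwiner hv).symm.trans (Finset.mem_filter.mp hu).2)
  · intro u _
    rw [Finset.mem_range, Nat.lt_succ_iff]
    exact (Finset.card_le_univ _).trans (by simp)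

theorem autWeightAt_eq_zero {n k : ℕ} (h : n < k) (T S : PTree) : autWeightAt n k T S = 0 := by
  rw [autWeightAt, Finset.sum_eq_zero]
  intro u hu
  have h1 := (Finset.mem_filter.mp hu).2
  have h2 := Finset.card_le_univ u.support
  rw [Fintype.card_fin] at h2
  omega

theorem factorial_le_autWeightAt_zero {n : ℕ} {T S : PTree} (hT : T.size = n) (hS : S.size = n) :
    n ! ≤ autWeightAt n 0 T S := by
  rw [autWeightAt]
  have h1 : (1 : Perm (Fin n)) ∈ autMoving n 0 T :=
    Finset.mem_filter.mpr ⟨one_mem_isoPerms hT, by simp⟩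
  have h2 : (1 : Perm (Fin n)) ∈ autMoving n 0 S :=
    Finset.mem_filter.mpr ⟨one_mem_isoPerms hS, by simp⟩
  refine le_trans ?_ (Finset.single_le_sum (f := fun u => ∑ w ∈ autMoving n 0 S,
    (Finset.univ.filter fun v : Perm (Fin n) => v * u = w * v).card)
    (fun _ _ => Nat.zero_le _) h1)
  refine le_trans ?_ (Finset.single_le_sum (f := fun w =>
    (Finset.univ.filter fun v : Perm (Fin n) => v * 1 = w * v).card)
    (fun _ _ => Nat.zero_le _) h2)
  simp [Fintype.card_perm]

/-- Upper bound for the number of matchings fixed by a pair of permutations moving `k` leaves. -/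
def fixBound (n k : ℕ) : ℕ := (n - k)! * k ^ (k / 2)

/-- The number of matchings fixed by a pair of involutions moving `k` leaves. -/
def fixInv (n k : ℕ) : ℕ := (n - k)! * (2 ^ (k / 2) * (k / 2)!)

theorem fixInv_le (n k : ℕ) : fixInv n k ≤ fixBound n k := by
  rw [fixInv, fixBound]
  gcongr
  calc 2 ^ (k / 2) * (k / 2)! ≤ 2 ^ (k / 2) * (k / 2) ^ (k / 2) := by
        gcongr; exact Nat.factorial_le_pow _
    _ = (2 * (k / 2)) ^ (k / 2) := by rw [mul_pow]
    _ ≤ k ^ (k / 2) := by gcongr; omega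

theorem autWeightAt_le (n k : ℕ) (T S : PTree) :
    autWeightAt n k T S ≤ (autMoving n k T).card * (autMoving n k S).card * fixBound n k := by
  rw [autWeightAt, mul_assoc]
  refine Finset.sum_le_card_nsmul _ _ _ fun u hu => ?_
  refine Finset.sum_le_card_nsmul _ _ _ fun w _ => ?_
  have := card_intertwiners_le u w
  rwa [(Finset.mem_filter.mp hu).2] at this

theorem le_autWeightAt (n k : ℕ) (T S : PTree) :
    (invMoving n k T).card * (invMoving n k S).card * fixInv n k ≤ autWeightAt n k T S := by
  calc _ = ∑ u ∈ invMoving n k T, ∑ w ∈ invMoving n k S,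
      (Finset.univ.filter fun v : Perm (Fin n) => v * u = w * v).card := by
        rw [mul_assoc, ← smul_eq_mul, ← Finset.sum_const]
        refine Finset.sum_congr rfl fun u hu => ?_
        rw [← smul_eq_mul, ← Finset.sum_const]
        refine Finset.sum_congr rfl fun w hw => ?_
        obtain ⟨hu1, hu2⟩ := Finset.mem_filter.mp hu
        obtain ⟨hw1, hw2⟩ := Finset.mem_filter.mp hw
        have hu3 := (Finset.mem_filter.mp hu1).2
        have hw3 := (Finset.mem_filter.mp hw1).2
        rw [card_intertwiners_involution hu2 hw2 (hu3.trans hw3.symm), hu3, fixInv]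
    _ ≤ ∑ u ∈ invMoving n k T, ∑ w ∈ autMoving n k S,
      (Finset.univ.filter fun v : Perm (Fin n) => v * u = w * v).card := by
        refine Finset.sum_le_sum fun u _ => ?_
        exact Finset.sum_le_sum_of_subset (Finset.filter_subset _ _)
    _ ≤ _ := Finset.sum_le_sum_of_subset (Finset.filter_subset _ _)

theorem sum_sum_le_add {α β : Type*} {A A' : Finset α} {B B' : Finset β} (hA : A' ⊆ A)
    (hB : B' ⊆ B) (N : α → β → ℕ) (κ D : ℕ) (h1 : ∀ u ∈ A', ∀ w ∈ B', N u w ≤ κ)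
    (h2 : ∀ u ∈ A, ∀ w ∈ B, N u w ≤ D) :
    ∑ u ∈ A, ∑ w ∈ B, N u w + A'.card * B'.card * D ≤ A.card * B.card * D + A'.card * B'.card * κ := by
  rw [← Finset.sum_product', ← Finset.card_product, ← Finset.card_product]
  have hsub : A' ×ˢ B' ⊆ A ×ˢ B := Finset.product_subset_product hA hB
  rw [← Finset.sum_sdiff hsub, ← Finset.card_sdiff_add_card_eq_card hsub]
  have e1 : ∑ x ∈ (A ×ˢ B) \ (A' ×ˢ B'), N x.1 x.2 ≤ ((A ×ˢ B) \ (A' ×ˢ B')).card * D := by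
    refine Finset.sum_le_card_nsmul _ _ _ fun x hx => ?_
    have := Finset.mem_product.mp (Finset.mem_sdiff.mp hx).1
    exact h2 _ this.1 _ this.2
  have e2 : ∑ x ∈ A' ×ˢ B', N x.1 x.2 ≤ (A' ×ˢ B').card * κ := by
    refine Finset.sum_le_card_nsmul _ _ _ fun x hx => ?_
    have := Finset.mem_product.mp hx
    exact h1 _ this.1 _ this.2
  nlinarith

theorem autWeightAt_add_le (n k : ℕ) (T S : PTree) :
    autWeightAt n k T S + (invMoving n k T).card * (invMoving n k S).card * fixBound n k ≤
      (autMoving n k T).card * (autMoving n k S).card * fixBound n k +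
        (invMoving n k T).card * (invMoving n k S).card * fixInv n k := by
  refine sum_sum_le_add (Finset.filter_subset _ _) (Finset.filter_subset _ _) _ _ _ ?_ ?_
  · intro u hu w hw
    obtain ⟨hu1, hu2⟩ := Finset.mem_filter.mp hu
    obtain ⟨hw1, hw2⟩ := Finset.mem_filter.mp hw
    have hu3 := (Finset.mem_filter.mp hu1).2
    have hw3 := (Finset.mem_filter.mp hw1).2
    rw [card_intertwiners_involution hu2 hw2 (hu3.trans hw3.symm), hu3, fixInv]
  · intro u hu w _
    have := card_intertwiners_le u w
    rwa [(Finset.mem_filter.mp hu).2] at this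

/-- The number of automorphisms moving `k` leaves that permute the leaves of `c` cherries. -/
noncomputable def cherryCoeff (c k : ℕ) : ℕ := ((1 + X ^ 2 : ℕ[X]) ^ c).coeff k

theorem cherryCoeff_eq (c k : ℕ) : cherryCoeff c k = if 2 ∣ k then c.choose (k / 2) else 0 := by
  have e : (1 + X ^ 2 : ℕ[X]) ^ c = expand ℕ 2 ((1 + X) ^ c) := by simp
  rw [cherryCoeff, e, coeff_expand (by norm_num)]
  simp [coeff_one_add_X_pow]

theorem abs_autWeightAt_sub_le {n : ℕ} (k : ℕ) {T S : PTree} (hT : T.size = n) (hS : S.size = n) :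
    |(autWeightAt n k T S : ℝ) - cherryCoeff T.cherries k * cherryCoeff S.cherries k * fixInv n k| ≤
      ((autPoly T).coeff k * (autPoly S).coeff k -
        cherryCoeff T.cherries k * cherryCoeff S.cherries k : ℝ) * fixBound n k := by
  have h1 := le_autWeightAt n k T S
  have h2 := autWeightAt_add_le n k T S
  have h3 := fixInv_le n k
  obtain ⟨R, hR⟩ := exists_invPoly_eq T
  obtain ⟨R', hR'⟩ := exists_invPoly_eq S
  rw [card_invMoving k hT, card_invMoving k hS] at h1 h2
  rw [card_autMoving k hT, card_autMoving k hS] at h2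
  have h4 : cherryCoeff T.cherries k * cherryCoeff S.cherries k ≤
      (invPoly T).coeff k * (invPoly S).coeff k := by
    rw [hR, hR', coeff_add, coeff_add, cherryCoeff, cherryCoeff]
    gcongr <;> exact Nat.le_add_right _ _
  have h5 : (invPoly T).coeff k * (invPoly S).coeff k ≤
      (autPoly T).coeff k * (autPoly S).coeff k := by
    obtain ⟨Q, hQ⟩ := exists_autPoly_eq T
    obtain ⟨Q', hQ'⟩ := exists_autPoly_eq S
    rw [hQ, hQ', coeff_add, coeff_add]
    gcongr <;> exact Nat.le_add_right _ _
  have h1 : (((invPoly T).coeff k : ℝ) * (invPoly S).coeff k) * fixInv n k ≤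
      autWeightAt n k T S := by exact_mod_cast h1
  have h2 : (autWeightAt n k T S : ℝ) +
      ((invPoly T).coeff k * (invPoly S).coeff k) * fixBound n k ≤
      ((autPoly T).coeff k * (autPoly S).coeff k) * fixBound n k +
      ((invPoly T).coeff k * (invPoly S).coeff k) * fixInv n k := by exact_mod_cast h2
  have h3 : (fixInv n k : ℝ) ≤ fixBound n k := by exact_mod_cast h3
  have h4 : (cherryCoeff T.cherries k : ℝ) * cherryCoeff S.cherries k ≤
      (invPoly T).coeff k * (invPoly S).coeff k := by exact_mod_cast h4
  have h5 : ((invPoly T).coeff k : ℝ) * (invPoly S).coeff k ≤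
      (autPoly T).coeff k * (autPoly S).coeff k := by exact_mod_cast h5
  have h0 : (0 : ℝ) ≤ fixInv n k := Nat.cast_nonneg _
  have h6 := mul_le_mul_of_nonneg_right h4 h0
  have h7 := mul_le_mul_of_nonneg_right h5 (h0.trans h3)
  have h8 := mul_le_mul_of_nonneg_right h4 (sub_nonneg.mpr h3)
  rw [abs_le]
  constructor <;> nlinarith

end PTree

namespace PTree
open Polynomial
open scoped Nat

theorem factorial_mul_pow_le {n k : ℕ} (hk : k ≤ n) :
    k ! * n ^ k ≤ n.descFactorial k * k ^ k := by
  rw [← Nat.descFactorial_self k, Nat.descFactorial_eq_prod_range, Nat.descFactorial_eq_prod_range]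
  have h : ∀ m : ℕ, m ^ k = ∏ _i ∈ Finset.range k, m := fun m => by simp
  rw [h n, h k, ← Finset.prod_mul_distrib, ← Finset.prod_mul_distrib]
  refine Finset.prod_le_prod' fun i hi => ?_
  have hi := Finset.mem_range.mp hi
  obtain ⟨a, rfl⟩ := Nat.exists_eq_add_of_le hi.le
  obtain ⟨b, rfl⟩ := Nat.exists_eq_add_of_le hk
  rw [Nat.add_sub_cancel_left, show i + a + b - i = a + b by omega]
  nlinarith [Nat.zero_le (b * i)]

theorem pow_mul_factorial_sub_le {n k : ℕ} (hk : k ≤ n) :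
    (n : ℝ) ^ k * (n - k)! ≤ Real.exp k * n ! := by
  have h1 : (k ! : ℝ) * (n : ℝ) ^ k ≤ n.descFactorial k * (k : ℝ) ^ k := by
    exact_mod_cast factorial_mul_pow_le hk
  have h2 : (k : ℝ) ^ k ≤ Real.exp k * k ! := by
    have := Real.pow_div_factorial_le_exp (x := (k : ℝ)) (Nat.cast_nonneg k) k
    rwa [div_le_iff₀ (by positivity)] at this
  have h3 : ((n - k)! : ℝ) * n.descFactorial k = n ! := by
    exact_mod_cast Nat.factorial_mul_descFactorial hk
  have h4 : (0 : ℝ) < k ! := by positivity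
  refine le_of_mul_le_mul_left ?_ h4
  calc (k ! : ℝ) * ((n : ℝ) ^ k * (n - k)!) = k ! * (n : ℝ) ^ k * (n - k)! := by ring
    _ ≤ n.descFactorial k * (k : ℝ) ^ k * (n - k)! := by gcongr
    _ ≤ n.descFactorial k * (Real.exp k * k !) * (n - k)! := by gcongr
    _ = k ! * (Real.exp k * n !) := by rw [← h3]; ring

theorem pow_mul_fixBound_le {n k : ℕ} (hk : k ≤ n) :
    (n : ℝ) ^ k * fixBound n k ≤ Real.exp k * (k : ℝ) ^ (k / 2) * n ! := by
  rw [fixBound, Nat.cast_mul, Nat.cast_pow]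
  have := mul_le_mul_of_nonneg_right (pow_mul_factorial_sub_le hk)
    (show (0 : ℝ) ≤ (k : ℝ) ^ (k / 2) by positivity)
  linarith

/-- The normalized weight at `k`. -/
noncomputable def weightAt (n k : ℕ) (T S : PTree) : ℝ := autWeightAt n k T S / n !

theorem weightAt_nonneg (n k : ℕ) (T S : PTree) : 0 ≤ weightAt n k T S := by
  rw [weightAt]; positivity

/-- A uniform bound for `weightAt n k`. -/
noncomputable def weightBound (k : ℕ) : ℝ := Real.exp (3 * k) * 4 ^ k * (k : ℝ) ^ (k / 2) / (k : ℝ) ^ k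

theorem evalR_autPoly_le_exp {n : ℕ} {T : PTree} (hT : T.size = n) {y : ℝ} (hy : 0 ≤ y)
    (hy' : y ≤ 1 / 2) : evalR y (autPoly T) ≤ Real.exp (n * y ^ 2 / 2 + 4 * n * y ^ 4) := by
  refine (evalR_autPoly_le hy hy' T).trans ?_
  rw [Real.exp_add, hT]
  have hc : (2 * T.cherries : ℝ) ≤ n := by rw [← hT]; exact_mod_cast two_mul_cherries_le T
  gcongr
  · calc (1 + y ^ 2) ^ T.cherries ≤ Real.exp (y ^ 2) ^ T.cherries := by
          gcongr; linarith [Real.add_one_le_exp (y ^ 2)]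
      _ = Real.exp (T.cherries * y ^ 2) := by rw [← Real.exp_nat_mul]
      _ ≤ _ := by
        rw [Real.exp_le_exp]
        nlinarith [mul_le_mul_of_nonneg_right hc (sq_nonneg y)]
  · linarith

theorem weightAt_le {n k : ℕ} {T S : PTree} (hT : T.size = n) (hS : S.size = n) :
    weightAt n k T S ≤ weightBound k := by
  rcases lt_or_ge n k with h | h
  · rw [weightAt, autWeightAt_eq_zero h, Nat.cast_zero, zero_div, weightBound]; positivity
  have hn : (0 : ℝ) < n := by rw [← hT]; exact_mod_cast size_pos T
  have hkn : (k : ℝ) ≤ n := by exact_mod_cast h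
  set y : ℝ := √(k / (4 * n)) with hy
  have hy2 : y ^ 2 = k / (4 * n) := Real.sq_sqrt (by positivity)
  have hy0 : 0 ≤ y := Real.sqrt_nonneg _
  have hyle : y ≤ 1 / 2 := by
    refine Real.sqrt_le_iff.mpr ⟨by norm_num, ?_⟩
    rw [div_le_iff₀ (by positivity)]; linarith
  have hexp : ∀ T : PTree, T.size = n → ((autPoly T).coeff k : ℝ) * y ^ k ≤ Real.exp k := by
    intro T hT
    refine (coeff_mul_pow_le_evalR hy0 _ k).trans ((evalR_autPoly_le_exp hT hy0 hyle).trans ?_)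
    rw [Real.exp_le_exp, show y ^ 4 = (y ^ 2) ^ 2 by ring, hy2]
    have e1 : (n : ℝ) * (k / (4 * n)) / 2 = k / 8 := by field_simp; ring
    have e2 : 4 * (n : ℝ) * (k / (4 * n)) ^ 2 = k * (k / n) / 4 := by field_simp
    have e3 : (k : ℝ) / n ≤ 1 := (div_le_one hn).mpr hkn
    rw [e1, e2]
    have : (k : ℝ) * (k / n) ≤ k * 1 := by gcongr
    have : (0 : ℝ) ≤ k := Nat.cast_nonneg k
    linarith
  have hprod : ((autPoly T).coeff k : ℝ) * (autPoly S).coeff k * (k : ℝ) ^ k ≤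
      Real.exp (2 * k) * 4 ^ k * (n : ℝ) ^ k := by
    have := mul_le_mul (hexp T hT) (hexp S hS) (by positivity) (by positivity)
    have e : ((autPoly T).coeff k : ℝ) * y ^ k * ((autPoly S).coeff k * y ^ k) =
        (autPoly T).coeff k * (autPoly S).coeff k * (k : ℝ) ^ k / (4 ^ k * (n : ℝ) ^ k) := by
      rw [show ((autPoly T).coeff k : ℝ) * y ^ k * ((autPoly S).coeff k * y ^ k) =
        (autPoly T).coeff k * (autPoly S).coeff k * (y ^ 2) ^ k by ring, hy2, div_pow, mul_pow]
      ring
    rw [e, div_le_iff₀ (by positivity), ← Real.exp_add] at this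
    calc _ ≤ _ := this
      _ = _ := by rw [← two_mul]; ring
  have hle : (autWeightAt n k T S : ℝ) ≤
      (autPoly T).coeff k * (autPoly S).coeff k * fixBound n k := by
    have := autWeightAt_le n k T S
    rw [card_autMoving k hT, card_autMoving k hS] at this
    exact_mod_cast this
  have hkk : (0 : ℝ) < (k : ℝ) ^ k := by
    rcases Nat.eq_zero_or_pos k with rfl | hk
    · simp
    · positivity
  rw [weightAt, weightBound, div_le_div_iff₀ (by positivity) hkk]
  calc (autWeightAt n k T S : ℝ) * (k : ℝ) ^ k ≤
      (autPoly T).coeff k * (autPoly S).coeff k * fixBound n k * (k : ℝ) ^ k := by gcongr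
    _ = (autPoly T).coeff k * (autPoly S).coeff k * (k : ℝ) ^ k * fixBound n k := by ring
    _ ≤ Real.exp (2 * k) * 4 ^ k * (n : ℝ) ^ k * fixBound n k := by gcongr
    _ = Real.exp (2 * k) * 4 ^ k * ((n : ℝ) ^ k * fixBound n k) := by ring
    _ ≤ Real.exp (2 * k) * 4 ^ k * (Real.exp k * (k : ℝ) ^ (k / 2) * n !) := by
      exact mul_le_mul_of_nonneg_left (pow_mul_fixBound_le h) (by positivity)
    _ = _ := by rw [show (3 * k : ℝ) = 2 * k + k by ring, Real.exp_add]; ring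

theorem weightBound_nonneg (k : ℕ) : 0 ≤ weightBound k := by
  rw [weightBound]; positivity

theorem summable_weightBound : Summable weightBound := by
  refine Summable.of_norm_bounded_eventually_nat (g := fun k => (1 / 2 : ℝ) ^ k)
    (summable_geometric_of_lt_one (by norm_num) (by norm_num)) ?_
  set M : ℝ := 8 * Real.exp 3 with hM
  have hM1 : 1 ≤ M := by
    have := Real.add_one_le_exp 3
    rw [hM]; linarith
  filter_upwards [Filter.eventually_ge_atTop (⌈M ^ 2⌉₊)] with k hk
  have hk' : M ^ 2 ≤ (k : ℝ) := (Nat.le_ceil _).trans (by exact_mod_cast hk)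
  have hk0 : (0 : ℝ) < k := lt_of_lt_of_le (by positivity) hk'
  rw [Real.norm_of_nonneg (weightBound_nonneg k), weightBound]
  have e : (k : ℝ) ^ k = (k : ℝ) ^ (k / 2) * (k : ℝ) ^ (k - k / 2) := by
    rw [← pow_add]; congr 1; omega
  rw [e, mul_comm _ ((k : ℝ) ^ (k / 2)), mul_div_mul_left _ _ (by positivity),
    div_le_iff₀ (by positivity)]
  have h1 : M ^ k ≤ (k : ℝ) ^ (k - k / 2) := by
    calc M ^ k ≤ M ^ (2 * (k - k / 2)) := pow_le_pow_right₀ hM1 (by omega)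
      _ = (M ^ 2) ^ (k - k / 2) := by rw [pow_mul]
      _ ≤ _ := by gcongr
  calc Real.exp (3 * k) * 4 ^ k = (1 / 2) ^ k * M ^ k := by
        rw [hM, mul_comm (3 : ℝ), Real.exp_nat_mul, ← mul_pow, ← mul_pow]; congr 1; ring
    _ ≤ _ := by gcongr

end PTree

namespace PTree
open Polynomial
open scoped Nat

theorem evalR_one_add_X_sq_pow (y : ℝ) (c : ℕ) :
    evalR y ((1 + X ^ 2) ^ c) = (1 + y ^ 2) ^ c := by
  rw [map_pow, map_add, map_pow, map_one, evalR_X]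

theorem choose_add_mul_le (n c₀ d s : ℕ) (h : c₀ + d ≤ n) :
    (c₀ + d).choose s * n ≤ c₀.choose s * n + d * n ^ s := by
  induction d with
  | zero => simp
  | succ d ih =>
    rcases s with _ | s
    · simp
    · have h1 : (c₀ + d).choose s ≤ n ^ s :=
        (Nat.choose_le_pow _ _).trans (Nat.pow_le_pow_left (by omega) s)
      rw [← Nat.add_assoc, Nat.choose_succ_succ, add_mul]
      have h2 := ih (by omega)
      have h3 := Nat.mul_le_mul_right n h1
      rw [← pow_succ] at h3
      rw [Nat.succ_mul]
      linarith

theorem abs_choose_sub_le {n c c₀ : ℕ} (s : ℕ) (hn : 0 < n) (hc : c ≤ n) (hc₀ : c₀ ≤ n) :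
    |(c.choose s : ℝ) - c₀.choose s| ≤ (n : ℝ) ^ s * (|(c : ℝ) - c₀| / n) := by
  wlog h : c₀ ≤ c generalizing c c₀
  · rw [abs_sub_comm, abs_sub_comm (c : ℝ)]
    exact this hc₀ hc (by omega)
  obtain ⟨d, rfl⟩ := Nat.exists_eq_add_of_le h
  have h1 := choose_add_mul_le n c₀ d s hc
  have h2 : (c₀.choose s : ℝ) ≤ (c₀ + d).choose s := by
    exact_mod_cast Nat.choose_le_choose s h
  have h3 : ((c₀ + d).choose s : ℝ) * n ≤ c₀.choose s * n + d * (n : ℝ) ^ s := by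
    exact_mod_cast h1
  have hn' : (0 : ℝ) < n := by exact_mod_cast hn
  rw [abs_of_nonneg (by linarith), Nat.cast_add, add_sub_cancel_left, abs_of_nonneg (by positivity),
    mul_div_assoc', le_div_iff₀ hn']
  linarith

theorem abs_cherryCoeff_sub_le {n c c₀ : ℕ} (k : ℕ) (hn : 0 < n) (hc : c ≤ n) (hc₀ : c₀ ≤ n) :
    |(cherryCoeff c k : ℝ) - cherryCoeff c₀ k| ≤ (n : ℝ) ^ (k / 2) * (|(c : ℝ) - c₀| / n) := by
  rw [cherryCoeff_eq, cherryCoeff_eq]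
  split_ifs
  · exact abs_choose_sub_le _ hn hc hc₀
  · simp; positivity

theorem cherryCoeff_le {n c : ℕ} (k : ℕ) (hc : c ≤ n) : cherryCoeff c k ≤ n ^ (k / 2) := by
  rw [cherryCoeff_eq]
  split_ifs
  · exact (Nat.choose_le_pow _ _).trans (Nat.pow_le_pow_left hc _)
  · exact Nat.zero_le _

theorem abs_cherryCoeff_mul_sub_le {n c c' c₀ : ℕ} (k : ℕ) (hn : 0 < n) (hc : c ≤ n) (hc' : c' ≤ n)
    (hc₀ : c₀ ≤ n) :
    |(cherryCoeff c k : ℝ) * cherryCoeff c' k - cherryCoeff c₀ k * cherryCoeff c₀ k| ≤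
      (n : ℝ) ^ k * ((|(c : ℝ) - c₀| + |(c' : ℝ) - c₀|) / n) := by
  have h1 := abs_cherryCoeff_sub_le k hn hc hc₀
  have h2 := abs_cherryCoeff_sub_le k hn hc' hc₀
  have h3 : (cherryCoeff c' k : ℝ) ≤ (n : ℝ) ^ (k / 2) := by exact_mod_cast cherryCoeff_le k hc'
  have h4 : (cherryCoeff c₀ k : ℝ) ≤ (n : ℝ) ^ (k / 2) := by exact_mod_cast cherryCoeff_le k hc₀
  have hn' : (1 : ℝ) ≤ n := by exact_mod_cast hn
  have h5 : (n : ℝ) ^ (k / 2) * (n : ℝ) ^ (k / 2) ≤ (n : ℝ) ^ k := by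
    rw [← pow_add]; exact pow_le_pow_right₀ hn' (by omega)
  calc _ = |((cherryCoeff c k : ℝ) - cherryCoeff c₀ k) * cherryCoeff c' k +
        cherryCoeff c₀ k * (cherryCoeff c' k - cherryCoeff c₀ k)| := by congr 1; ring
    _ ≤ |(cherryCoeff c k : ℝ) - cherryCoeff c₀ k| * cherryCoeff c' k +
        cherryCoeff c₀ k * |(cherryCoeff c' k : ℝ) - cherryCoeff c₀ k| := by
      refine (abs_add_le _ _).trans (le_of_eq ?_)
      rw [abs_mul, abs_mul, Nat.abs_cast, Nat.abs_cast]
    _ ≤ (n : ℝ) ^ (k / 2) * (|(c : ℝ) - c₀| / n) * (n : ℝ) ^ (k / 2) +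
        (n : ℝ) ^ (k / 2) * ((n : ℝ) ^ (k / 2) * (|(c' : ℝ) - c₀| / n)) := by gcongr
    _ = ((n : ℝ) ^ (k / 2) * (n : ℝ) ^ (k / 2)) * ((|(c : ℝ) - c₀| + |(c' : ℝ) - c₀|) / n) := by ring
    _ ≤ _ := by gcongr

theorem coeff_autPoly_estimates {n k : ℕ} (hn : 4 ≤ n) {T : PTree} (hT : T.size = n) :
    (cherryCoeff T.cherries k : ℝ) ≤ (autPoly T).coeff k ∧
    (autPoly T).coeff k * (1 / √n) ^ k ≤ 6 ∧
    cherryCoeff T.cherries k * (1 / √n) ^ k ≤ 2 ∧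
    ((autPoly T).coeff k - cherryCoeff T.cherries k : ℝ) * (1 / √n) ^ k ≤
      2 * (Real.exp (4 / n) - 1) := by
  have hn4 : (4 : ℝ) ≤ n := by exact_mod_cast hn
  set y : ℝ := 1 / √n with hy
  have hs : (2 : ℝ) ≤ √n := Real.le_sqrt_of_sq_le (by linarith)
  have hy0 : 0 ≤ y := by positivity
  have hyle : y ≤ 1 / 2 := one_div_le_one_div_of_le (by norm_num) hs
  have hy2 : y ^ 2 = 1 / n := by rw [hy, div_pow, Real.sq_sqrt (by linarith), one_pow]
  obtain ⟨R, hR⟩ := exists_invPoly_eq T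
  obtain ⟨R', hR'⟩ := exists_autPoly_eq T
  have hA : autPoly T = (1 + X ^ 2) ^ T.cherries + (R + R') := by rw [hR', hR, add_assoc]
  have hco : ((autPoly T).coeff k : ℝ) = cherryCoeff T.cherries k + (R + R').coeff k := by
    rw [hA, coeff_add, Nat.cast_add, cherryCoeff]
  have hev : evalR y (autPoly T) = (1 + y ^ 2) ^ T.cherries + evalR y (R + R') := by
    rw [hA, map_add, evalR_one_add_X_sq_pow]
  have hE : evalR y (autPoly T) ≤ (1 + y ^ 2) ^ T.cherries * Real.exp (4 / n) := by
    refine (evalR_autPoly_le hy0 hyle T).trans ?_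
    gcongr
    rw [hT, show y ^ 4 = (y ^ 2) ^ 2 by ring, hy2, div_pow, one_pow, mul_one_div,
      div_le_div_iff₀ (by positivity) (by positivity)]
    nlinarith
  have hc : (2 * T.cherries : ℝ) ≤ n := by rw [← hT]; exact_mod_cast two_mul_cherries_le T
  have hB : (1 + y ^ 2) ^ T.cherries ≤ 2 := by
    calc (1 + y ^ 2) ^ T.cherries ≤ Real.exp (y ^ 2) ^ T.cherries := by
          gcongr; linarith [Real.add_one_le_exp (y ^ 2)]
      _ = Real.exp (T.cherries * y ^ 2) := by rw [← Real.exp_nat_mul]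
      _ ≤ Real.exp (1 / 2) := by
        rw [Real.exp_le_exp, hy2, mul_one_div, div_le_div_iff₀ (by positivity) (by norm_num)]
        linarith
      _ ≤ 2 := by
        have h1 : Real.exp (1 / 2) ^ 2 = Real.exp 1 := by rw [← Real.exp_nat_mul]; norm_num
        have h2 := Real.exp_one_lt_d9
        have h3 := Real.exp_pos (1 / 2)
        nlinarith
  have hE1 : 1 ≤ Real.exp (4 / n) := Real.one_le_exp (by positivity)
  have hE3 : Real.exp (4 / n) ≤ 3 := by
    have h2 := Real.exp_one_lt_d9
    have : Real.exp (4 / n) ≤ Real.exp 1 := by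
      rw [Real.exp_le_exp, div_le_one (by linarith)]; exact hn4
    linarith
  have hB0 : 0 ≤ (1 + y ^ 2) ^ T.cherries := by positivity
  refine ⟨?_, ?_, ?_, ?_⟩
  · rw [hco]; exact le_add_of_nonneg_right (Nat.cast_nonneg _)
  · refine (coeff_mul_pow_le_evalR hy0 _ k).trans (hE.trans ?_)
    nlinarith
  · refine (coeff_mul_pow_le_evalR hy0 ((1 + X ^ 2) ^ T.cherries) k).trans ?_
    rw [evalR_one_add_X_sq_pow]; exact hB
  · rw [hco, add_sub_cancel_left]
    refine (coeff_mul_pow_le_evalR hy0 (R + R') k).trans ?_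
    nlinarith

/-- The deterministic approximation of `weightAt n k`. -/
noncomputable def mainTerm (n k : ℕ) : ℝ :=
  cherryCoeff (n / 4) k * cherryCoeff (n / 4) k * fixInv n k / n !

theorem abs_weightAt_sub_mainTerm_le {n k : ℕ} (hn : 4 ≤ n) (hk : k ≤ n) {T S : PTree}
    (hT : T.size = n) (hS : S.size = n) :
    |weightAt n k T S - mainTerm n k| ≤ Real.exp k * (k : ℝ) ^ (k / 2) *
      (16 * (Real.exp (4 / n) - 1) +
        (|(T.cherries : ℝ) - (n / 4 : ℕ)| + |(S.cherries : ℝ) - (n / 4 : ℕ)|) / n) := by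
  have hn0 : (0 : ℝ) < n := by exact_mod_cast (by omega : 0 < n)
  obtain ⟨a1, a2, a3, a4⟩ := coeff_autPoly_estimates (k := k) hn hT
  obtain ⟨b1, b2, b3, b4⟩ := coeff_autPoly_estimates (k := k) hn hS
  have hcT : T.cherries ≤ n := by have := two_mul_cherries_le T; omega
  have hcS : S.cherries ≤ n := by have := two_mul_cherries_le S; omega
  have hB := abs_cherryCoeff_mul_sub_le k (by omega : 0 < n) hcT hcS (by omega : n / 4 ≤ n)
  have hA := abs_autWeightAt_sub_le k hT hS
  set a : ℝ := ((autPoly T).coeff k : ℝ)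
  set a' : ℝ := ((autPoly S).coeff k : ℝ)
  set b : ℝ := (cherryCoeff T.cherries k : ℝ)
  set b' : ℝ := (cherryCoeff S.cherries k : ℝ)
  set Bc : ℝ := (cherryCoeff (n / 4) k : ℝ)
  set δ : ℝ := Real.exp (4 / n) - 1
  set D : ℝ := (fixBound n k : ℝ)
  set κ : ℝ := (fixInv n k : ℝ)
  set ρ : ℝ := (|(T.cherries : ℝ) - (n / 4 : ℕ)| + |(S.cherries : ℝ) - (n / 4 : ℕ)|) / n
  have hκD : κ ≤ D := Nat.cast_le.mpr (fixInv_le n k)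
  have hκ0 : 0 ≤ κ := Nat.cast_nonneg _
  have hD0 : 0 ≤ D := Nat.cast_nonneg _
  have ha' : 0 ≤ a' := Nat.cast_nonneg _
  have hb : 0 ≤ b := Nat.cast_nonneg _
  have hδ : 0 ≤ δ := sub_nonneg.mpr (Real.one_le_exp (by positivity))
  have hρ : 0 ≤ ρ := by positivity
  set z : ℝ := (1 / √n) ^ k with hz
  have hz0 : 0 ≤ z := by positivity
  have hzz : z * z * (n : ℝ) ^ k = 1 := by
    rw [hz, ← mul_pow, ← mul_pow, ← mul_one_div, one_mul, one_div_mul_one_div,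
      Real.mul_self_sqrt hn0.le, one_div_mul_cancel hn0.ne', one_pow]
  have h1 : a * a' - b * b' ≤ 16 * δ * (n : ℝ) ^ k := by
    have e1 : (a - b) * z * (a' * z) ≤ 2 * δ * 6 :=
      mul_le_mul a4 b2 (by positivity) (by positivity)
    have e2 : b * z * ((a' - b') * z) ≤ 2 * (2 * δ) :=
      mul_le_mul a3 b4 (mul_nonneg (sub_nonneg.mpr b1) hz0) (by norm_num)
    calc a * a' - b * b' = ((a - b) * z * (a' * z) + b * z * ((a' - b') * z)) * (n : ℝ) ^ k := by
          have : ((a - b) * z * (a' * z) + b * z * ((a' - b') * z)) * (n : ℝ) ^ k =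
            (a * a' - b * b') * (z * z * (n : ℝ) ^ k) := by ring
          rw [this, hzz, mul_one]
      _ ≤ (2 * δ * 6 + 2 * (2 * δ)) * (n : ℝ) ^ k := by gcongr
      _ = _ := by ring
  have h2 : |(autWeightAt n k T S : ℝ) - Bc * Bc * κ| ≤ (16 * δ + ρ) * ((n : ℝ) ^ k * D) := by
    calc |(autWeightAt n k T S : ℝ) - Bc * Bc * κ| =
        |((autWeightAt n k T S : ℝ) - b * b' * κ) + (b * b' - Bc * Bc) * κ| := by
          congr 1; ring
      _ ≤ |(autWeightAt n k T S : ℝ) - b * b' * κ| + |b * b' - Bc * Bc| * κ := by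
          refine (abs_add_le _ _).trans (le_of_eq ?_)
          rw [abs_mul, abs_of_nonneg hκ0]
      _ ≤ 16 * δ * (n : ℝ) ^ k * D + (n : ℝ) ^ k * ρ * D := by
          refine add_le_add (hA.trans (mul_le_mul_of_nonneg_right h1 hD0)) ?_
          exact mul_le_mul hB hκD hκ0 (by positivity)
      _ = _ := by ring
  rw [weightAt, mainTerm, ← sub_div, abs_div, Nat.abs_cast, div_le_iff₀ (by positivity)]
  calc _ ≤ _ := h2
    _ ≤ (16 * δ + ρ) * (Real.exp k * (k : ℝ) ^ (k / 2) * n !) := by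
      exact mul_le_mul_of_nonneg_left (pow_mul_fixBound_le hk) (by positivity)
    _ = _ := by ring

end PTree

namespace PTree
open scoped Nat

/-- The absolute deviation of the height from its mean. -/
noncomputable def heightDev (n : ℕ) (T : PTree) : ℝ := (height T : ℝ) - mean n fun T => height T

/-- The deviation of the number of cherries from `⌊n/4⌋`. -/
noncomputable def cherryDev (n : ℕ) (T : PTree) : ℝ := |(cherries T : ℝ) - (n / 4 : ℕ)|

theorem sum_mul_le_of_sum_sq_le {ι : Type*} (s : Finset ι) (f g : ι → ℝ) {A B : ℝ} (hA : 0 ≤ A)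
    (hB : 0 ≤ B) (hf : ∑ i ∈ s, f i ^ 2 ≤ A ^ 2) (hg : ∑ i ∈ s, g i ^ 2 ≤ B ^ 2) :
    ∑ i ∈ s, f i * g i ≤ A * B := by
  refine abs_le_of_sq_le_sq' ?_ (mul_nonneg hA hB) |>.2
  refine (Finset.sum_mul_sq_le_sq_mul_sq s f g).trans ?_
  rw [mul_pow]
  exact mul_le_mul hf hg (Finset.sum_nonneg fun i _ => sq_nonneg _) (sq_nonneg _)

theorem sum_heightDev {n : ℕ} (hn : 1 ≤ n) : ∑ T ∈ planeTrees n, heightDev n T = 0 := by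
  have hN : (numTrees n : ℝ) ≠ 0 := by exact_mod_cast (numTrees_pos hn).ne'
  simp only [heightDev, Finset.sum_sub_distrib, Finset.sum_const, nsmul_eq_mul]
  rw [mean, ← numTrees, mul_div_cancel₀ _ hN, sub_self]

theorem sum_heightDev_sq_le {n : ℕ} (hn : 1 ≤ n) :
    ∑ T ∈ planeTrees n, heightDev n T ^ 2 ≤ (16 * √n * √(numTrees n)) ^ 2 := by
  have hN : (0 : ℝ) < numTrees n := by exact_mod_cast numTrees_pos hn
  have h1 := mean_height_sq_le n
  rw [mean, div_le_iff₀ hN] at h1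
  have h2 : ∑ T ∈ planeTrees n, heightDev n T ^ 2 = ∑ T ∈ planeTrees n, (height T : ℝ) ^ 2 -
      (mean n fun T => height T) * ∑ T ∈ planeTrees n, (height T : ℝ) -
      (mean n fun T => height T) * ∑ T ∈ planeTrees n, heightDev n T := by
    rw [Finset.mul_sum, Finset.mul_sum, ← Finset.sum_sub_distrib, ← Finset.sum_sub_distrib]
    refine Finset.sum_congr rfl fun T _ => ?_
    rw [heightDev]; ring
  have h3 : 0 ≤ (mean n fun T => height T) * ∑ T ∈ planeTrees n, (height T : ℝ) := by
    rw [mean]; positivity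
  rw [h2, sum_heightDev hn, mul_pow, mul_pow, Real.sq_sqrt (Nat.cast_nonneg _),
    Real.sq_sqrt hN.le]
  linarith

theorem sum_cherryDev_sq_le {n : ℕ} (hn : 1 ≤ n) :
    ∑ T ∈ planeTrees n, cherryDev n T ^ 2 ≤ (2 * √n * √(numTrees n)) ^ 2 := by
  have hn' : (1 : ℝ) ≤ n := by exact_mod_cast hn
  have h1 := sum_cherries_sub_sq_le n
  have h2 : ∀ T ∈ planeTrees n, cherryDev n T ^ 2 ≤ 2 * ((cherries T : ℝ) - n / 4) ^ 2 + 2 := by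
    intro T _
    rw [cherryDev, sq_abs]
    have e1 : (4 * (n / 4 : ℕ) : ℝ) ≤ n := by exact_mod_cast Nat.mul_div_le n 4
    have e2 : (n : ℝ) ≤ 4 * (n / 4 : ℕ) + 4 := by
      exact_mod_cast (by omega : n ≤ 4 * (n / 4) + 4)
    set q : ℝ := ((n / 4 : ℕ) : ℝ)
    set c : ℝ := (cherries T : ℝ)
    have e3 : ((n : ℝ) / 4 - q) ^ 2 ≤ 1 := by
      rw [sq_le_one_iff_abs_le_one, abs_le]; constructor <;> linarith
    nlinarith [sq_nonneg (c - n / 4 - (n / 4 - q))]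
  refine (Finset.sum_le_sum h2).trans ?_
  rw [Finset.sum_add_distrib, ← Finset.mul_sum, Finset.sum_const, nsmul_eq_mul, ← numTrees, mul_pow,
    mul_pow, Real.sq_sqrt (Nat.cast_nonneg _), Real.sq_sqrt (Nat.cast_nonneg _)]
  nlinarith [mul_le_mul_of_nonneg_right hn' (show (0 : ℝ) ≤ numTrees n from Nat.cast_nonneg _)]

theorem sum_one_sq (n : ℕ) : ∑ _T ∈ planeTrees n, (1 : ℝ) ^ 2 ≤ √(numTrees n) ^ 2 := by
  rw [Real.sq_sqrt (Nat.cast_nonneg _)]; simp [numTrees]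

theorem sum_abs_heightDev_le {n : ℕ} (hn : 1 ≤ n) :
    ∑ T ∈ planeTrees n, |heightDev n T| ≤ 16 * √n * numTrees n := by
  have h := sum_mul_le_of_sum_sq_le (planeTrees n) (fun T => |heightDev n T|) (fun _ => 1)
    (A := 16 * √n * √(numTrees n)) (B := √(numTrees n))
    (by positivity) (by positivity) (by simpa only [sq_abs] using sum_heightDev_sq_le hn)
    (sum_one_sq n)
  rw [mul_assoc, Real.mul_self_sqrt (Nat.cast_nonneg _)] at h
  simpa using h

theorem sum_cherryDev_le {n : ℕ} (hn : 1 ≤ n) :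
    ∑ T ∈ planeTrees n, cherryDev n T ≤ 2 * √n * numTrees n := by
  have h := sum_mul_le_of_sum_sq_le (planeTrees n) (fun T => cherryDev n T) (fun _ => 1)
    (A := 2 * √n * √(numTrees n)) (B := √(numTrees n))
    (by positivity) (by positivity) (sum_cherryDev_sq_le hn) (sum_one_sq n)
  rw [mul_assoc, Real.mul_self_sqrt (Nat.cast_nonneg _)] at h
  simpa using h

theorem sum_abs_heightDev_mul_cherryDev_le {n : ℕ} (hn : 1 ≤ n) :
    ∑ T ∈ planeTrees n, |heightDev n T| * cherryDev n T ≤ 32 * n * numTrees n := by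
  have h := sum_mul_le_of_sum_sq_le (planeTrees n) (fun T => |heightDev n T|) (cherryDev n)
    (A := 16 * √n * √(numTrees n)) (B := 2 * √n * √(numTrees n))
    (by positivity) (by positivity) (by simpa only [sq_abs] using sum_heightDev_sq_le hn)
    (sum_cherryDev_sq_le hn)
  refine h.trans (le_of_eq ?_)
  rw [show 16 * √(n : ℝ) * √(numTrees n : ℝ) * (2 * √n * √(numTrees n)) =
    32 * (√(n : ℝ) * √n) * (√(numTrees n : ℝ) * √(numTrees n)) by ring,
    Real.mul_self_sqrt (Nat.cast_nonneg _), Real.mul_self_sqrt (Nat.cast_nonneg _)]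

/-- The covariance of the height and `weightAt n k` over pairs of random plane trees. -/
noncomputable def weightCov (n k : ℕ) : ℝ :=
  (∑ T ∈ planeTrees n, ∑ S ∈ planeTrees n, heightDev n T * weightAt n k T S) / (numTrees n) ^ 2

theorem abs_weightCov_le {n : ℕ} (hn : 1 ≤ n) (k : ℕ) :
    |weightCov n k| ≤ 16 * √n * weightBound k := by
  have hN : (0 : ℝ) < numTrees n := by exact_mod_cast numTrees_pos hn
  rw [weightCov, abs_div, abs_of_nonneg (show (0 : ℝ) ≤ (numTrees n : ℝ) ^ 2 by positivity),
    div_le_iff₀ (by positivity)]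
  calc |∑ T ∈ planeTrees n, ∑ S ∈ planeTrees n, heightDev n T * weightAt n k T S| ≤
      ∑ T ∈ planeTrees n, ∑ S ∈ planeTrees n, |heightDev n T| * weightBound k := by
        refine (Finset.abs_sum_le_sum_abs _ _).trans (Finset.sum_le_sum fun T hT => ?_)
        refine (Finset.abs_sum_le_sum_abs _ _).trans (Finset.sum_le_sum fun S hS => ?_)
        rw [abs_mul, abs_of_nonneg (weightAt_nonneg _ _ _ _)]
        gcongr
        exact weightAt_le (mem_planeTrees.mp hT) (mem_planeTrees.mp hS)
    _ = (∑ T ∈ planeTrees n, |heightDev n T|) * weightBound k * numTrees n := by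
        rw [Finset.sum_mul, Finset.sum_mul]
        refine Finset.sum_congr rfl fun T _ => ?_
        rw [Finset.sum_const, nsmul_eq_mul, numTrees, mul_comm]
    _ ≤ (16 * √n * numTrees n) * weightBound k * numTrees n := by
        have := weightBound_nonneg k
        gcongr
        exact sum_abs_heightDev_le hn
    _ = _ := by ring

theorem abs_weightCov_le_of_le {n k : ℕ} (hn : 4 ≤ n) (hk : k ≤ n) :
    |weightCov n k| ≤ Real.exp k * (k : ℝ) ^ (k / 2) *
      (256 * √n * (Real.exp (4 / n) - 1) + 64) := by
  have hn1 : 1 ≤ n := by omega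
  have hn0 : (0 : ℝ) < n := by exact_mod_cast hn1
  have hN : (0 : ℝ) < numTrees n := by exact_mod_cast numTrees_pos hn1
  have hcard : ((planeTrees n).card : ℝ) = numTrees n := rfl
  set C : ℝ := Real.exp k * (k : ℝ) ^ (k / 2) with hC
  set δ : ℝ := Real.exp (4 / n) - 1 with hδ
  have hδ0 : 0 ≤ δ := sub_nonneg.mpr (Real.one_le_exp (by positivity))
  have hC0 : 0 ≤ C := by positivity
  have hzero : ∑ T ∈ planeTrees n, ∑ S ∈ planeTrees n, heightDev n T * weightAt n k T S =
      ∑ T ∈ planeTrees n, ∑ S ∈ planeTrees n,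
        heightDev n T * (weightAt n k T S - mainTerm n k) := by
    simp only [mul_sub, Finset.sum_sub_distrib, Finset.sum_const, nsmul_eq_mul]
    rw [← Finset.mul_sum, ← Finset.sum_mul, sum_heightDev hn1, zero_mul, mul_zero, sub_zero]
  rw [weightCov, hzero, abs_div, abs_of_nonneg (show (0 : ℝ) ≤ (numTrees n : ℝ) ^ 2 by positivity),
    div_le_iff₀ (by positivity)]
  have h1 := sum_abs_heightDev_le hn1
  have h2 := sum_cherryDev_le hn1
  have h3 := sum_abs_heightDev_mul_cherryDev_le hn1
  set G : ℝ := ∑ T ∈ planeTrees n, |heightDev n T|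
  set Q : ℝ := ∑ T ∈ planeTrees n, cherryDev n T
  set P : ℝ := ∑ T ∈ planeTrees n, |heightDev n T| * cherryDev n T
  have hQ0 : 0 ≤ Q := Finset.sum_nonneg fun T _ => abs_nonneg _
  have hsq : √(n : ℝ) * √n = n := Real.mul_self_sqrt hn0.le
  calc |∑ T ∈ planeTrees n, ∑ S ∈ planeTrees n,
        heightDev n T * (weightAt n k T S - mainTerm n k)| ≤
      ∑ T ∈ planeTrees n, ∑ S ∈ planeTrees n,
        |heightDev n T| * (C * (16 * δ + (cherryDev n T + cherryDev n S) / n)) := by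
        refine (Finset.abs_sum_le_sum_abs _ _).trans (Finset.sum_le_sum fun T hT => ?_)
        refine (Finset.abs_sum_le_sum_abs _ _).trans (Finset.sum_le_sum fun S hS => ?_)
        rw [abs_mul]
        gcongr
        exact abs_weightAt_sub_mainTerm_le hn hk (mem_planeTrees.mp hT) (mem_planeTrees.mp hS)
    _ = C * (16 * δ * G * numTrees n + (P * numTrees n + G * Q) / n) := by
        have e : ∀ T S, |heightDev n T| * (C * (16 * δ + (cherryDev n T + cherryDev n S) / n)) =
            C * 16 * δ * |heightDev n T| + C / n * (|heightDev n T| * cherryDev n T) +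
              C / n * (|heightDev n T| * cherryDev n S) := by intro T S; ring
        simp only [e, Finset.sum_add_distrib, Finset.sum_const, nsmul_eq_mul, ← Finset.mul_sum,
          ← Finset.sum_mul, hcard]
        ring
    _ ≤ C * (16 * δ * (16 * √n * numTrees n) * numTrees n +
        (32 * n * numTrees n * numTrees n + 16 * √n * numTrees n * (2 * √n * numTrees n)) / n) := by
        gcongr
    _ = C * (256 * √n * δ + (32 * n + 32 * (√n * √n)) / n) * (numTrees n) ^ 2 := by ring
    _ = _ := by
        rw [hsq, show (32 * (n : ℝ) + 32 * n) / n = 64 by field_simp; norm_num]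

theorem abs_tangleExp_sub_le {n : ℕ} (hn : 1 ≤ n) :
    |tangleExp n (fun t => height t.1) - mean n fun T => height T| ≤
      ∑ k ∈ Finset.range (n + 1), |weightCov n k| := by
  have hN : (0 : ℝ) < numTrees n := by exact_mod_cast numTrees_pos hn
  have hf : (0 : ℝ) < n ! := by positivity
  have hW : ∀ T S, (autWeight n T S : ℝ) = n ! * ∑ k ∈ Finset.range (n + 1), weightAt n k T S := by
    intro T S
    rw [autWeight_eq_sum, Nat.cast_sum, Finset.mul_sum]
    refine Finset.sum_congr rfl fun k _ => ?_
    rw [weightAt, mul_div_cancel₀ _ hf.ne']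
  set D : ℝ := ∑ T ∈ planeTrees n, ∑ S ∈ planeTrees n, (autWeight n T S : ℝ) with hD
  have hDle : n ! * (numTrees n : ℝ) ^ 2 ≤ D := by
    have : ∀ T ∈ planeTrees n, ∀ S ∈ planeTrees n, (n ! : ℝ) ≤ autWeight n T S := by
      intro T hT S hS
      rw [autWeight_eq_sum]
      exact_mod_cast (factorial_le_autWeightAt_zero (mem_planeTrees.mp hT)
        (mem_planeTrees.mp hS)).trans (Finset.single_le_sum (f := fun k => autWeightAt n k T S)
          (fun _ _ => Nat.zero_le _) (Finset.mem_range.mpr (Nat.succ_pos n)))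
    calc n ! * (numTrees n : ℝ) ^ 2 = ∑ T ∈ planeTrees n, ∑ S ∈ planeTrees n, (n ! : ℝ) := by
          simp only [Finset.sum_const, nsmul_eq_mul, numTrees]; ring
      _ ≤ D := Finset.sum_le_sum fun T hT => Finset.sum_le_sum fun S hS => this T hT S hS
  have hDpos : 0 < D := lt_of_lt_of_le (by positivity) hDle
  have hnum : (∑ T ∈ planeTrees n, (height T : ℝ) * ∑ S ∈ planeTrees n, (autWeight n T S : ℝ)) -
      (mean n fun T => height T) * D =
      n ! * (numTrees n : ℝ) ^ 2 * ∑ k ∈ Finset.range (n + 1), weightCov n k := by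
    have e1 : (numTrees n : ℝ) ^ 2 * ∑ k ∈ Finset.range (n + 1), weightCov n k =
        ∑ k ∈ Finset.range (n + 1), ∑ T ∈ planeTrees n, ∑ S ∈ planeTrees n,
          heightDev n T * weightAt n k T S := by
      rw [Finset.mul_sum]
      refine Finset.sum_congr rfl fun k _ => ?_
      rw [weightCov, mul_div_cancel₀ _ (by positivity)]
    rw [mul_assoc, e1, Finset.sum_comm, hD, Finset.mul_sum, Finset.mul_sum,
      ← Finset.sum_sub_distrib]
    refine Finset.sum_congr rfl fun T _ => ?_
    rw [← sub_mul, ← heightDev, Finset.sum_comm, Finset.mul_sum, Finset.mul_sum]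
    refine Finset.sum_congr rfl fun S _ => ?_
    rw [hW, ← Finset.mul_sum]; ring
  have e : tangleExp n (fun t => height t.1) - (mean n fun T => (height T : ℝ)) =
      n ! * (numTrees n : ℝ) ^ 2 * (∑ k ∈ Finset.range (n + 1), weightCov n k) / D := by
    rw [tangleExp_eq, ← hD, ← hnum, sub_div, mul_div_cancel_right₀ _ hDpos.ne']
  rw [e, abs_div, abs_mul, abs_of_pos hDpos,
    abs_of_nonneg (show (0 : ℝ) ≤ n ! * (numTrees n : ℝ) ^ 2 by positivity), div_le_iff₀ hDpos]
  have h1 := Finset.abs_sum_le_sum_abs (fun k => weightCov n k) (Finset.range (n + 1))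
  calc _ ≤ D * ∑ k ∈ Finset.range (n + 1), |weightCov n k| :=
        mul_le_mul hDle h1 (abs_nonneg _) hDpos.le
    _ = _ := mul_comm _ _

theorem tendsto_weightCov (k : ℕ) :
    Filter.Tendsto (fun n : ℕ => |weightCov n k| / √n) Filter.atTop (nhds 0) := by
  have hδ : Filter.Tendsto (fun n : ℕ => Real.exp (4 / n) - 1) Filter.atTop (nhds 0) := by
    have h1 : Filter.Tendsto (fun n : ℕ => (4 : ℝ) / n) Filter.atTop (nhds 0) :=
      tendsto_const_div_atTop_nhds_zero_nat 4
    have h2 := (Real.continuous_exp.tendsto 0).comp h1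
    rw [Real.exp_zero] at h2
    simpa using h2.sub_const 1
  have hb : Filter.Tendsto (fun n : ℕ => Real.exp k * (k : ℝ) ^ (k / 2) *
      (256 * (Real.exp (4 / n) - 1) + 64 * (1 / √n))) Filter.atTop (nhds 0) := by
    have := ((hδ.const_mul 256).add (tendsto_inv_sqrt.const_mul 64)).const_mul
      (Real.exp k * (k : ℝ) ^ (k / 2))
    simpa using this
  refine squeeze_zero' (Filter.Eventually.of_forall fun n => by positivity) ?_ hb
  filter_upwards [Filter.eventually_ge_atTop (max 4 k)] with n hn
  have h4 : 4 ≤ n := (le_max_left _ _).trans hn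
  have hs : 0 < √(n : ℝ) := Real.sqrt_pos.mpr (by exact_mod_cast (by omega : 0 < n))
  rw [div_le_iff₀ hs]
  refine (abs_weightCov_le_of_le h4 ((le_max_right _ _).trans hn)).trans (le_of_eq ?_)
  field_simp

theorem tendsto_tangleExp_height :
    Filter.Tendsto (fun n : ℕ => tangleExp n (fun t => height t.1) / √n) Filter.atTop
      (nhds (2 * √Real.pi)) := by
  have hbound : ∀ᶠ n : ℕ in Filter.atTop, ∀ k, ‖|weightCov n k| / √(n : ℝ)‖ ≤ 16 * weightBound k := by
    filter_upwards [Filter.eventually_ge_atTop 1] with n hn k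
    have hs : 0 < √(n : ℝ) := Real.sqrt_pos.mpr (by exact_mod_cast hn)
    rw [Real.norm_of_nonneg (by positivity), div_le_iff₀ hs]
    have := abs_weightCov_le hn k
    linarith
  have hsum : Summable fun k => 16 * weightBound k := summable_weightBound.mul_left 16
  have hT := tendsto_tsum_of_dominated_convergence hsum tendsto_weightCov hbound
  rw [tsum_zero] at hT
  have hdiff : Filter.Tendsto (fun n : ℕ => (tangleExp n (fun t => height t.1) -
      mean n fun T => height T) / √n) Filter.atTop (nhds 0) := by
    refine squeeze_zero_norm' ?_ hT
    filter_upwards [Filter.eventually_ge_atTop 1, hbound] with n hn hb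
    have hs : 0 < √(n : ℝ) := Real.sqrt_pos.mpr (by exact_mod_cast hn)
    have hsn : Summable fun k => |weightCov n k| / √(n : ℝ) := Summable.of_norm_bounded hsum hb
    refine le_trans ?_ (hsn.sum_le_tsum (Finset.range (n + 1)) fun k _ => by positivity)
    rw [Real.norm_eq_abs, abs_div, abs_of_pos hs, ← Finset.sum_div]
    exact div_le_div_of_nonneg_right (abs_tangleExp_sub_le hn) hs.le
  have := tendsto_mean_height.add hdiff
  rw [add_zero] at this
  refine this.congr fun n => ?_
  rw [← add_div]; ring

end PTree

open PTree in
/-- Corollary 6 (mean): the average height of the left tree of a random tanglegram of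
size `n` is asymptotically `2√(πn)`. -/
theorem mean_height :
    Filter.Tendsto
      (fun n : ℕ => tangleExp n (fun t => height t.1) / Real.sqrt n)
      Filter.atTop (nhds (2 * Real.sqrt Real.pi)) := by
  exact tendsto_tangleExp_height
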